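/- There exists a fixed deterministic 3-counter automaton A, working in space polynomial in the bit length of its input, such that the following problem is PSPACE-complete: given an input vector n ∈ ℕ³ (encoded in binary), does A have a run from the configuration (q₀, n) to the configuration (q_f, 0, 0, 0)? -/

import Mathlib

/-!
STATEMENT 13: There exists a fixed deterministic 3-counter automaton A,
working in space polynomial in the bit length of its input, such that the
following problem is PSPACE-complete: given an input vector n ∈ ℕ³ (encoded in
binary), does A have a run from the configuration (q₀, n) to the configuration
(q_f, 0, 0, 0)?
-/

/-- A tape symbol: `none` is the blank symbol. -/
abbrev TapeSym := Option Bool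

/-- A deterministic one-tape Turing machine with tape alphabet `TapeSym`
(inputs are binary words).  `trans q a = none` means the machine halts;
`trans q a = some (q', b, d)` means: write `b`, move right if `d` and left
otherwise, and go to state `q'`. -/
structure TM where
  nstates : ℕ
  q0 : Fin nstates
  qacc : Fin nstates
  trans : Fin nstates → TapeSym → Option (Fin nstates × TapeSym × Bool)

/-- A configuration of a one-tape Turing machine. -/
structure TMCfg (M : TM) where
  q : Fin M.nstates
  tape : ℤ → TapeSym
  pos : ℤ

/-- The (deterministic) one-step function; `none` means the machine has halted. -/
def TM.stepCfg (M : TM) (c : TMCfg M) : Option (TMCfg M) :=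
  match M.trans c.q (c.tape c.pos) with
  | none => none
  | some (q', a, d) =>
      some ⟨q', Function.update c.tape c.pos a, if d then c.pos + 1 else c.pos - 1⟩

/-- The initial configuration on input word `w`. -/
def TM.initCfg (M : TM) (w : List Bool) : TMCfg M :=
  ⟨M.q0, fun i => if i < 0 then none else w[i.toNat]?, 0⟩

/-- The configuration after `n` steps on input `w` (`none` if the machine has
halted before). -/
def TM.run (M : TM) (w : List Bool) : ℕ → Option (TMCfg M)
  | 0 => some (M.initCfg w)
  | n + 1 => (M.run w n).bind M.stepCfg

/-- `M` halts on input `w`. -/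
def TM.Halts (M : TM) (w : List Bool) : Prop :=
  ∃ (n : ℕ) (c : TMCfg M), M.run w n = some c ∧ M.stepCfg c = none

/-- `M` halts on `w` in the accepting state. -/
def TM.Accepts (M : TM) (w : List Bool) : Prop :=
  ∃ (n : ℕ) (c : TMCfg M), M.run w n = some c ∧ M.stepCfg c = none ∧ c.q = M.qacc

/-- `M` halts on `w` in a non-accepting state. -/
def TM.Rejects (M : TM) (w : List Bool) : Prop :=
  ∃ (n : ℕ) (c : TMCfg M), M.run w n = some c ∧ M.stepCfg c = none ∧ c.q ≠ M.qacc

/-- `M` uses at most `s` tape cells on input `w`: all head positions along the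
run lie in an interval of length `s`. -/
def TM.RunsInSpace (M : TM) (w : List Bool) (s : ℕ) : Prop :=
  ∃ lo : ℤ, ∀ (n : ℕ) (c : TMCfg M), M.run w n = some c →
    lo ≤ c.pos ∧ c.pos < lo + s

/-- `M` is a polynomial-space Turing machine. -/
def TM.PolySpace (M : TM) : Prop :=
  ∃ p : Polynomial ℕ, ∀ w : List Bool, M.RunsInSpace w (Polynomial.eval w.length p)

/-- `M` decides the language `L` (halting on every input). -/
def TM.Decides (M : TM) (L : Set (List Bool)) : Prop :=
  ∀ w : List Bool, ∃ (n : ℕ) (c : TMCfg M),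
    M.run w n = some c ∧ M.stepCfg c = none ∧ (c.q = M.qacc ↔ w ∈ L)

/-- `M` decides `L` within time `T` (in the length of the input). -/
def TM.DecidesInTime (M : TM) (L : Set (List Bool)) (T : ℕ → ℕ) : Prop :=
  ∀ w : List Bool, ∃ (n : ℕ) (c : TMCfg M), n ≤ T w.length ∧
    M.run w n = some c ∧ M.stepCfg c = none ∧ (c.q = M.qacc ↔ w ∈ L)

/-- `M` computes the word function `f` within time `T`: on input `w` it halts
after at most `T |w|` steps with `f w` written on the tape starting at
position 0 (followed by blanks). -/
def TM.ComputesInTime (M : TM) (f : List Bool → List Bool) (T : ℕ → ℕ) : Prop :=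
  ∀ w : List Bool, ∃ (n : ℕ) (c : TMCfg M), n ≤ T w.length ∧
    M.run w n = some c ∧ M.stepCfg c = none ∧
    ∀ i : ℕ, c.tape (i : ℤ) = (f w)[i]?

/-- `f` is computable in polynomial time. -/
def PolyTimeComputable (f : List Bool → List Bool) : Prop :=
  ∃ (M : TM) (p : Polynomial ℕ), M.ComputesInTime f fun n => Polynomial.eval n p

/-- `L₁` reduces to `L₂` in polynomial time. -/
def PolyTimeReducible (L₁ L₂ : Set (List Bool)) : Prop :=
  ∃ f : List Bool → List Bool, PolyTimeComputable f ∧ ∀ w, w ∈ L₁ ↔ f w ∈ L₂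

/-- The class P of polynomial-time decidable languages. -/
def InP (L : Set (List Bool)) : Prop :=
  ∃ (M : TM) (p : Polynomial ℕ), M.DecidesInTime L fun n => Polynomial.eval n p

/-- The class PSPACE of languages decidable by polynomial-space deterministic
Turing machines. -/
def InPSpace (L : Set (List Bool)) : Prop :=
  ∃ M : TM, M.PolySpace ∧ M.Decides L

/-- `L` is PSPACE-hard (w.r.t. polynomial-time reductions). -/
def PSpaceHard (L : Set (List Bool)) : Prop :=
  ∀ L' : Set (List Bool), InPSpace L' → PolyTimeReducible L' L

/-- `L` is PSPACE-complete. -/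
def PSpaceComplete (L : Set (List Bool)) : Prop :=
  InPSpace L ∧ PSpaceHard L
/-- A `d`-counter automaton: a finite-state machine with `d` counters over ℕ;
each transition carries a vector of counter updates and optionally a counter
that is tested for zero (`none` meaning no test). -/
structure CA (d : ℕ) where
  State : Type
  finState : Finite State
  q0 : State
  qf : State
  trans : Set (State × (Fin d → ℤ) × Option (Fin d) × State)

/-- The transition `tr` is enabled in configuration `c`. -/
def CA.Enabled {d : ℕ} (A : CA d) (tr : A.State × (Fin d → ℤ) × Option (Fin d) × A.State)
    (c : A.State × (Fin d → ℕ)) : Prop :=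
  tr ∈ A.trans ∧ tr.1 = c.1 ∧ (∀ j, 0 ≤ (c.2 j : ℤ) + tr.2.1 j) ∧
    (∀ j, tr.2.2.1 = some j → c.2 j = 0)

/-- One step of the counter automaton. -/
def CA.Step {d : ℕ} (A : CA d) (c c' : A.State × (Fin d → ℕ)) : Prop :=
  ∃ tr, A.Enabled tr c ∧ c'.1 = tr.2.2.2 ∧ ∀ j, (c'.2 j : ℤ) = (c.2 j : ℤ) + tr.2.1 j

/-- A counter automaton is deterministic if from every configuration at most
one transition is enabled. -/
def CA.Deterministic {d : ℕ} (A : CA d) : Prop :=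
  ∀ c tr₁ tr₂, A.Enabled tr₁ c → A.Enabled tr₂ c → tr₁ = tr₂

/-- Reachability between configurations. -/
def CA.Reaches {d : ℕ} (A : CA d) : (A.State × (Fin d → ℕ)) → (A.State × (Fin d → ℕ)) → Prop :=
  Relation.ReflTransGen A.Step

/-- `A` accepts an input vector: its run from `(q₀, v)` reaches the final
state `q_f` (which has no outgoing transitions). -/
def CA.Accepts {d : ℕ} (A : CA d) (v : Fin d → ℕ) : Prop :=
  ∃ m : Fin d → ℕ, A.Reaches (A.q0, v) (A.qf, m)

/-- Zero-reachability: `A` has a run from `(q₀, v)` to `(q_f, 0)`. -/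
def CA.ZeroReach {d : ℕ} (A : CA d) (v : Fin d → ℕ) : Prop :=
  A.Reaches (A.q0, v) (A.qf, fun _ => 0)

/-- `A` works in space `s` on input `v`: the bit length of every counter value
along the run from `(q₀, v)` is at most `s`. -/
def CA.SpaceBounded {d : ℕ} (A : CA d) (v : Fin d → ℕ) (s : ℕ) : Prop :=
  ∀ c, A.Reaches (A.q0, v) c → ∀ j, Nat.size (c.2 j) ≤ s
/-- Unary encoding of a natural number (used as a self-delimiting prefix). -/
def encodeNatU (n : ℕ) : List Bool := List.replicate n true ++ [false]

/-- Binary encoding of a vector of natural numbers: each entry is written in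
binary (via `Nat.bits`), preceded by a self-delimiting length prefix. -/
def encodeVec {d : ℕ} (v : Fin d → ℕ) : List Bool :=
  (List.ofFn fun j : Fin d => encodeNatU (Nat.bits (v j)).length ++ Nat.bits (v j)).flatten


/-! ## Bounded paths of transition systems -/

/-- `QPath R W n a b`: an `n`-step path from `a` to `b`, all of whose configurations satisfy `W`. -/
def QPath {σ : Type} (R : σ → σ → Prop) (W : σ → Prop) : ℕ → σ → σ → Prop
  | 0, a, b => a = b ∧ W a
  | n + 1, a, b => W a ∧ ∃ c, R a c ∧ QPath R W n c b

namespace QPath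
variable {σ : Type} {R : σ → σ → Prop} {W W' : σ → Prop}

theorem refl {a : σ} (h : W a) : QPath R W 0 a a := ⟨rfl, h⟩

theorem single {a b : σ} (h : R a b) (ha : W a) (hb : W b) : QPath R W 1 a b :=
  ⟨ha, b, h, rfl, hb⟩

theorem cons {a b c : σ} {n : ℕ} (h : R a b) (ha : W a) (p : QPath R W n b c) :
    QPath R W (n + 1) a c := ⟨ha, b, h, p⟩

theorem trans {n m : ℕ} {a b c : σ} (p : QPath R W n a b) (q : QPath R W m b c) :
    QPath R W (n + m) a c := by
  induction n generalizing a with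
  | zero => obtain ⟨rfl, _⟩ := p; simpa using q
  | succ n ih =>
    obtain ⟨h, d, hd, p⟩ := p
    rw [Nat.add_right_comm]
    exact ⟨h, d, hd, ih p⟩

theorem mono (hW : ∀ x, W x → W' x) {n : ℕ} {a b : σ} (p : QPath R W n a b) : QPath R W' n a b := by
  induction n generalizing a with
  | zero => exact ⟨p.1, hW _ p.2⟩
  | succ n ih =>
    obtain ⟨h, d, hd, p⟩ := p
    exact ⟨hW _ h, d, hd, ih p⟩

theorem start {n : ℕ} {a b : σ} (p : QPath R W n a b) : W a := by
  cases n with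
  | zero => exact p.2
  | succ n => exact p.1

theorem last {n : ℕ} {a b : σ} (p : QPath R W n a b) : W b := by
  induction n generalizing a with
  | zero => obtain ⟨rfl, h⟩ := p; exact h
  | succ n ih => obtain ⟨h, d, hd, p⟩ := p; exact ih p

theorem toRTG {n : ℕ} {a b : σ} (p : QPath R W n a b) : Relation.ReflTransGen R a b := by
  induction n generalizing a with
  | zero => obtain ⟨rfl, h⟩ := p; exact .refl
  | succ n ih => obtain ⟨h, d, hd, p⟩ := p; exact .head hd (ih p)

/-- For deterministic systems, everything reachable from the start of a path that ends in a stuck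
configuration lies on the path. -/
theorem reach (hdet : ∀ a b c, R a b → R a c → b = c) {n : ℕ} {a b c : σ} (p : QPath R W n a b)
    (hb : ∀ d, ¬ R b d) (h : Relation.ReflTransGen R a c) :
    W c ∧ Relation.ReflTransGen R c b := by
  induction n generalizing a with
  | zero =>
    obtain ⟨rfl, hw⟩ := p
    rcases Relation.ReflTransGen.cases_head h with rfl | ⟨d, hd, _⟩
    · exact ⟨hw, .refl⟩
    · exact absurd hd (hb _)
  | succ n ih =>
    have p0 := p
    obtain ⟨hw, d, hd, p⟩ := p
    rcases Relation.ReflTransGen.cases_head h with rfl | ⟨d', hd', h'⟩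
    · exact ⟨hw, p0.toRTG⟩
    · obtain rfl := hdet _ _ _ hd hd'
      exact ih p h'

theorem unique (hdet : ∀ a b c, R a b → R a c → b = c) {n : ℕ} {a b c : σ} (p : QPath R W n a b)
    (hb : ∀ d, ¬ R b d) (h : Relation.ReflTransGen R a c) (hc : ∀ d, ¬ R c d) : c = b := by
  rcases Relation.ReflTransGen.cases_head (p.reach hdet hb h).2 with rfl | ⟨d, hd, _⟩
  · rfl
  · exact absurd hd (hc _)

end QPath

/-! ## Queue machines -/

/-- Instructions of a queue machine: pop from the front of the first list, push to the back of the
second list, flip the lists (when the first one is empty), halt. -/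
inductive QI (S : Type) where
  | pop (e : S) (f : Bool → S)
  | push (b : Bool) (s : S)
  | flip (s : S)
  | halt (acc : Bool)

def QI.map {S T : Type} (g : S → T) : QI S → QI T
  | .pop e f => .pop (g e) (fun b => g (f b))
  | .push b s => .push b (g s)
  | .flip s => .flip (g s)
  | .halt a => .halt a

structure QM where
  S : Type
  fin : Finite S
  s0 : S
  instr : S → QI S

structure QC (S : Type) where
  s : S
  u : List Bool
  v : List Bool

def QC.map {S T : Type} (g : S → T) (c : QC S) : QC T := ⟨g c.s, c.u, c.v⟩

/-- One step of an instruction. -/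
def QI.exec {S : Type} : QI S → List Bool → List Bool → Option (QC S)
  | .pop e f, u, v => match u with
    | [] => some ⟨e, [], v⟩
    | b :: u => some ⟨f b, u, v⟩
  | .push b s, u, v => some ⟨s, u, v ++ [b]⟩
  | .flip s, u, v => match u with
    | [] => some ⟨s, v, []⟩
    | _ :: _ => none
  | .halt _, _, _ => none

def QM.R (M : QM) (c d : QC M.S) : Prop := (M.instr c.s).exec c.u c.v = some d

theorem QM.det (M : QM) (a b c : QC M.S) (h : M.R a b) (h' : M.R a c) : b = c := by
  unfold QM.R at *; rw [h] at h'; exact Option.some.inj h'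

/-- The window predicate: total list length at most `L`. -/
def QW {S : Type} (L : ℕ) (c : QC S) : Prop := c.u.length + c.v.length ≤ L

/-- From input `x`, `M` halts after `n` steps with verdict `b`, output `y`,
using lists of total length at most `L`. -/
def QM.HaltsIn (M : QM) (n L : ℕ) (x : List Bool) (b : Bool) (y v : List Bool) : Prop :=
  ∃ h : M.S, M.instr h = .halt b ∧ QPath M.R (QW L) n ⟨M.s0, x, []⟩ ⟨h, y, v⟩

theorem QI.exec_map {S T : Type} (g : S → T) (i : QI S) (u v : List Bool) :
    (i.map g).exec u v = (i.exec u v).map (QC.map g) := by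
  cases i <;> cases u <;> rfl

/-- Sequential composition. -/
def QM.comp (M N : QM) : QM where
  S := M.S ⊕ N.S
  fin := by have := M.fin; have := N.fin; infer_instance
  s0 := .inl M.s0
  instr
    | .inl s => match M.instr s with
      | .halt true => (N.instr N.s0).map .inr
      | .halt false => .halt false
      | i => i.map .inl
    | .inr s => (N.instr s).map .inr

theorem QM.comp_inl {M N : QM} {a b : QC M.S} (h : M.R a b) :
    (M.comp N).R (a.map .inl) (b.map .inl) := by
  have h0 := h
  unfold QM.R at *
  have : (M.comp N).instr (a.map Sum.inl).s = (M.instr a.s).map .inl := by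
    simp only [QM.comp, QC.map]
    cases hi : M.instr a.s with
    | halt acc => rw [hi] at h; cases acc <;> simp [QI.exec] at h
    | _ => rfl
  refine Eq.trans (b := (QI.map Sum.inl (M.instr a.s)).exec a.u a.v) ?_ ?_
  · exact congrArg (fun i => QI.exec i a.u a.v) this
  · rw [QI.exec_map, h]; rfl

theorem QM.comp_inr {M N : QM} {a b : QC N.S} (h : N.R a b) :
    (M.comp N).R (a.map .inr) (b.map .inr) := by
  unfold QM.R at *
  refine Eq.trans (b := (QI.map Sum.inr (N.instr a.s)).exec a.u a.v) rfl ?_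
  rw [QI.exec_map, h]; rfl

theorem QPath.map {σ τ : Type} {R : σ → σ → Prop} {R' : τ → τ → Prop} {W : σ → Prop}
    {W' : τ → Prop} (g : σ → τ) (hR : ∀ a b, R a b → R' (g a) (g b)) (hW : ∀ a, W a → W' (g a))
    {n : ℕ} {a b : σ} (p : QPath R W n a b) : QPath R' W' n (g a) (g b) := by
  induction n generalizing a with
  | zero => exact ⟨congrArg g p.1, hW _ p.2⟩
  | succ n ih =>
    obtain ⟨h, d, hd, p⟩ := p
    exact ⟨hW _ h, g d, hR _ _ hd, ih p⟩

theorem QM.HaltsIn.mono {M : QM} {n L L' : ℕ} {x y v : List Bool} {b : Bool}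
    (h : M.HaltsIn n L x b y v) (hL : L ≤ L') : M.HaltsIn n L' x b y v := by
  obtain ⟨s, hs, p⟩ := h
  exact ⟨s, hs, p.mono fun c hc => le_trans hc hL⟩

theorem QM.HaltsIn.comp_false {M N : QM} {n L : ℕ} {x y v : List Bool}
    (h : M.HaltsIn n L x false y v) : (M.comp N).HaltsIn n L x false y v := by
  obtain ⟨s, hs, p⟩ := h
  refine ⟨.inl s, ?_, p.map (R' := (M.comp N).R) (W' := QW L)
    (QC.map Sum.inl) (fun _ _ => QM.comp_inl) (fun _ h => h)⟩
  simp [QM.comp, hs]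

theorem QM.HaltsIn.comp_true {M N : QM} {n m L : ℕ} {x y z v : List Bool} {b : Bool}
    (h : M.HaltsIn n L x true y []) (h' : N.HaltsIn m L y b z v) :
    (M.comp N).HaltsIn (n + m) L x b z v := by
  obtain ⟨s, hs, p⟩ := h
  obtain ⟨t, ht, q⟩ := h'
  have p' : QPath (M.comp N).R (QW L) n ⟨(M.comp N).s0, x, []⟩ ⟨.inl s, y, []⟩ :=
    p.map (R' := (M.comp N).R) (W' := QW L) (QC.map Sum.inl) (fun _ _ => QM.comp_inl)
      (fun _ h => h)
  have hi : (M.comp N).instr (.inl s) = (N.instr N.s0).map .inr := by simp [QM.comp, hs]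
  cases m with
  | zero =>
    obtain ⟨he, hw⟩ := q
    injection he with h1 h2 h3
    subst h1 h2 h3
    refine ⟨.inl s, ?_, p'⟩
    rw [hi, ht]; rfl
  | succ m =>
    obtain ⟨hw, d, hd, q⟩ := q
    refine ⟨.inr t, ?_, p'.trans ⟨p'.last, d.map .inr, ?_,
      q.map (R' := (M.comp N).R) (W' := QW L) (QC.map Sum.inr) (fun _ _ => QM.comp_inr)
      (fun _ h => h)⟩⟩
    · refine Eq.trans (b := (N.instr t).map Sum.inr) rfl ?_
      rw [ht]; rfl
    · unfold QM.R at *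
      refine Eq.trans (b := (QI.map (Sum.inr (α := M.S)) (N.instr N.s0)).exec y []) ?_ ?_
      · exact congrArg (fun i => QI.exec i y []) hi
      · rw [QI.exec_map, hd]; rfl


/-! ## Turing machines over arbitrary finite state types, zipper configurations -/

noncomputable def stEq (S : Type) (h : Finite S) : S ≃ Fin (Nat.card S) :=
  have := h; Finite.equivFin S

noncomputable def mkTM (S : Type) (h : Finite S) (s0 acc : S)
    (g : S → Option Bool → Option (S × Option Bool × Bool)) : TM where
  nstates := Nat.card S
  q0 := stEq S h s0
  qacc := stEq S h acc
  trans q a := (g ((stEq S h).symm q) a).map fun t => (stEq S h t.1, t.2.1, t.2.2)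

/-- Tape with content `l` starting at position `-1`. -/
def tp (l : List (Option Bool)) (i : ℤ) : Option Bool :=
  if i < -1 then none else (l[(i + 1).toNat]?).join

theorem tp_none (l : List (Option Bool)) : tp (l ++ [none]) = tp l := by
  funext i
  unfold tp
  split_ifs with h
  · rfl
  · generalize (i + 1).toNat = k
    rcases lt_trichotomy k l.length with h | h | h
    · rw [List.getElem?_append_left h]
    · subst h; simp
    · rw [List.getElem?_eq_none (by simp; omega), List.getElem?_eq_none (by omega)]

theorem tp_read (l : List (Option Bool)) (a : Option Bool) (r : List (Option Bool)) :
    tp (l.reverse ++ a :: r) ((l.length : ℤ) - 1) = a := by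
  unfold tp
  rw [if_neg (by omega)]
  simp

theorem tp_write (l : List (Option Bool)) (a b : Option Bool) (r : List (Option Bool)) :
    Function.update (tp (l.reverse ++ a :: r)) ((l.length : ℤ) - 1) b
      = tp (l.reverse ++ b :: r) := by
  funext i
  by_cases h : i = (l.length : ℤ) - 1
  · subst h; rw [tp_read]; simp
  · rw [Function.update_of_ne h]
    unfold tp
    split_ifs with h'
    · rfl
    · have : (i + 1).toNat ≠ l.length := by omega
      generalize (i + 1).toNat = k at *
      rcases Nat.lt_or_ge k l.length with h | h
      · rw [List.getElem?_append_left (by simpa), List.getElem?_append_left (by simpa)]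
      · obtain ⟨m, rfl⟩ : ∃ m, k = l.length + (m + 1) := ⟨k - l.length - 1, by omega⟩
        rw [List.getElem?_append_right (by simp), List.getElem?_append_right (by simp)]
        simp

section
variable {S : Type} {h : Finite S} {s0 acc : S}
  {g : S → Option Bool → Option (S × Option Bool × Bool)}

/-- Zipper configuration. -/
noncomputable def ZC (h : Finite S) (s0 acc : S)
    (g : S → Option Bool → Option (S × Option Bool × Bool)) (s : S) (l r : List (Option Bool)) :
    TMCfg (mkTM S h s0 acc g) :=
  ⟨stEq S h s, tp (l.reverse ++ r), (l.length : ℤ) - 1⟩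

def TM.Rel (M : TM) (c d : TMCfg M) : Prop := M.stepCfg c = some d

theorem TM.Rel.det (M : TM) (a b c : TMCfg M) (h : M.Rel a b) (h' : M.Rel a c) : b = c := by
  unfold TM.Rel at *; rw [h] at h'; exact Option.some.inj h'

def TMW {M : TM} (K : ℕ) (c : TMCfg M) : Prop := -1 ≤ c.pos ∧ c.pos ≤ K

theorem ZC.W {s : S} {l r : List (Option Bool)} {K : ℕ} (hl : l.length ≤ K + 1) :
    TMW K (ZC h s0 acc g s l r) := by
  unfold TMW ZC; dsimp only; omega

theorem ZC.none {s : S} {l r : List (Option Bool)} :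
    ZC h s0 acc g s l (r ++ [none]) = ZC h s0 acc g s l r := by
  unfold ZC; rw [← List.append_assoc, tp_none]

theorem ZC.nil {s : S} {l : List (Option Bool)} :
    ZC h s0 acc g s l [] = ZC h s0 acc g s l [Option.none] := (ZC.none (r := [])).symm

theorem ZC.right {s s' : S} {a b : Option Bool} {l r : List (Option Bool)}
    (hg : g s a = some (s', b, true)) :
    (mkTM S h s0 acc g).Rel (ZC h s0 acc g s l (a :: r)) (ZC h s0 acc g s' (b :: l) r) := by
  unfold TM.Rel TM.stepCfg ZC
  simp only [tp_read]
  simp only [mkTM, Equiv.symm_apply_apply, hg, Option.map_some, tp_write, if_true]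
  simp

theorem ZC.left {s s' : S} {a b x : Option Bool} {l r : List (Option Bool)}
    (hg : g s a = some (s', b, false)) :
    (mkTM S h s0 acc g).Rel (ZC h s0 acc g s (x :: l) (a :: r))
      (ZC h s0 acc g s' l (x :: b :: r)) := by
  unfold TM.Rel TM.stepCfg ZC
  simp only [tp_read]
  simp only [mkTM, Equiv.symm_apply_apply, hg, Option.map_some, tp_write]
  simp

/-- Running to the right over a list of nonblank symbols. -/
theorem ZC.runR {s : S} (hg : ∀ y : Bool, g s (some y) = some (s, some y, true)) {K : ℕ}
    (xs : List Bool) (l r : List (Option Bool)) (hK : l.length + xs.length ≤ K + 1) :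
    QPath (mkTM S h s0 acc g).Rel (TMW K) xs.length (ZC h s0 acc g s l (xs.map some ++ r))
      (ZC h s0 acc g s ((xs.map some).reverse ++ l) r) := by
  induction xs generalizing l with
  | nil => exact QPath.refl (ZC.W (by simpa using hK))
  | cons x xs ih =>
    simp only [List.length_cons] at hK
    have := ih (some x :: l) (by simp; omega)
    refine QPath.cons (ZC.right (hg x)) (ZC.W (by omega)) ?_
    simpa using this

/-- Zipper configuration with the head on the first element of `ll`. -/
noncomputable def ZL (h : Finite S) (s0 acc : S)
    (g : S → Option Bool → Option (S × Option Bool × Bool)) (s : S) :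
    (ll r : List (Option Bool)) → TMCfg (mkTM S h s0 acc g)
  | [], r => ZC h s0 acc g s [] r
  | x :: l, r => ZC h s0 acc g s l (x :: r)

theorem ZL.left {s s' : S} {a b : Option Bool} {l r : List (Option Bool)} (hl : l ≠ [])
    (hg : g s a = some (s', b, false)) :
    (mkTM S h s0 acc g).Rel (ZL h s0 acc g s (a :: l) r)
      (ZL h s0 acc g s' l (b :: r)) := by
  cases l with
  | nil => exact absurd rfl hl
  | cons x l => exact ZC.left hg

theorem ZL.W {s : S} {l r : List (Option Bool)} {K : ℕ} (hl : l.length ≤ K + 2) :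
    TMW K (ZL h s0 acc g s l r) := by
  cases l with
  | nil => exact ZC.W (by simp)
  | cons x l => exact ZC.W (by simpa using hl)

/-- Running to the left over a list of nonblank symbols; the head starts on the first one. -/
theorem ZL.run {s : S} (hg : ∀ y : Bool, g s (some y) = some (s, some y, false)) {K : ℕ}
    (xs : List Bool) (l r : List (Option Bool)) (hl : l ≠ [])
    (hK : l.length + xs.length ≤ K + 2) :
    QPath (mkTM S h s0 acc g).Rel (TMW K) xs.length
      (ZL h s0 acc g s (xs.map some ++ l) r)
      (ZL h s0 acc g s l ((xs.map some).reverse ++ r)) := by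
  induction xs generalizing r with
  | nil => exact QPath.refl (ZL.W (by simpa using hK))
  | cons x xs ih =>
    simp only [List.length_cons] at hK
    have := ih (some x :: r) (by omega)
    refine QPath.cons (ZL.left (by simp [hl]) (hg x)) (ZL.W (by simp; omega)) ?_
    simpa using this

/-- Shifting to the right while moving left. -/
theorem ZL.runS {s : Option Bool → S}
    (hg : ∀ (c : Option Bool) (y : Bool), g (s c) (some y) = some (s (some y), c, false)) {K : ℕ}
    {s' : S} (hg' : ∀ (c : Option Bool), g (s c) none = some (s', c, false))
    (xs : List Bool) (l r : List (Option Bool)) (hl : l ≠ []) (c : Option Bool)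
    (hK : l.length + xs.length + 1 ≤ K + 2) :
    QPath (mkTM S h s0 acc g).Rel (TMW K) (xs.length + 1)
      (ZL h s0 acc g (s c) (xs.map some ++ none :: l) r)
      (ZL h s0 acc g s' l ((xs.map some).reverse ++ c :: r)) := by
  induction xs generalizing r c with
  | nil =>
    exact QPath.single (ZL.left hl (hg' c)) (ZL.W (by simpa using hK))
      (ZL.W (by simp at hK; omega))
  | cons x xs ih =>
    simp only [List.length_cons] at hK
    have := ih (c :: r) (some x) (by omega)
    refine QPath.cons (ZL.left (by simp) (hg c x)) (ZL.W (by simp; omega)) ?_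
    simpa using this
end

/-! ## Simulation of queue machines by Turing machines -/

inductive TS (S : Type) where
  | st (s : S) | bk (s : S) | a1 (b : Bool) (s : S) | a2 (b : Bool) (s : S)
  | a3 (s : S) | a4 (s : S) | d1 (s : S) | d2 (s : S)
  | d3 (s : S) (c : Option Bool) | d4 (s : S) (c : Option Bool) | e2 (s : S) | hl (b : Bool)

def TS.code {S : Type} : TS S → Fin 12 × Option Bool × Option S
  | st s => (0, none, some s)
  | bk s => (1, none, some s)
  | a1 b s => (2, some b, some s)
  | a2 b s => (3, some b, some s)
  | a3 s => (4, none, some s)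
  | a4 s => (5, none, some s)
  | d1 s => (6, none, some s)
  | d2 s => (7, none, some s)
  | d3 s c => (8, c, some s)
  | d4 s c => (9, c, some s)
  | e2 s => (10, none, some s)
  | hl b => (11, some b, none)

theorem TS.fin {S : Type} (h : Finite S) : Finite (TS S) := by
  refine Finite.of_injective TS.code ?_
  intro a b hab
  cases a <;> cases b <;> simp_all [TS.code]

def QM.g (M : QM) : TS M.S → Option Bool → Option (TS M.S × Option Bool × Bool)
  | .st s, x => match M.instr s, x with
    | .push b s', some y => some (.a1 b s', some y, true)
    | .push b s', none => some (.a2 b s', none, true)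
    | .pop _ f, some y => some (.d1 (f y), none, true)
    | .pop e _, none => some (.bk e, none, false)
    | .flip _, some _ => none
    | .flip s', none => some (.e2 s', none, true)
    | .halt b, x => some (.hl b, x, true)
  | .bk s, x => some (.st s, x, true)
  | .a1 b s, some y => some (.a1 b s, some y, true)
  | .a1 b s, none => some (.a2 b s, none, true)
  | .a2 b s, some y => some (.a2 b s, some y, true)
  | .a2 b s, none => some (.a3 s, some b, false)
  | .a3 s, some y => some (.a3 s, some y, false)
  | .a3 s, none => some (.a4 s, none, false)
  | .a4 s, some y => some (.a4 s, some y, false)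
  | .a4 s, none => some (.st s, none, true)
  | .d1 s, some y => some (.d1 s, some y, true)
  | .d1 s, none => some (.d2 s, none, true)
  | .d2 s, some y => some (.d2 s, some y, true)
  | .d2 s, none => some (.d3 s none, none, false)
  | .d3 s c, some y => some (.d3 s (some y), c, false)
  | .d3 s c, none => some (.d4 s none, c, false)
  | .d4 s c, some y => some (.d4 s (some y), c, false)
  | .d4 s c, none => some (.bk s, c, false)
  | .e2 s, some y => some (.e2 s, some y, true)
  | .e2 s, none => some (.d4 s none, none, false)
  | .hl _, _ => none

noncomputable def QM.toTM (M : QM) : TM := mkTM (TS M.S) (TS.fin M.fin) (.st M.s0) (.hl true) M.g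

noncomputable def QM.Z (M : QM) (s : TS M.S) (l r : List (Option Bool)) : TMCfg M.toTM :=
  ZC (TS.fin M.fin) (.st M.s0) (.hl true) M.g s l r

noncomputable def QM.ZL (M : QM) (s : TS M.S) (l r : List (Option Bool)) : TMCfg M.toTM :=
  _root_.ZL (TS.fin M.fin) (.st M.s0) (.hl true) M.g s l r

/-- The rest configuration. -/
noncomputable def QM.rest (M : QM) (c : QC M.S) : TMCfg M.toTM :=
  M.Z (.st c.s) [none] (c.u.map some ++ none :: c.v.map some)

theorem QM.Z_none {M : QM} {s : TS M.S} {l r : List (Option Bool)} :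
    M.Z s l (r ++ [none]) = M.Z s l r := ZC.none

theorem QM.Z_none1 {M : QM} {s : TS M.S} {l r : List (Option Bool)} {x y}  :
    M.Z s l (r ++ [x, y, none]) = M.Z s l (r ++ [x, y]) := by
  rw [show r ++ [x, y, none] = (r ++ [x, y]) ++ [none] by simp, Z_none]

theorem QM.Z_right {M : QM} {s s' : TS M.S} {a b : Option Bool} {l r : List (Option Bool)}
    (hg : M.g s a = some (s', b, true)) :
    M.toTM.Rel (M.Z s l (a :: r)) (M.Z s' (b :: l) r) := ZC.right hg

theorem QM.ZL_left {M : QM} {s s' : TS M.S} {a b : Option Bool} {l r : List (Option Bool)}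
    (hl : l ≠ []) (hg : M.g s a = some (s', b, false)) :
    M.toTM.Rel (M.ZL s (a :: l) r) (M.ZL s' l (b :: r)) := _root_.ZL.left hl hg

theorem QM.sim_bk {M : QM} {s : M.S} {r : List (Option Bool)} {K : ℕ} :
    QPath M.toTM.Rel (TMW K) 1 (M.ZL (.bk s) [none] r) (M.Z (.st s) [none] r) :=
  QPath.single (ZC.right rfl) (ZC.W (by simp)) (ZC.W (by simp))

theorem QM.sim_push {M : QM} {s s' : M.S} {b : Bool} {u v : List Bool} {K : ℕ}
    (hi : M.instr s = .push b s') (hK : u.length + v.length + 2 ≤ K) :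
    ∃ n ≤ 2 * K + 10, QPath M.toTM.Rel (TMW K) n (M.rest ⟨s, u, v⟩) (M.rest ⟨s', u, v ++ [b]⟩) := by
  -- reaching `a2` at the separator
  have h1 : QPath M.toTM.Rel (TMW K) (u.length + 1) (M.rest ⟨s, u, v⟩)
      (M.Z (.a2 b s') (none :: ((u.map some).reverse ++ [none])) (v.map some ++ [none])) := by
    unfold rest
    rw [← Z_none]
    cases u with
    | nil =>
      exact QPath.single (ZC.right (by simp [QM.g, hi])) (ZC.W (by simp)) (ZC.W (by simp; simp at hK; omega))
    | cons y u =>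
      simp only [List.length_cons] at *
      have p1 : QPath M.toTM.Rel (TMW K) (u.length) _ _ := ZC.runR (h := TS.fin M.fin)
        (s0 := .st M.s0) (acc := .hl true) (g := M.g) (s := .a1 b s')
        (fun y => rfl) u [some y, none] (none :: (v.map some ++ [none])) (K := K) (by simp; omega)
      refine QPath.cons (ZC.right (s' := .a1 b s') (b := some y) (by simp [QM.g, hi])) (ZC.W (by simp)) ?_
      have p2 := p1.trans (QPath.single (ZC.right rfl) p1.last (ZC.W (by simp; omega)))
      unfold QM.Z
      simpa using p2
  have h2 : QPath M.toTM.Rel (TMW K) (v.length) _ _ := ZC.runR (h := TS.fin M.fin)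
        (s0 := .st M.s0) (acc := .hl true) (g := M.g) (s := .a2 b s')
        (fun y => rfl) v (none :: ((u.map some).reverse ++ [none])) [none] (K := K) (by simp; omega)
  have h3 : QPath M.toTM.Rel (TMW K) 1 (M.Z (.a2 b s') ((v.map some).reverse ++ (none :: ((u.map some).reverse ++ [none]))) [none])
      (M.ZL (.a3 s') ((v.map some).reverse ++ (none :: ((u.map some).reverse ++ [none]))) [some b]) :=
    QPath.single (ZL.left (by simp) rfl) (ZC.W (by simp; omega)) (ZL.W (by simp; omega))
  have h4 : QPath M.toTM.Rel (TMW K) v.reverse.length _ _ := ZL.run (h := TS.fin M.fin)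
        (s0 := .st M.s0) (acc := .hl true) (g := M.g) (s := .a3 s')
        (fun y => rfl) v.reverse (none :: ((u.map some).reverse ++ [none])) [some b] (by simp) (K := K) (by simp; omega)
  have h5 : QPath M.toTM.Rel (TMW K) 1 (M.ZL (.a3 s') (none :: ((u.map some).reverse ++ [none])) ((v.reverse.map some).reverse ++ [some b]))
      (M.ZL (.a4 s') ((u.map some).reverse ++ [none]) (none :: ((v.reverse.map some).reverse ++ [some b]))) :=
    QPath.single (ZL.left (by simp) rfl) (ZL.W (by simp; omega)) (ZL.W (by simp; omega))
  have h6 : QPath M.toTM.Rel (TMW K) u.reverse.length _ _ := ZL.run (h := TS.fin M.fin)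
        (s0 := .st M.s0) (acc := .hl true) (g := M.g) (s := .a4 s')
        (fun y => rfl) u.reverse [none] (none :: ((v.reverse.map some).reverse ++ [some b])) (by simp) (K := K) (by simp; omega)
  have h7 : QPath M.toTM.Rel (TMW K) 1 (M.ZL (.a4 s') [none] ((u.reverse.map some).reverse ++ none :: ((v.reverse.map some).reverse ++ [some b])))
     (M.rest ⟨s', u, v ++ [b]⟩) := by
    refine QPath.single (R := M.toTM.Rel) ?_ (ZC.W (by simp)) (ZC.W (by simp))
    have := M.Z_right (s := .a4 s') (s' := .st s') (a := none) (b := none) (l := []) (r := ((u.reverse.map some).reverse ++ none :: ((v.reverse.map some).reverse ++ [some b]))) rfl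
    rw [List.map_reverse, List.reverse_reverse, List.map_reverse, List.reverse_reverse] at *
    unfold rest
    simp only [List.map_append]
    exact this
  rw [List.map_reverse] at h4 h5 h6 h7
  rw [List.map_reverse] at h6 h7
  refine ⟨_, ?_, (((((h1.trans h2).trans h3).trans h4).trans h5).trans h6).trans h7⟩
  simp; omega

theorem QM.sim_d4 {M : QM} {s' : M.S} {u r : List Bool} {K : ℕ}
    (hK : u.length + 2 ≤ K) :
    QPath M.toTM.Rel (TMW K) (u.length + 2) (M.ZL (.d4 s' none) ((u.map some).reverse ++ [none, none]) (r.map some))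
      (M.rest ⟨s', u, r⟩) := by
  have h1 : QPath M.toTM.Rel (TMW K) (u.reverse.length + 1) _ _ := ZL.runS (h := TS.fin M.fin)
        (s0 := .st M.s0) (acc := .hl true) (g := M.g) (s := .d4 s') (s' := .bk s')
        (fun c y => rfl) (fun c => rfl) u.reverse [none] (r.map some) (by simp) none (K := K) (by simp; omega)
  have := h1.trans M.sim_bk
  rw [List.map_reverse, List.reverse_reverse] at this
  simp only [List.length_reverse] at this
  exact this

theorem QM.sim_flip {M : QM} {s s' : M.S} {v : List Bool} {K : ℕ}
    (hi : M.instr s = .flip s') (hK : v.length + 2 ≤ K) :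
    ∃ n ≤ 2 * K + 10, QPath M.toTM.Rel (TMW K) n (M.rest ⟨s, [], v⟩) (M.rest ⟨s', v, []⟩) := by
  have h1 : QPath M.toTM.Rel (TMW K) 1 (M.rest ⟨s, [], v⟩)
      (M.Z (.e2 s') [none, none] (v.map some ++ [none])) := by
    unfold rest
    rw [← Z_none]
    exact QPath.single (ZC.right (by simp [QM.g, hi])) (ZC.W (by simp)) (ZC.W (by simp; omega))
  have h2 : QPath M.toTM.Rel (TMW K) (v.length) _ _ := ZC.runR (h := TS.fin M.fin)
        (s0 := .st M.s0) (acc := .hl true) (g := M.g) (s := .e2 s')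
        (fun y => rfl) v [none, none] [none] (K := K) (by simp; omega)
  have h3 : QPath M.toTM.Rel (TMW K) 1 (M.Z (.e2 s') ((v.map some).reverse ++ [none, none]) [none])
      (M.ZL (.d4 s' none) ((v.map some).reverse ++ [none, none]) [none]) :=
    QPath.single (ZL.left (by simp) rfl) (ZC.W (by simp; omega)) (ZL.W (by simp; omega))
  have h4 : M.ZL (.d4 s' none) ((v.map some).reverse ++ [none, none]) [none] =
      M.ZL (.d4 s' none) ((v.map some).reverse ++ [none, none]) [] := by
    have := List.map_reverse (f := (some : Bool → _)) (l := v)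
    rw [← this]
    cases v.reverse with
    | nil => exact ZC.none (r := [none])
    | cons x l => exact ZC.none (r := [some x])
  rw [h4] at h3
  refine ⟨_, ?_, ((h1.trans h2).trans h3).trans (M.sim_d4 (u := v) (r := []) (by omega))⟩
  omega

theorem QM.sim_pop_nil {M : QM} {s e : M.S} {f} {v : List Bool} {K : ℕ}
    (hi : M.instr s = .pop e f) :
    ∃ n ≤ 2 * K + 10, QPath M.toTM.Rel (TMW K) n (M.rest ⟨s, [], v⟩) (M.rest ⟨e, [], v⟩) := by
  have h1 : QPath M.toTM.Rel (TMW K) 1 (M.rest ⟨s, [], v⟩)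
      (M.ZL (.bk e) [none] (none :: v.map some)) := by
    exact QPath.single (R := M.toTM.Rel) (M.ZL_left (s := .st s) (a := none) (by simp)
      (by simp [QM.g, hi])) (ZC.W (by simp)) (ZL.W (by simp))
  exact ⟨_, by omega, h1.trans M.sim_bk⟩

theorem QM.sim_pop_cons {M : QM} {s e : M.S} {f} {y : Bool} {u v : List Bool} {K : ℕ}
    (hi : M.instr s = .pop e f) (hK : u.length + 1 + v.length + 2 ≤ K) :
    ∃ n ≤ 2 * K + 10, QPath M.toTM.Rel (TMW K) n (M.rest ⟨s, y :: u, v⟩) (M.rest ⟨f y, u, v⟩) := by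
  have h1 : QPath M.toTM.Rel (TMW K) 1 (M.rest ⟨s, y :: u, v⟩)
      (M.Z (.d1 (f y)) [none, none] (u.map some ++ none :: (v.map some ++ [none]))) := by
    unfold rest
    rw [← Z_none]
    have := M.Z_right (s := .st s)
      (s' := .d1 (f y)) (a := some y) (b := none) (l := [none])
      (r := (u.map some ++ none :: (v.map some ++ [none]))) (by simp [QM.g, hi])
    refine QPath.single (R := M.toTM.Rel) ?_ (ZC.W (by simp)) (ZC.W (by simp; omega))
    simpa using this
  have h2 : QPath M.toTM.Rel (TMW K) (u.length) _ _ := ZC.runR (h := TS.fin M.fin)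
        (s0 := .st M.s0) (acc := .hl true) (g := M.g) (s := .d1 (f y))
        (fun y => rfl) u [none, none] (none :: (v.map some ++ [none])) (K := K) (by simp; omega)
  have h3 : QPath M.toTM.Rel (TMW K) 1 (M.Z (.d1 (f y)) ((u.map some).reverse ++ [none, none]) (none :: (v.map some ++ [none])))
      (M.Z (.d2 (f y)) (none :: ((u.map some).reverse ++ [none, none])) (v.map some ++ [none])) :=
    QPath.single (ZC.right rfl) (ZC.W (by simp; omega)) (ZC.W (by simp; omega))
  have h4 : QPath M.toTM.Rel (TMW K) (v.length) _ _ := ZC.runR (h := TS.fin M.fin)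
        (s0 := .st M.s0) (acc := .hl true) (g := M.g) (s := .d2 (f y))
        (fun y => rfl) v (none :: ((u.map some).reverse ++ [none, none])) [none] (K := K) (by simp; omega)
  have h5 : QPath M.toTM.Rel (TMW K) 1 (M.Z (.d2 (f y)) ((v.map some).reverse ++ none :: ((u.map some).reverse ++ [none, none])) [none])
      (M.ZL (.d3 (f y) none) ((v.map some).reverse ++ none :: ((u.map some).reverse ++ [none, none])) [none]) :=
    QPath.single (ZL.left (by simp) rfl) (ZC.W (by simp; omega)) (ZL.W (by simp; omega))
  have h6 : QPath M.toTM.Rel (TMW K) (v.reverse.length + 1) _ _ := ZL.runS (h := TS.fin M.fin)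
        (s0 := .st M.s0) (acc := .hl true) (g := M.g) (s := .d3 (f y)) (s' := .d4 (f y) none)
        (fun c y => rfl) (fun c => rfl) v.reverse ((u.map some).reverse ++ [none, none]) [none] (by simp) none (K := K) (by simp; omega)
  rw [List.map_reverse, List.reverse_reverse] at h6
  have h7 : M.ZL (.d4 (f y) none) ((u.map some).reverse ++ [none, none]) (v.map some ++ [none, none]) =
      M.ZL (.d4 (f y) none) ((u.map some).reverse ++ [none, none]) (v.map some) := by
    have := List.map_reverse (f := (some : Bool → _)) (l := u)
    rw [← this]
    rw [show v.map some ++ [none, none] = (v.map some ++ [none]) ++ [none] by simp]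
    cases u.reverse with
    | nil => exact (ZC.none (r := none :: (v.map some ++ [none]))).trans (ZC.none (r := none :: (v.map some)))
    | cons x l => exact (ZC.none (r := some x :: (v.map some ++ [none]))).trans (ZC.none (r := some x :: (v.map some)))
  have h8 := M.sim_d4 (s' := f y) (u := u) (r := v) (K := K) (by omega)
  rw [← h7] at h8
  refine ⟨_, ?_, (((((h1.trans h2).trans h3).trans h4).trans h5).trans h6).trans h8⟩
  simp; omega

theorem QM.sim_step {M : QM} {c d : QC M.S} {L : ℕ} (h : M.R c d) (hc : QW L c) :
    ∃ n ≤ 2 * (L + 2) + 10, QPath M.toTM.Rel (TMW (L + 2)) n (M.rest c) (M.rest d) := by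
  obtain ⟨s, u, v⟩ := c
  unfold QW at hc
  unfold R at h
  dsimp only at *
  cases hi : M.instr s with
  | pop e f =>
    cases u with
    | nil => simp [hi, QI.exec] at h; subst h; exact M.sim_pop_nil hi
    | cons y u =>
      simp [hi, QI.exec] at h; subst h; exact M.sim_pop_cons hi (by simp at hc; omega)
  | push b s' => simp [hi, QI.exec] at h; subst h; exact M.sim_push hi (by omega)
  | flip s' =>
    cases u with
    | nil => simp [hi, QI.exec] at h; subst h; exact M.sim_flip hi (by simp at hc; omega)
    | cons y u => simp [hi, QI.exec] at h
  | halt b => simp [hi, QI.exec] at h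

theorem QM.sim_path {M : QM} {c d : QC M.S} {L n : ℕ} (h : QPath M.R (QW L) n c d) :
    ∃ m ≤ n * (2 * L + 14), QPath M.toTM.Rel (TMW (L + 2)) m (M.rest c) (M.rest d) := by
  induction n generalizing c with
  | zero => obtain ⟨rfl, h⟩ := h; exact ⟨0, by simp, QPath.refl (ZC.W (by simp))⟩
  | succ n ih =>
    obtain ⟨hw, e, he, p⟩ := h
    obtain ⟨m, hm, p⟩ := ih p
    obtain ⟨k, hk, q⟩ := M.sim_step he hw
    exact ⟨k + m, by nlinarith, q.trans p⟩

theorem QM.sim_halts {M : QM} {n L : ℕ} {x y v : List Bool} {b : Bool}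
    (h : M.HaltsIn n L x b y v) :
    ∃ m ≤ (n + 1) * (2 * L + 14), ∃ c, QPath M.toTM.Rel (TMW (L + 2)) m (M.toTM.initCfg x) c ∧
      M.toTM.stepCfg c = none ∧ (c.q = M.toTM.qacc ↔ b = true) ∧
      (v = [] → ∀ i : ℕ, c.tape (i : ℤ) = y[i]?) := by
  obtain ⟨s, hs, p⟩ := h
  obtain ⟨m, hm, p⟩ := M.sim_path p
  have hinit : M.toTM.initCfg x = M.rest ⟨M.s0, x, []⟩ := by
    unfold rest
    simp only [List.map_nil]
    rw [Z_none]
    unfold TM.initCfg Z ZC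
    congr 1
    funext i
    unfold tp
    split_ifs with h1 h2 h2
    · rfl
    · have : i = -1 := by omega
      subst this; simp
    · omega
    · have : (i + 1).toNat = i.toNat + 1 := by omega
      rw [this]; simp
      cases x[i.toNat]? <;> rfl
  have hstep : ∃ c, M.toTM.Rel (M.rest ⟨s, y, v⟩) c ∧ c.q = stEq _ (TS.fin M.fin) (.hl b) ∧ c.pos = 1 ∧
      c.tape = (M.rest ⟨s, y, v⟩).tape := by
    unfold rest
    cases y with
    | nil =>
      exact ⟨_, M.Z_right (s := .st s) (s' := .hl b) (b := none) (by simp [g, hs]), rfl,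
        by simp [Z, ZC], by simp [Z, ZC]⟩
    | cons x y =>
      exact ⟨_, M.Z_right (s := .st s) (s' := .hl b) (b := some x) (by simp [g, hs]), rfl,
        by simp [Z, ZC], by simp [Z, ZC]⟩
  obtain ⟨c, hc, hq, hpos, htp⟩ := hstep
  refine ⟨m + 1, by nlinarith, c, ?_, ?_, ?_, ?_⟩
  · rw [hinit]
    exact p.trans (QPath.single hc p.last (by unfold TMW; omega))
  · unfold TM.stepCfg
    rw [hq]
    simp [toTM, mkTM, g]
  · rw [hq]
    simp [toTM, mkTM]
  · rintro rfl i
    rw [htp]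
    unfold rest
    simp only [List.map_nil]
    rw [Z_none]
    simp only [Z, ZC, tp]
    rw [if_neg (by omega)]
    have : ((i : ℤ) + 1).toNat = i + 1 := by omega
    rw [this]; simp
    cases y[i]? <;> rfl

theorem TM.run_add {M : TM} {w : List Bool} {W : TMCfg M → Prop} {n k : ℕ} {c d : TMCfg M}
    (hk : M.run w k = some c) (p : QPath M.Rel W n c d) : M.run w (k + n) = some d := by
  induction n generalizing k c with
  | zero => obtain ⟨rfl, _⟩ := p; exact hk
  | succ n ih =>
    obtain ⟨_, e, he, p⟩ := p
    have : M.run w (k + 1) = some e := by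
      simp only [TM.run, hk, Option.bind_some]; exact he
    have := ih this p
    rwa [Nat.add_right_comm] at this

theorem TM.run_of_path {M : TM} {w : List Bool} {W : TMCfg M → Prop} {n : ℕ} {d : TMCfg M}
    (p : QPath M.Rel W n (M.initCfg w) d) : M.run w n = some d := by
  simpa using TM.run_add (k := 0) rfl p

theorem TM.rtg_of_run {M : TM} {w : List Bool} {n : ℕ} {d : TMCfg M}
    (h : M.run w n = some d) : Relation.ReflTransGen M.Rel (M.initCfg w) d := by
  induction n generalizing d with
  | zero => simp only [TM.run, Option.some.injEq] at h; subst h; exact .refl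
  | succ n ih =>
    simp only [TM.run, Option.bind_eq_some_iff] at h
    obtain ⟨c, hc, hd⟩ := h
    exact (ih hc).tail hd

theorem QM.grow {M : QM} {W : QC M.S → Prop} {n : ℕ} {c d : QC M.S} (p : QPath M.R W n c d) :
    QPath M.R (QW (c.u.length + c.v.length + n)) n c d := by
  induction n generalizing c with
  | zero => exact ⟨p.1, by simp [QW]⟩
  | succ n ih =>
    obtain ⟨_, e, he, p⟩ := p
    refine ⟨by unfold QW; omega, e, he, (ih p).mono ?_⟩
    intro x hx
    refine le_trans hx ?_
    have : e.u.length + e.v.length ≤ c.u.length + c.v.length + 1 := by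
      obtain ⟨s, u, v⟩ := c
      unfold R at he
      cases hi : M.instr s <;> cases u <;> simp [hi, QI.exec] at he <;> subst he <;> simp <;> omega
    omega

theorem QM.HaltsIn.grow {M : QM} {n L : ℕ} {x y v : List Bool} {b : Bool}
    (h : M.HaltsIn n L x b y v) : M.HaltsIn n (x.length + n) x b y v := by
  obtain ⟨s, hs, p⟩ := h
  exact ⟨s, hs, by simpa using QM.grow p⟩

theorem QM.polyTime (M : QM) (f : List Bool → List Bool) (p : Polynomial ℕ)
    (h : ∀ w, ∃ n L b, n ≤ p.eval w.length ∧ M.HaltsIn n L w b (f w) []) :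
    PolyTimeComputable f := by
  refine ⟨M.toTM, (p + 1) * (2 * (.X + p) + 14), fun w => ?_⟩
  obtain ⟨n, L, b, hn, hh⟩ := h w
  obtain ⟨m, hm, c, hp, hc, -, ht⟩ := M.sim_halts hh.grow
  refine ⟨m, c, hm.trans ?_, TM.run_of_path hp, hc, ht rfl⟩
  simp only [Polynomial.eval_mul, Polynomial.eval_add, Polynomial.eval_one, Polynomial.eval_X,
    Polynomial.eval_ofNat]
  gcongr

theorem QM.inPSpace (M : QM) (A : Set (List Bool)) (p : Polynomial ℕ)
    (h : ∀ w, ∃ n L b y v, L ≤ p.eval w.length ∧ M.HaltsIn n L w b y v ∧ (b = true ↔ w ∈ A)) :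
    InPSpace A := by
  refine ⟨M.toTM, ⟨p + 4, fun w => ⟨-1, fun k d hd => ?_⟩⟩, fun w => ?_⟩
  · obtain ⟨n, L, b, y, v, hL, hh, -⟩ := h w
    obtain ⟨m, hm, c, hp, hc, -, ht⟩ := M.sim_halts hh
    have := (hp.reach (TM.Rel.det _) (fun d hd => by unfold TM.Rel at hd; simp [hc] at hd)
      (TM.rtg_of_run hd)).1
    unfold TMW at this
    simp only [Polynomial.eval_add, Polynomial.eval_ofNat]
    push_cast
    push_cast at this
    have : (L : ℤ) ≤ p.eval w.length := by exact_mod_cast hL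
    omega
  · obtain ⟨n, L, b, y, v, hL, hh, hb⟩ := h w
    obtain ⟨m, hm, c, hp, hc, hq, ht⟩ := M.sim_halts hh
    exact ⟨m, c, TM.run_of_path hp, hc, hq.trans hb⟩


/-! ## Simulation of queue machines by three-counter automata -/

/-- Branching counter automata: in state `s` with `br s = (j, z, p)`, counter `j` is inspected; if it
is zero the branch `z` is taken (adding a vector), otherwise counter `j` is decremented
and the branch `p` is taken (adding a vector outside `j`). -/
def mkCA (S : Type) (h : Finite S) (s0 sf : S)
    (br : S → Fin 3 × Option ((Fin 3 → ℕ) × S) × Option ((Fin 3 → ℕ) × S)) : CA 3 where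
  State := S
  finState := h
  q0 := s0
  qf := sf
  trans := {t | (∃ a, (br t.1).2.1 = some (a, t.2.2.2) ∧ t.2.1 = (fun i => (a i : ℤ)) ∧
      t.2.2.1 = some (br t.1).1) ∨
    (∃ a, (br t.1).2.2 = some (a, t.2.2.2) ∧
      t.2.1 = (fun i => if i = (br t.1).1 then -1 else (a i : ℤ)) ∧ t.2.2.1 = none)}

section
variable {S : Type} {h : Finite S} {s0 sf : S}
  {br : S → Fin 3 × Option ((Fin 3 → ℕ) × S) × Option ((Fin 3 → ℕ) × S)}

theorem mkCA_enabled {t} {c : S × (Fin 3 → ℕ)} (ht : (mkCA S h s0 sf br).Enabled t c) :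
    (c.2 (br c.1).1 = 0 ∧ ∃ a s, (br c.1).2.1 = some (a, s) ∧
      t = (c.1, (fun i => (a i : ℤ)), some (br c.1).1, s)) ∨
    (c.2 (br c.1).1 ≠ 0 ∧ ∃ a s, (br c.1).2.2 = some (a, s) ∧
      t = (c.1, (fun i => if i = (br c.1).1 then -1 else (a i : ℤ)), none, s)) := by
  obtain ⟨s, z, o, s'⟩ := t
  obtain ⟨ht, hs, hpos, hz⟩ := ht
  dsimp only at *
  subst hs
  rcases ht with ⟨a, h1, h2, h3⟩ | ⟨a, h1, h2, h3⟩
  · dsimp only at h1 h2 h3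
    left
    exact ⟨hz _ h3, a, s', h1, by rw [h2, h3]; rfl⟩
  · dsimp only at h1 h2 h3
    right
    refine ⟨?_, a, s', h1, by rw [h2, h3]; rfl⟩
    have := hpos (br c.1).1
    rw [h2] at this
    simp at this
    omega

theorem mkCA_det : (mkCA S h s0 sf br).Deterministic := by
  intro c t1 t2 h1 h2
  rcases mkCA_enabled h1 with ⟨h6, a, s, h3, rfl⟩ | ⟨h6, a, s, h3, rfl⟩ <;>
  rcases mkCA_enabled h2 with ⟨h5, a', s', h4, rfl⟩ | ⟨h5, a', s', h4, rfl⟩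
  · rw [h3] at h4; cases h4; rfl
  · exact absurd h6 h5
  · exact absurd h5 h6
  · rw [h3] at h4; cases h4; rfl

theorem mkCA_stuck {c : S × (Fin 3 → ℕ)}
    (hz : c.2 (br c.1).1 = 0 → (br c.1).2.1 = none)
    (hp : c.2 (br c.1).1 ≠ 0 → (br c.1).2.2 = none) (d) : ¬ (mkCA S h s0 sf br).Step c d := by
  rintro ⟨t, ht, -⟩
  rcases mkCA_enabled ht with ⟨h1, a, s, h3, rfl⟩ | ⟨h1, a, s, h3, rfl⟩
  · rw [hz h1] at h3; cases h3
  · rw [hp h1] at h3; cases h3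

theorem mkCA_zero {s s' : S} {n m a : Fin 3 → ℕ} {j : Fin 3} {q}
    (hb : br s = (j, some (a, s'), q)) (hj : n j = 0) (hm : ∀ i, m i = n i + a i) :
    (mkCA S h s0 sf br).Step (s, n) (s', m) := by
  refine ⟨(s, (fun i => (a i : ℤ)), some j, s'), ⟨Or.inl ⟨a, ?_, rfl, ?_⟩, rfl, ?_, ?_⟩, rfl, ?_⟩
  · simp [hb]
  · simp [hb]
  · intro i; simp only; omega
  · intro i hi; simp at hi; subst hi; exact hj
  · intro i; simp [hm]

theorem mkCA_pos {s s' : S} {n m a : Fin 3 → ℕ} {j : Fin 3} {q}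
    (hb : br s = (j, q, some (a, s'))) (hj : n j = m j + 1) (hm : ∀ i, i ≠ j → m i = n i + a i) :
    (mkCA S h s0 sf br).Step (s, n) (s', m) := by
  refine ⟨(s, (fun i => if i = j then -1 else (a i : ℤ)), none, s'),
    ⟨Or.inr ⟨a, ?_, ?_, rfl⟩, rfl, ?_, ?_⟩, rfl, ?_⟩
  · simp [hb]
  · simp [hb]
  · intro i; simp only
    split_ifs with h
    · subst h; rw [hj]; push_cast; omega
    · omega
  · intro i hi; simp at hi
  · intro i; simp only
    split_ifs with h
    · subst h; rw [hj]; push_cast; omega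
    · rw [hm i h]; push_cast; omega

end

theorem CA.step_det {A : CA 3} (h : A.Deterministic) (a b c) (h1 : A.Step a b) (h2 : A.Step a c) :
    b = c := by
  obtain ⟨t, ht, h3, h4⟩ := h1
  obtain ⟨t', ht', h5, h6⟩ := h2
  obtain rfl := h _ _ _ ht ht'
  refine Prod.ext (h3.trans h5.symm) (funext fun j => ?_)
  have := (h4 j).trans (h6 j).symm
  exact_mod_cast this

/-- Binary number with a leading sentinel digit. -/
def num (l : List Bool) : ℕ := l.foldr (fun b n => 2 * n + b.toNat) 1

theorem num_cons (b : Bool) (l : List Bool) : num (b :: l) = 2 * num l + b.toNat := rfl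

theorem num_pos (l : List Bool) : 1 ≤ num l := by
  induction l with
  | nil => simp [num]
  | cons b l ih => rw [num_cons]; omega

theorem num_lt (l : List Bool) : num l < 2 ^ (l.length + 1) := by
  induction l with
  | nil => simp [num]
  | cons b l ih =>
    rw [num_cons, List.length_cons, pow_succ]
    cases b <;> simp <;> omega

theorem num_bits (l : List Bool) : (num l).bits = l ++ [true] := by
  induction l with
  | nil => simp [num]
  | cons b l ih =>
    have : num (b :: l) = Nat.bit b (num l) := by
      rw [num_cons, Nat.bit_val]
    rw [this, Nat.bits_append_bit _ _ (fun h => by have := num_pos l; omega), ih]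
    rfl

theorem num_surj (n : ℕ) (hn : n ≠ 0) : ∃ l, num l = n := by
  induction n using Nat.binaryRec' with
  | zero => exact absurd rfl hn
  | bit b n hb ih =>
    by_cases h : n = 0
    · subst h; rw [hb rfl]; exact ⟨[], by simp [num]⟩
    · obtain ⟨l, hl⟩ := ih h
      exact ⟨b :: l, by rw [num_cons, hl, Nat.bit_val]⟩

/-- Counter index of a stack. -/
def ci (j : Bool) : Fin 3 := if j then 1 else 0

/-- Counter vector with value `x` in stack `j`, `o` in the other stack and `t` in the
auxiliary counter. -/
def cv (j : Bool) (x o t : ℕ) : Fin 3 → ℕ := if j then ![o, x, t] else ![x, o, t]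

theorem cv_not (j : Bool) (x o t : ℕ) : cv (!j) x o t = cv j o x t := by
  cases j <;> rfl

@[simp] theorem cv_ci (j : Bool) (x o t : ℕ) : cv j x o t (ci j) = x := by
  cases j <;> rfl

@[simp] theorem cv_two (j : Bool) (x o t : ℕ) : cv j x o t 2 = t := by
  cases j <;> rfl

theorem cv_add (j : Bool) (x o t x' o' t' : ℕ) (i : Fin 3) :
    cv j (x + x') (o + o') (t + t') i = cv j x o t i + cv j x' o' t' i := by
  cases j <;> fin_cases i <;> rfl

inductive CS (S : Type) where
  | i0 | i1 | i2 | i3 | dead | cl0 | cl1 | qf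
  | run (s : S) | p0 (k : Bool × S) | p1 (k : Bool × S) | qc (k : Bool × S)
  | q (b : Bool) (k : Bool × S) | u1 (b : Bool) (k : Bool × S) | u2 (b : Bool) (k : Bool × S)

def CS.code {S : Type} : CS S → Fin 15 × Bool × Option (Bool × S)
  | i0 => (0, false, none)
  | i1 => (1, false, none)
  | i2 => (2, false, none)
  | i3 => (3, false, none)
  | dead => (4, false, none)
  | cl0 => (5, false, none)
  | cl1 => (6, false, none)
  | qf => (7, false, none)
  | run s => (8, false, some (false, s))
  | p0 k => (9, false, some k)
  | p1 k => (10, false, some k)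
  | qc k => (11, false, some k)
  | q b k => (12, b, some k)
  | u1 b k => (13, b, some k)
  | u2 b k => (14, b, some k)

theorem CS.fin {S : Type} (h : Finite S) : Finite (CS S) := by
  refine Finite.of_injective CS.code ?_
  intro a b hab
  cases a <;> cases b <;> simp_all [CS.code]

/-- Continuation after reading a digit (`none`: empty stack). -/
def QM.digit (M : QM) (b : Option Bool) : Bool × M.S → CS M.S
  | (false, s) => match M.instr s, b with
    | .pop e _, none => .run e
    | .pop _ f, some b => .run (f b)
    | _, _ => .dead
  | (true, s) => match b with
    | none => .run s
    | some b => .u1 b (true, s)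

/-- Continuation after writing a digit. -/
def QM.wrote (M : QM) : Bool × M.S → CS M.S
  | (false, s) => .run s
  | (true, s) => .p0 (true, s)

def QM.disp (M : QM) (s : M.S) : CS M.S :=
  match M.instr s with
  | .pop _ _ => .p0 (false, s)
  | .push b s' => .u1 b (false, s')
  | .flip s' => .p0 (true, s')
  | .halt true => .cl0
  | .halt false => .dead

def QM.br (M : QM) :
    CS M.S → Fin 3 × Option ((Fin 3 → ℕ) × CS M.S) × Option ((Fin 3 → ℕ) × CS M.S)
  | .i0 => (1, some (cv true 1 0 0, .i1), none)
  | .i1 => (2, some (cv true 0 0 0, .i2), none)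
  | .i2 => (0, none, some (cv true 0 0 0, .i3))
  | .i3 => (2, some (cv false 1 0 0, .run M.s0), none)
  | .dead => (0, none, none)
  | .qf => (0, none, none)
  | .cl0 => (0, some (cv true 0 0 0, .cl1), some (cv true 0 0 0, .cl0))
  | .cl1 => (1, some (cv true 0 0 0, .qf), some (cv true 0 0 0, .cl1))
  | .run s => (2, some (cv true 0 0 0, M.disp s), none)
  | .p0 k => (ci k.1, some (cv true 0 0 0, .q false k), some (cv k.1 0 0 0, .p1 k))
  | .p1 k => (ci k.1, some (cv true 0 0 0, .qc k), some (cv k.1 0 0 1, .p0 k))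
  | .qc k => (2, some (cv k.1 1 0 0, M.digit none k), some (cv k.1 1 0 0, .q true k))
  | .q b k => (2, some (cv k.1 0 0 0, M.digit (some b) k), some (cv k.1 1 0 0, .q b k))
  | .u1 b k => (ci !k.1, some (cv true 0 0 0, .u2 b k), some (cv (!k.1) 0 0 2, .u1 b k))
  | .u2 b k => (2, some (cv (!k.1) b.toNat 0 0, M.wrote k), some (cv (!k.1) 1 0 0, .u2 b k))

def QM.toCA (M : QM) : CA 3 := mkCA (CS M.S) (CS.fin M.fin) .i0 .qf M.br

def CAW {S : Type} (B : ℕ) (c : S × (Fin 3 → ℕ)) : Prop := ∀ i, c.2 i ≤ B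

theorem CAW_cv {S : Type} {B : ℕ} {s : S} {j : Bool} {x o t : ℕ} (hx : x ≤ B) (ho : o ≤ B)
    (ht : t ≤ B) : CAW B (s, cv j x o t) := by
  intro i
  cases j <;> fin_cases i <;> simpa [cv]

/-- Existence of a bounded path of some length. -/
def QM.CP (M : QM) (B : ℕ) (c d : CS M.S × (Fin 3 → ℕ)) : Prop :=
  ∃ n, QPath M.toCA.Step (CAW B) n c d

theorem QM.CP.trans {M : QM} {B : ℕ} {c d e} (h : M.CP B c d) (h' : M.CP B d e) : M.CP B c e := by
  obtain ⟨n, p⟩ := h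
  obtain ⟨m, q⟩ := h'
  exact ⟨_, p.trans q⟩

theorem QM.CP.zero {M : QM} {B : ℕ} {s s' : CS M.S} {j jj : Bool} {x o t x' o' t' : ℕ} {i : Fin 3}
    {q} (hb : M.br s = (i, some (cv jj x' o' t', s'), q)) (hi : cv j x o t i = 0)
    {x2 o2 t2 : ℕ}
    (h : cv j x2 o2 t2 = fun i => cv j x o t i + cv jj x' o' t' i)
    (hx : x ≤ B) (ho : o ≤ B) (ht : t ≤ B)
    (hx2 : x2 ≤ B) (ho2 : o2 ≤ B) (ht2 : t2 ≤ B) :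
    M.CP B (s, cv j x o t) (s', cv j x2 o2 t2) :=
  ⟨1, QPath.single (R := M.toCA.Step) (mkCA_zero hb hi fun i => congrFun h i) (CAW_cv hx ho ht) (CAW_cv hx2 ho2 ht2)⟩

theorem QM.CP.posx {M : QM} {B : ℕ} {s s' : CS M.S} {j : Bool} {x o t o' t' : ℕ}
    {q} (hb : M.br s = (ci j, q, some (cv j 0 o' t', s')))
    (hx : x + 1 ≤ B) (ho : o ≤ B) (ht : t ≤ B) (ho2 : o + o' ≤ B) (ht2 : t + t' ≤ B) :
    M.CP B (s, cv j (x + 1) o t) (s', cv j x (o + o') (t + t')) :=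
  ⟨1, QPath.single (R := M.toCA.Step) (mkCA_pos hb (by simp) (by
    intro i hi; revert hi
    cases j <;> fin_cases i <;> simp [ci, cv])) (CAW_cv hx ho ht) (CAW_cv (by omega) ho2 ht2)⟩

theorem QM.CP.post {M : QM} {B : ℕ} {s s' : CS M.S} {j : Bool} {x o t o' x' : ℕ}
    {q} (hb : M.br s = (2, q, some (cv j x' o' 0, s')))
    (hx : x ≤ B) (ho : o ≤ B) (ht : t + 1 ≤ B) (ho2 : o + o' ≤ B) (hx2 : x + x' ≤ B) :
    M.CP B (s, cv j x o (t + 1)) (s', cv j (x + x') (o + o') t) :=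
  ⟨1, QPath.single (R := M.toCA.Step) (mkCA_pos hb (by simp) (by
    intro i hi; revert hi
    cases j <;> fin_cases i <;> simp [ci, cv])) (CAW_cv hx ho ht) (CAW_cv hx2 ho2 (by omega))⟩

theorem QM.cp_half {M : QM} {B : ℕ} (k : Bool × M.S) (h o t : ℕ) (r : Bool)
    (h1 : 2 * h + 1 ≤ B) (ho : o ≤ B) (ht : t + h ≤ B) :
    M.CP B (.p0 k, cv k.1 (2 * h + r.toNat) o t) (if r then .qc k else .q false k, cv k.1 0 o (t + h)) := by
  induction h generalizing t with
  | zero =>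
    cases r with
    | false =>
      exact QM.CP.zero rfl (by simp) (by cases k.1 <;> funext i <;> fin_cases i <;> simp [cv])
        (by simp) ho (by omega) (by simp) ho (by omega)
    | true =>
      refine (QM.CP.posx rfl (by omega) ho (by omega) (by omega) (by omega)).trans ?_
      exact QM.CP.zero rfl (by simp) (by cases k.1 <;> funext i <;> fin_cases i <;> simp [cv])
        (by simp) ho (by omega) (by simp) ho (by omega)
  | succ h ih =>
    have hr : r.toNat ≤ 1 := by cases r <;> simp
    have e : 2 * (h + 1) + r.toNat = (2 * h + r.toNat) + 1 + 1 := by omega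
    rw [e, show t + (h + 1) = (t + 1) + h by omega]
    refine (QM.CP.posx rfl (by omega) ho (by omega) (by omega) (by omega)).trans ?_
    refine (QM.CP.posx rfl (by omega) ho (by omega) (by omega) (by omega)).trans ?_
    exact ih (t + 1) (by omega) (by omega)

theorem QM.cp_q {M : QM} {B : ℕ} (b : Bool) (k : Bool × M.S) (h o x : ℕ)
    (ho : o ≤ B) (ht : x + h ≤ B) :
    M.CP B (.q b k, cv k.1 x o h) (M.digit (some b) k, cv k.1 (x + h) o 0) := by
  induction h generalizing x with
  | zero =>
    exact QM.CP.zero rfl (by simp) (by cases k.1 <;> funext i <;> fin_cases i <;> simp [cv])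
        (by omega) ho (by omega) (by omega) ho (by omega)
  | succ h ih =>
    rw [show x + (h + 1) = (x + 1) + h by omega]
    refine (QM.CP.post rfl (by omega) ho (by omega) (by omega) (by omega)).trans ?_
    exact ih (x + 1) (by omega)

theorem QM.cp_pop_cons {M : QM} {B : ℕ} (k : Bool × M.S) (b : Bool) (l : List Bool) (o : ℕ)
    (hl : num (b :: l) < B) (ho : o ≤ B) :
    M.CP B (.p0 k, cv k.1 (num (b :: l)) o 0) (M.digit (some b) k, cv k.1 (num l) o 0) := by
  rw [num_cons] at *
  have hn := num_pos l
  refine (QM.cp_half k (num l) o 0 b (by cases b <;> simp at * <;> omega) ho (by omega)).trans ?_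
  cases b with
  | false => simpa using QM.cp_q false k (num l) o 0 ho (by omega)
  | true =>
    obtain ⟨m, hm⟩ : ∃ m, num l = m + 1 := ⟨num l - 1, by omega⟩
    rw [hm]
    simp only [if_true, Nat.zero_add]
    refine (QM.CP.post rfl (by omega) ho (by omega) (by omega) (by omega)).trans ?_
    simpa [Nat.add_comm] using QM.cp_q true k m o 1 ho (by omega)

theorem QM.cp_pop_nil {M : QM} {B : ℕ} (k : Bool × M.S) (o : ℕ) (hB : 1 ≤ B) (ho : o ≤ B) :
    M.CP B (.p0 k, cv k.1 (num []) o 0) (M.digit none k, cv k.1 (num []) o 0) := by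
  refine (QM.cp_half k 0 o 0 true (by omega) ho (by omega)).trans ?_
  exact QM.CP.zero rfl (by simp) (by cases k.1 <;> funext i <;> fin_cases i <;> simp [cv, num])
        (by omega) ho (by omega) (by simpa [num]) ho (by omega)

theorem QM.cp_u1 {M : QM} {B : ℕ} (b : Bool) (k : Bool × M.S) (x o t : ℕ)
    (ho : o ≤ B) (ht : t + 2 * x ≤ B) :
    M.CP B (.u1 b k, cv (!k.1) x o t) (.u2 b k, cv (!k.1) 0 o (t + 2 * x)) := by
  induction x generalizing t with
  | zero =>
    exact QM.CP.zero rfl (by simp) (by cases k.1 <;> funext i <;> fin_cases i <;> simp [cv])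
        (by omega) ho (by omega) (by omega) ho (by omega)
  | succ x ih =>
    rw [show t + 2 * (x + 1) = (t + 2) + 2 * x by omega]
    refine (QM.CP.posx rfl (by omega) ho (by omega) (by omega) (by omega)).trans ?_
    exact ih (t + 2) (by omega)

theorem QM.cp_u2 {M : QM} {B : ℕ} (b : Bool) (k : Bool × M.S) (x o t : ℕ)
    (ho : o ≤ B) (ht : x + t + 1 ≤ B) :
    M.CP B (.u2 b k, cv (!k.1) x o t) (M.wrote k, cv (!k.1) (x + t + b.toNat) o 0) := by
  have hr : b.toNat ≤ 1 := by cases b <;> simp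
  induction t generalizing x with
  | zero =>
    exact QM.CP.zero rfl (by simp) (by cases k.1 <;> funext i <;> fin_cases i <;> simp [cv])
        (by omega) ho (by omega) (by omega) ho (by omega)
  | succ t ih =>
    rw [show x + (t + 1) = (x + 1) + t by omega]
    refine (QM.CP.post rfl (by omega) ho (by omega) (by omega) (by omega)).trans ?_
    exact ih (x + 1) (by omega)

theorem QM.cp_push {M : QM} {B : ℕ} (b : Bool) (k : Bool × M.S) (l : List Bool) (o : ℕ)
    (ho : o ≤ B) (ht : 2 * num l + 1 ≤ B) :
    M.CP B (.u1 b k, cv k.1 o (num l) 0) (M.wrote k, cv k.1 o (num (b :: l)) 0) := by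
  rw [← cv_not k.1, ← cv_not k.1]
  refine (QM.cp_u1 b k (num l) o 0 ho (by omega)).trans ?_
  simpa [num_cons] using QM.cp_u2 b k 0 o (2 * num l) ho (by omega)

theorem QM.cp_run {M : QM} {B : ℕ} (s : M.S) (x y : ℕ) (hx : x ≤ B) (hy : y ≤ B) :
    M.CP B (.run s, cv false x y 0) (M.disp s, cv false x y 0) :=
  QM.CP.zero rfl (by simp) (by funext i; fin_cases i <;> simp [cv])
    hx hy (by omega) hx hy (by omega)

/-- Counter representation of a configuration. -/
def QM.crep (M : QM) (c : QC M.S) : CS M.S × (Fin 3 → ℕ) :=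
  (.run c.s, cv false (num c.u) (num c.v.reverse) 0)

theorem two_pow_bound {l : List Bool} {L : ℕ} (h : l.length ≤ L) : 2 * num l + 1 ≤ 2 ^ (L + 2) := by
  have h1 := num_lt l
  have h2 : 2 ^ (l.length + 1) ≤ 2 ^ (L + 1) := Nat.pow_le_pow_right (by simp) (by omega)
  rw [pow_succ 2 (L + 1)]
  omega

theorem QM.cp_rev {M : QM} {L : ℕ} (s : M.S) (l m : List Bool) (h : l.length + m.length ≤ L) :
    M.CP (2 ^ (L + 2)) (.p0 (true, s), cv true (num l) (num m) 0)
      (.run s, cv true (num []) (num (l.reverse ++ m)) 0) := by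
  induction l generalizing m with
  | nil =>
    have := two_pow_bound (l := m) (L := L) (by simpa using h)
    exact QM.cp_pop_nil (true, s) (num m) (by omega) (by omega)
  | cons b l ih =>
    simp only [List.length_cons] at h
    have h1 := two_pow_bound (l := m) (L := L) (by omega)
    have h2 := two_pow_bound (l := b :: l) (L := L) (by simp; omega)
    have h3 := two_pow_bound (l := l) (L := L) (by omega)
    refine (QM.cp_pop_cons (true, s) b l (num m) (by omega) (by omega)).trans ?_
    refine (QM.cp_push b (true, s) m (num l) (by omega) (by omega)).trans ?_
    simpa [wrote] using ih (b :: m) (by simp; omega)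

theorem QM.cp_step {M : QM} {c d : QC M.S} {L : ℕ} (h : M.R c d) (hc : QW L c) :
    M.CP (2 ^ (L + 2)) (M.crep c) (M.crep d) := by
  obtain ⟨s, u, v⟩ := c
  unfold QW at hc
  unfold R at h
  dsimp only at *
  have h1 := two_pow_bound (l := u) (L := L) (by omega)
  have h2 := two_pow_bound (l := v.reverse) (L := L) (by simp; omega)
  refine (M.cp_run s _ _ (by dsimp only; omega) (by dsimp only; omega)).trans ?_
  cases hi : M.instr s with
  | pop e f =>
    have hd : M.disp s = .p0 (false, s) := by simp [disp, hi]
    rw [hd]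
    cases u with
    | nil =>
      simp [hi, QI.exec] at h; subst h
      have := QM.cp_pop_nil (M := M) (B := 2 ^ (L + 2)) (false, s) (num v.reverse) (by omega) (by omega)
      simpa [digit, hi, crep] using this
    | cons y u =>
      simp [hi, QI.exec] at h; subst h
      have := QM.cp_pop_cons (M := M) (B := 2 ^ (L + 2)) (false, s) y u (num v.reverse) (by omega) (by omega)
      simpa [digit, hi, crep] using this
  | push b s' =>
    have hd : M.disp s = .u1 b (false, s') := by simp [disp, hi]
    rw [hd]
    simp [hi, QI.exec] at h; subst h
    have := QM.cp_push (M := M) (B := 2 ^ (L + 2)) b (false, s') v.reverse (num u) (by omega) (by omega)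
    simpa [wrote, crep] using this
  | flip s' =>
    have hd : M.disp s = .p0 (true, s') := by simp [disp, hi]
    rw [hd]
    cases u with
    | nil =>
      simp [hi, QI.exec] at h; subst h
      have := M.cp_rev (L := L) s' v.reverse [] (by simp at hc; simp; omega)
      simpa [crep, cv] using this
    | cons y u => simp [hi, QI.exec] at h
  | halt b => simp [hi, QI.exec] at h

theorem QM.cp_path {M : QM} {c d : QC M.S} {L n : ℕ} (h : QPath M.R (QW L) n c d) :
    M.CP (2 ^ (L + 2)) (M.crep c) (M.crep d) := by
  induction n generalizing c with
  | zero =>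
    obtain ⟨rfl, h⟩ := h
    unfold QW at h
    have h1 := two_pow_bound (l := c.u) (L := L) (by omega)
    have h2 := two_pow_bound (l := c.v.reverse) (L := L) (by simp; omega)
    exact ⟨0, QPath.refl (CAW_cv (by omega) (by omega) (by omega))⟩
  | succ n ih =>
    obtain ⟨hw, e, he, p⟩ := h
    exact (M.cp_step he hw).trans (ih p)

theorem QM.cp_cl0 {M : QM} {B : ℕ} (x y : ℕ) (hx : x ≤ B) (hy : y ≤ B) :
    M.CP B (.cl0, cv false x y 0) (.cl1, cv false 0 y 0) := by
  induction x with
  | zero => exact QM.CP.zero rfl (by simp [cv]) (by funext i; fin_cases i <;> simp [cv])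
              hx hy (by omega) hx hy (by omega)
  | succ x ih => exact (QM.CP.posx rfl hx hy (by omega) (by omega) (by omega)).trans (ih (by omega))

theorem QM.cp_cl1 {M : QM} {B : ℕ} (y : ℕ) (hy : y ≤ B) :
    M.CP B (.cl1, cv true y 0 0) (.qf, cv true 0 0 0) := by
  induction y with
  | zero => exact QM.CP.zero rfl (by simp [cv]) (by funext i; fin_cases i <;> simp [cv])
              hy hy (by omega) hy hy (by omega)
  | succ x ih => exact (QM.CP.posx rfl hy (by omega) (by omega) (by omega) (by omega)).trans (ih (by omega))

theorem QM.cp_init {M : QM} {B : ℕ} (x : ℕ) (hx : x + 1 ≤ B) :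
    M.CP B (.i0, cv false (x + 1) 0 0) (.run M.s0, cv false (x + 1) 1 0) := by
  refine (QM.CP.zero rfl (by simp [cv]) (x2 := x + 1) (o2 := 1) (t2 := 0) (by funext i; fin_cases i <;> simp [cv])
      (by omega) (by omega) (by omega) (by omega) (by omega) (by omega)).trans ?_
  refine (QM.CP.zero rfl (by simp [cv]) (x2 := x + 1) (o2 := 1) (t2 := 0) (by funext i; fin_cases i <;> simp [cv])
      (by omega) (by omega) (by omega) (by omega) (by omega) (by omega)).trans ?_
  refine (QM.CP.posx (o' := 0) (t' := 0) rfl hx (by omega) (by omega) (by omega) (by omega)).trans ?_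
  exact (QM.CP.zero rfl (by simp [cv]) (x2 := x + 1) (o2 := 1) (t2 := 0) (by funext i; fin_cases i <;> simp [cv])
      (by omega) (by omega) (by omega) (by omega) (by omega) (by omega))

theorem QM.toCA_det (M : QM) : M.toCA.Deterministic := mkCA_det

theorem QM.toCA_spec {M : QM} {n L : ℕ} {x y w : List Bool} {b : Bool}
    (h : M.HaltsIn n L x b y w) :
    (M.toCA.ZeroReach (cv false (num x) 0 0) ↔ b = true) ∧
    ∀ c, M.toCA.Reaches (M.toCA.q0, cv false (num x) 0 0) c → ∀ j, c.2 j ≤ 2 ^ (L + 2) := by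
  obtain ⟨s, hs, p⟩ := h
  have hx := p.start
  have hy := p.last
  unfold QW at hx hy
  simp at hx hy
  have h1 := two_pow_bound (l := x) (L := L) (by omega)
  have h2 := two_pow_bound (l := y) (L := L) (by omega)
  have h3 := two_pow_bound (l := w.reverse) (L := L) (by simp; omega)
  have hn := num_pos x
  have q1 : M.CP (2 ^ (L + 2)) (.i0, cv false (num x) 0 0) (.run M.s0, cv false (num x) 1 0) := by
    have := M.cp_init (B := 2 ^ (L + 2)) (num x - 1) (by omega)
    rwa [show num x - 1 + 1 = num x by omega] at this
  have q2 := q1.trans ((M.cp_path p).trans (M.cp_run s _ _ (by dsimp only; omega) (by dsimp only; omega)))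
  dsimp only at q2
  cases b with
  | true =>
    have hd : M.disp s = .cl0 := by simp [disp, hs]
    rw [hd] at q2
    have q3 := q2.trans ((QM.cp_cl0 _ _ (by omega) (by omega)).trans (QM.cp_cl1 _ (by omega)))
    have e : cv true 0 0 0 = fun _ => 0 := by funext i; fin_cases i <;> rfl
    rw [e] at q3
    obtain ⟨m, q3⟩ := q3
    refine ⟨⟨fun _ => rfl, fun _ => q3.toRTG⟩, fun c hc => ?_⟩
    exact (q3.reach (CA.step_det M.toCA_det) (mkCA_stuck (fun _ => rfl) (fun _ => rfl)) hc).1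
  | false =>
    have hd : M.disp s = .dead := by simp [disp, hs]
    rw [hd] at q2
    obtain ⟨m, q3⟩ := q2
    refine ⟨⟨fun h => ?_, fun h => by cases h⟩, fun c hc => ?_⟩
    · have := q3.unique (CA.step_det M.toCA_det) (mkCA_stuck (fun _ => rfl) (fun _ => rfl)) h
        (mkCA_stuck (fun _ => rfl) (fun _ => rfl))
      have := congrArg Prod.fst this
      cases this
    · exact (q3.reach (CA.step_det M.toCA_det) (mkCA_stuck (fun _ => rfl) (fun _ => rfl)) hc).1

theorem QM.toCA_bad {M : QM} (v : Fin 3 → ℕ) (hv : ¬ (v 1 = 0 ∧ v 2 = 0 ∧ v 0 ≠ 0)) :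
    ¬ M.toCA.ZeroReach v ∧
    ∀ c, M.toCA.Reaches (M.toCA.q0, v) c → ∀ j, c.2 j ≤ v j + 1 := by
  suffices h : ∃ (s : CS M.S) (m : Fin 3 → ℕ) (n : ℕ), QPath M.toCA.Step (fun c => ∀ j, c.2 j ≤ v j + 1) n (CS.i0, v) (s, m) ∧
      s ≠ CS.qf ∧ ∀ d, ¬ M.toCA.Step (s, m) d by
    obtain ⟨s, m, n, p, hs, hd⟩ := h
    refine ⟨fun h => ?_, fun c hc => (p.reach (CA.step_det M.toCA_det) hd hc).1⟩
    have := p.unique (CA.step_det M.toCA_det) hd h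
        (mkCA_stuck (fun _ => rfl) (fun _ => rfl))
    have := congrArg Prod.fst this
    exact hs this.symm
  by_cases h1 : v 1 = 0
  swap
  · exact ⟨.i0, v, 0, QPath.refl (by simp), by simp,
      mkCA_stuck (fun h => absurd h h1) (fun _ => rfl)⟩
  have s1 : M.toCA.Step (CS.i0, v) (CS.i1, fun i => v i + cv true 1 0 0 i) :=
    mkCA_zero rfl h1 (fun i => rfl)
  have w1 : ∀ j, v j + cv true 1 0 0 j ≤ v j + 1 := by
    intro j; fin_cases j <;> simp [cv]
  by_cases h2 : v 2 = 0
  swap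
  · exact ⟨.i1, _, 1, QPath.single s1 (by simp) w1, by simp,
      mkCA_stuck (fun h => absurd h (by simpa [br, cv] using h2)) (fun _ => rfl)⟩
  have s2 : M.toCA.Step (CS.i1, fun i => v i + cv true 1 0 0 i) (CS.i2, fun i => v i + cv true 1 0 0 i) :=
    mkCA_zero rfl (by simpa [cv] using h2) (fun i => by fin_cases i <;> simp [cv])
  have h0 : v 0 = 0 := by
    by_contra h; exact hv ⟨h1, h2, h⟩
  exact ⟨.i2, _, 2, QPath.cons s1 (by simp) (QPath.single s2 w1 w1), by simp,
      mkCA_stuck (fun h => rfl) (fun h => absurd h (by simpa [br, cv] using h0))⟩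


/-! ## Transducers with iterated passes, compiled to queue machines -/

/-- Bounded lists. -/
def BL (n : ℕ) : Type := {l : List Bool // l.length ≤ n}

theorem BL.finite (n : ℕ) : Finite (BL n) := (List.finite_length_le Bool n).to_subtype

def BL.mk (n : ℕ) (l : List Bool) : BL n := ⟨l.take n, by simp⟩

theorem BL.mk_val {n : ℕ} {l : List Bool} (h : l.length ≤ n) : (BL.mk n l).1 = l :=
  List.take_of_length_le h

/-- A coded alphabet. -/
structure Alph where
  Γ : Type
  k : ℕ
  hk : 0 < k
  enc : Γ → List Bool
  dec : List Bool → Γ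
  len : ∀ a, (enc a).length = k
  dec_enc : ∀ a, dec (enc a) = a

def Alph.encs (A : Alph) (l : List A.Γ) : List Bool := l.flatMap A.enc

@[simp] theorem Alph.encs_nil (A : Alph) : A.encs [] = [] := rfl
@[simp] theorem Alph.encs_cons (A : Alph) (a : A.Γ) (l) : A.encs (a :: l) = A.enc a ++ A.encs l := rfl
@[simp] theorem Alph.encs_append (A : Alph) (l m : List A.Γ) :
    A.encs (l ++ m) = A.encs l ++ A.encs m := by simp [encs]
@[simp] theorem Alph.encs_length (A : Alph) (l : List A.Γ) : (A.encs l).length = A.k * l.length := by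
  induction l with
  | nil => simp
  | cons a l ih => simp [ih, A.len]; ring

/-- A transducer performing passes over the content; at the end of each pass it halts or starts
another pass. -/
structure Tr (A : Alph) where
  S : Type
  fin : Finite S
  s0 : S
  step : S → A.Γ → S × List Bool
  last : S → (Bool ⊕ S) × List Bool

namespace Tr
variable {A : Alph} (T : Tr A)

def runs : T.S → List A.Γ → T.S × List Bool
  | s, [] => (s, [])
  | s, a :: l => ((runs (T.step s a).1 l).1, (T.step s a).2 ++ (runs (T.step s a).1 l).2)

def pass (s : T.S) (l : List A.Γ) : (Bool ⊕ T.S) × List Bool :=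
  ((T.last (T.runs s l).1).1, (T.runs s l).2 ++ (T.last (T.runs s l).1).2)

theorem runs_append (s : T.S) (l m : List A.Γ) :
    T.runs s (l ++ m) = ((T.runs (T.runs s l).1 m).1, (T.runs s l).2 ++ (T.runs (T.runs s l).1 m).2) := by
  induction l generalizing s with
  | nil => simp [runs]
  | cons a l ih => simp [runs, ih]

theorem exists_C : ∃ C, (∀ s l, l.length ≤ A.k → (T.step s (A.dec l)).2.length ≤ C) ∧
    ∀ s, (T.last s).2.length ≤ C := by
  have h1 := T.fin
  have h2 := BL.finite A.k
  obtain ⟨C1, h3⟩ := (Set.finite_range fun x : T.S × BL A.k =>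
    (T.step x.1 (A.dec x.2.1)).2.length).bddAbove
  obtain ⟨C2, h4⟩ := (Set.finite_range fun x : T.S => (T.last x).2.length).bddAbove
  refine ⟨max C1 C2, fun s l hl => le_max_of_le_left (h3 ⟨(s, ⟨l, hl⟩), rfl⟩),
    fun s => le_max_of_le_right (h4 ⟨s, rfl⟩)⟩

noncomputable def C : ℕ := Classical.choose T.exists_C

theorem step_le (s : T.S) (a : A.Γ) : (T.step s a).2.length ≤ T.C := by
  have := (Classical.choose_spec T.exists_C).1 s (A.enc a) (A.len a).le
  rwa [A.dec_enc] at this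

theorem last_le (s : T.S) : (T.last s).2.length ≤ T.C := (Classical.choose_spec T.exists_C).2 s

theorem runs_le (s : T.S) (l : List A.Γ) : (T.runs s l).2.length ≤ T.C * l.length := by
  induction l generalizing s with
  | nil => simp [runs]
  | cons a l ih =>
    have := ih (T.step s a).1
    have := T.step_le s a
    simp only [runs, List.length_append, List.length_cons]
    nlinarith

theorem pass_le (s : T.S) (l : List A.Γ) : (T.pass s l).2.length ≤ T.C * (l.length + 1) := by
  have := T.runs_le s l
  have := T.last_le (T.runs s l).1
  simp only [pass, List.length_append]
  nlinarith

inductive Q (S : Type) (k C : ℕ) where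
  | rd (s : S) (buf : BL k)
  | wr (o : BL C) (s : S)
  | wf (o : BL C) (r : Bool ⊕ S)
  | hlt (b : Bool)

def Q.code {S : Type} {k C : ℕ} :
    Q S k C → (S × BL k) ⊕ (BL C × S) ⊕ (BL C × (Bool ⊕ S)) ⊕ Bool
  | .rd s buf => .inl (s, buf)
  | .wr o s => .inr (.inl (o, s))
  | .wf o r => .inr (.inr (.inl (o, r)))
  | .hlt b => .inr (.inr (.inr b))

theorem Q.finite {S : Type} (h : Finite S) (k C : ℕ) : Finite (Q S k C) := by
  have := BL.finite k
  have := BL.finite C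
  refine Finite.of_injective Q.code ?_
  intro a b hab
  cases a <;> cases b <;> simp_all [Q.code]

noncomputable def rdI (s : T.S) (buf : List Bool) : QI (Q T.S A.k T.C) :=
  .pop (if buf = [] then .wf (BL.mk _ (T.last s).2) (T.last s).1 else .hlt false)
    (fun b => if buf.length + 1 = A.k then
        .wr (BL.mk _ (T.step s (A.dec (buf ++ [b]))).2) (T.step s (A.dec (buf ++ [b]))).1
      else .rd s (BL.mk _ (buf ++ [b])))

noncomputable def at' (s : T.S) : Q T.S A.k T.C := .wr (BL.mk _ []) s

noncomputable def tgt : Bool ⊕ T.S → Q T.S A.k T.C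
  | .inl b => .hlt b
  | .inr s => T.at' s

noncomputable def toQM : QM where
  S := Q T.S A.k T.C
  fin := Q.finite T.fin _ _
  s0 := T.at' T.s0
  instr
    | .rd s buf => T.rdI s buf.1
    | .wr o s => match o.1 with
      | [] => T.rdI s []
      | b :: o => .push b (.wr (BL.mk _ o) s)
    | .wf o r => match o.1 with
      | [] => .flip (T.tgt r)
      | b :: o => .push b (.wf (BL.mk _ o) r)
    | .hlt b => .halt b

abbrev cfg (s : Q T.S A.k T.C) (u v : List Bool) : QC T.toQM.S := ⟨s, u, v⟩

theorem step_rd {s : T.S} {buf : BL A.k} {b : Bool} {u v : List Bool}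
    (h : buf.1.length + 1 < A.k) :
    T.toQM.R (T.cfg (.rd s buf) (b :: u) v) (T.cfg (.rd s (BL.mk _ (buf.1 ++ [b]))) u v) := by
  simp [QM.R, toQM, rdI, QI.exec, cfg, h.ne]

theorem write {s : T.S} {o u v : List Bool} {L : ℕ} (ho : o.length ≤ T.C)
    (hL : u.length + v.length + o.length ≤ L) :
    QPath T.toQM.R (QW L) o.length (T.cfg (.wr (BL.mk _ o) s) u v) (T.cfg (T.at' s) u (v ++ o)) := by
  induction o generalizing v with
  | nil => simpa [at'] using QPath.refl (R := T.toQM.R) (W := QW L) (by simpa [QW] using hL)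
  | cons b o ih =>
    simp only [List.length_cons] at ho hL
    have := ih (v := v ++ [b]) (by omega) (by simp; omega)
    simp only [List.append_assoc, List.cons_append, List.nil_append] at this
    refine QPath.cons ?_ (by unfold QW; dsimp only; omega) this
    have := BL.mk_val (n := T.C) (l := b :: o) (by simpa using ho)
    simp only [QM.R, toQM, QI.exec, this, cfg]

theorem writef {r : Bool ⊕ T.S} {o v : List Bool} {L : ℕ} (ho : o.length ≤ T.C)
    (hL : v.length + o.length ≤ L) :
    QPath T.toQM.R (QW L) (o.length + 1) (T.cfg (.wf (BL.mk _ o) r) [] v)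
      (T.cfg (T.tgt r) (v ++ o) []) := by
  induction o generalizing v with
  | nil =>
    refine QPath.single ?_ (by simpa [QW] using hL) (by simpa [QW] using hL)
    simp [QM.R, toQM, QI.exec, BL.mk]; rfl
  | cons b o ih =>
    simp only [List.length_cons] at ho hL
    have := ih (v := v ++ [b]) (by omega) (by simp; omega)
    simp only [List.append_assoc, List.cons_append, List.nil_append] at this
    refine QPath.cons ?_ (by unfold QW; simp; omega) this
    have := BL.mk_val (n := T.C) (l := b :: o) (by simpa using ho)
    simp only [QM.R, toQM, QI.exec, this, cfg]

/-- Either a reading state with the given buffer. -/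
def isRd (s : T.S) (buf : List Bool) (q : Q T.S A.k T.C) : Prop :=
  T.toQM.instr q = T.rdI s buf

theorem isRd_at (s : T.S) : T.isRd s [] (T.at' s) := by
  simp [isRd, toQM, at', BL.mk]

/-- Reading a proper part of a block. -/
theorem read_part {s : T.S} {q : Q T.S A.k T.C} {buf x u v : List Bool} {L : ℕ}
    (hq : T.isRd s buf q) (hb : buf.length + x.length < A.k)
    (hL : x.length + u.length + v.length ≤ L) :
    ∃ q', T.isRd s (buf ++ x) q' ∧
      QPath T.toQM.R (QW L) x.length (T.cfg q (x ++ u) v) (T.cfg q' u v) := by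
  induction x generalizing q buf with
  | nil => exact ⟨q, by simpa using hq, QPath.refl (by simpa [QW] using hL)⟩
  | cons b x ih =>
    simp only [List.length_cons] at hb hL
    have e := BL.mk_val (n := A.k) (l := buf ++ [b]) (by simp; omega)
    obtain ⟨q', h1, h2⟩ := ih (q := .rd s (BL.mk _ (buf ++ [b]))) (buf := buf ++ [b])
      (by simp [isRd, toQM, e]) (by simp; omega) (by omega)
    refine ⟨q', by simpa using h1, QPath.cons ?_ (by unfold QW; simp; omega) h2⟩
    unfold isRd at hq
    have : ¬ (buf.length + 1 = A.k) := by omega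
    simp [QM.R, hq, rdI, QI.exec, this]

theorem read_block {s : T.S} {a : A.Γ} {u v : List Bool} {L : ℕ}
    (hL : A.k + u.length + v.length ≤ L) (hL' : u.length + v.length + (T.step s a).2.length ≤ L) :
    QPath T.toQM.R (QW L) (A.k + (T.step s a).2.length) (T.cfg (T.at' s) (A.enc a ++ u) v)
      (T.cfg (T.at' (T.step s a).1) u (v ++ (T.step s a).2)) := by
  have hlen := A.len a
  have hk := A.hk
  have hne : A.enc a ≠ [] := by intro h; rw [h] at hlen; simp at hlen; omega
  obtain ⟨x, b, hx⟩ : ∃ x b, A.enc a = x ++ [b] := ⟨_, _, (List.dropLast_append_getLast hne).symm⟩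
  have hxl : x.length + 1 = A.k := by rw [← hlen, hx]; simp
  obtain ⟨q', h1, h2⟩ := T.read_part (T.isRd_at s) (x := x) (u := b :: u) (v := v) (L := L)
    (by simp; omega) (by simp; omega)
  have h3 : T.toQM.R (T.cfg q' (b :: u) v) (T.cfg (.wr (BL.mk _ (T.step s a).2) (T.step s a).1) u v) := by
    unfold isRd at h1
    simp only [List.nil_append] at h1
    have hd : A.dec (x ++ [b]) = a := by rw [← hx, A.dec_enc]
    simp [QM.R, h1, rdI, QI.exec, hxl, hd]
  have h4 := (h2.trans (QPath.single h3 h2.last (by unfold QW; dsimp only; omega))).trans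
    (T.write (T.step_le s a) (by omega))
  rw [hx]
  rw [hxl] at h4
  simpa using h4

theorem read_all {s : T.S} {l : List A.Γ} {u v : List Bool} {L : ℕ}
    (hL : A.k * l.length + u.length + v.length + (T.runs s l).2.length ≤ L) :
    QPath T.toQM.R (QW L) (A.k * l.length + (T.runs s l).2.length)
      (T.cfg (T.at' s) (A.encs l ++ u) v)
      (T.cfg (T.at' (T.runs s l).1) u (v ++ (T.runs s l).2)) := by
  induction l generalizing s v with
  | nil => simpa [runs] using QPath.refl (R := T.toQM.R) (W := QW L) (by simp [QW]; simp at hL; omega)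
  | cons a l ih =>
    simp only [runs, List.length_cons, List.length_append, Nat.mul_add, Nat.mul_one] at hL ⊢
    have h1 := T.read_block (s := s) (a := a) (u := A.encs l ++ u) (v := v) (L := L)
      (by simp; omega) (by simp; omega)
    have h2 := ih (s := (T.step s a).1) (v := v ++ (T.step s a).2) (by simp; omega)
    have := h1.trans h2
    simp only [List.append_assoc] at this
    simp only [Alph.encs_cons, List.append_assoc]
    convert this using 1
    omega

theorem pass_path {s : T.S} {l : List A.Γ} {L : ℕ}
    (hL : A.k * l.length + (T.pass s l).2.length ≤ L) :
    QPath T.toQM.R (QW L) (A.k * l.length + (T.pass s l).2.length + 2)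
      (T.cfg (T.at' s) (A.encs l) []) (T.cfg (T.tgt (T.pass s l).1) (T.pass s l).2 []) := by
  simp only [pass, List.length_append] at hL ⊢
  have h1 := T.read_all (s := s) (l := l) (u := []) (v := []) (L := L) (by simp; omega)
  simp only [List.append_nil, List.nil_append] at h1
  have h2 : T.toQM.R (T.cfg (T.at' (T.runs s l).1) [] (T.runs s l).2)
      (T.cfg (.wf (BL.mk _ (T.last (T.runs s l).1).2) (T.last (T.runs s l).1).1) [] (T.runs s l).2) := by
    have := T.isRd_at (T.runs s l).1
    unfold isRd at this
    simp [QM.R, this, rdI, QI.exec]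
  have h3 := T.writef (r := (T.last (T.runs s l).1).1) (T.last_le (T.runs s l).1) (v := (T.runs s l).2)
    (L := L) (by omega)
  have := (h1.trans (QPath.single h2 h1.last (by unfold QW; simp; omega))).trans h3
  convert this using 1
  omega

/-- Halting from state `s` with content `u`. -/
def Ends (n L : ℕ) (s : T.S) (u : List Bool) (b : Bool) (y : List Bool) : Prop :=
  ∃ m ≤ n, QPath T.toQM.R (QW L) m (T.cfg (T.at' s) u []) (T.cfg (.hlt b) y [])

variable {T}

theorem Ends.done {L : ℕ} {s : T.S} {l : List A.Γ} {b : Bool} {y : List Bool}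
    (h : T.pass s l = (.inl b, y)) (hL : A.k * l.length + y.length ≤ L) :
    T.Ends (L + 2) L s (A.encs l) b y := by
  have := T.pass_path (s := s) (l := l) (L := L) (by rw [h]; exact hL)
  rw [h] at this
  exact ⟨_, by simpa using hL, this⟩

theorem Ends.next {n L : ℕ} {s s' : T.S} {l : List A.Γ} {b : Bool} {o y : List Bool}
    (h : T.pass s l = (.inr s', o)) (hL : A.k * l.length + o.length ≤ L)
    (h' : T.Ends n L s' o b y) :
    T.Ends (n + (L + 2)) L s (A.encs l) b y := by
  have := T.pass_path (s := s) (l := l) (L := L) (by rw [h]; exact hL)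
  rw [h] at this
  obtain ⟨m, hm, p⟩ := h'
  exact ⟨_, by dsimp only; omega, this.trans p⟩

theorem Ends.mono {n n' L : ℕ} {s : T.S} {u : List Bool} {b : Bool} {y : List Bool}
    (h : T.Ends n L s u b y) (hn : n ≤ n') : T.Ends n' L s u b y := by
  obtain ⟨m, hm, p⟩ := h
  exact ⟨m, by omega, p⟩

theorem Ends.halts {n L : ℕ} {u : List Bool} {b : Bool} {y : List Bool}
    (h : T.Ends n L T.s0 u b y) : ∃ m ≤ n, T.toQM.HaltsIn m L u b y [] := by
  obtain ⟨m, hm, p⟩ := h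
  exact ⟨m, hm, .hlt b, rfl, p⟩

/-- Inputs that end with an incomplete block are rejected. -/
theorem partial_halts {l : List A.Γ} {r : List Bool} {L : ℕ} (hr : r ≠ []) (hr' : r.length < A.k)
    (hL : A.k * l.length + r.length + T.C * l.length ≤ L) :
    ∃ m y v, T.toQM.HaltsIn m L (A.encs l ++ r) false y v := by
  have hc := T.runs_le T.s0 l
  have h1 := T.read_all (s := T.s0) (l := l) (u := r) (v := []) (L := L) (by simp; omega)
  obtain ⟨q', h2, h3⟩ := T.read_part (T.isRd_at (T.runs T.s0 l).1) (x := r) (u := [])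
    (v := (T.runs T.s0 l).2) (L := L) (by simpa using hr') (by simp; omega)
  have h4 : T.toQM.R (T.cfg q' [] (T.runs T.s0 l).2) (T.cfg (.hlt false) [] (T.runs T.s0 l).2) := by
    unfold isRd at h2
    simp [QM.R, h2, rdI, QI.exec, hr]
  simp only [List.append_nil] at h3
  exact ⟨_, _, _, .hlt false, rfl, (h1.trans h3).trans (QPath.single h4 h3.last (by
    unfold QW; simp; omega))⟩

end Tr


/-! ## Polynomial-time families of queue computations -/

/-- `PT i o`: some queue machine turns `i d` into `o d` in polynomial time. -/
def PT {D : Type} (i o : D → List Bool) : Prop :=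
  ∃ (M : QM) (p : Polynomial ℕ), ∀ d, ∃ n L, n ≤ p.eval (i d).length ∧
    M.HaltsIn n L (i d) true (o d) []

theorem QM.HaltsIn.out_le {M : QM} {n L : ℕ} {x y v : List Bool} {b : Bool}
    (h : M.HaltsIn n L x b y v) : y.length ≤ x.length + n := by
  obtain ⟨s, hs, p⟩ := h.grow
  have := p.last
  unfold QW at this
  dsimp only at this
  omega

theorem polyEval_mono (p : Polynomial ℕ) {a b : ℕ} (h : a ≤ b) : p.eval a ≤ p.eval b := by
  induction p using Polynomial.induction_on' with
  | add p q hp hq => simp only [Polynomial.eval_add]; omega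
  | monomial n c =>
    simp only [Polynomial.eval_monomial]
    exact Nat.mul_le_mul_left _ (Nat.pow_le_pow_left h n)

theorem PT.comp {D : Type} {i o r : D → List Bool} (h : PT i o) (h' : PT o r) : PT i r := by
  obtain ⟨M, p, h⟩ := h
  obtain ⟨N, q, h'⟩ := h'
  refine ⟨M.comp N, p + q.comp (Polynomial.X + p), fun d => ?_⟩
  obtain ⟨n, L, h1, h2⟩ := h d
  obtain ⟨n', L', h3, h4⟩ := h' d
  have h5 := h2.out_le
  have h6 : q.eval (o d).length ≤ q.eval ((i d).length + p.eval (i d).length) :=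
    polyEval_mono q (by omega)
  refine ⟨n + n', max L L', ?_, (h2.mono (le_max_left _ _)).comp_true (h4.mono (le_max_right _ _))⟩
  simp only [Polynomial.eval_add, Polynomial.eval_comp, Polynomial.eval_X]
  omega

theorem PT.pullback {D E : Type} {i o : D → List Bool} (h : PT i o) (g : E → D) :
    PT (fun e => i (g e)) (fun e => o (g e)) := by
  obtain ⟨M, p, h⟩ := h
  exact ⟨M, p, fun d => h (g d)⟩

theorem PT.of_tr {A : Alph} (T : Tr A) {D : Type} (l : D → List A.Γ) (o : D → List Bool)
    (p : Polynomial ℕ)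
    (h : ∀ d, ∃ n L, n ≤ p.eval (l d).length ∧ T.Ends n L T.s0 (A.encs (l d)) true (o d)) :
    PT (fun d => A.encs (l d)) o := by
  refine ⟨T.toQM, p, fun d => ?_⟩
  obtain ⟨n, L, h1, h2⟩ := h d
  obtain ⟨m, h3, h4⟩ := h2.halts
  refine ⟨m, L, le_trans (h3.trans h1) (polyEval_mono p ?_), h4⟩
  have := A.hk
  simp only [Alph.encs_length]
  nlinarith

/-- A single pass. -/
theorem PT.of_pass {A : Alph} (T : Tr A) {D : Type} (l : D → List A.Γ) (o : D → List Bool)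
    (h : ∀ d, T.pass T.s0 (l d) = (.inl true, o d)) :
    PT (fun d => A.encs (l d)) o := by
  refine PT.of_tr T l o (Polynomial.C (A.k + T.C) * (Polynomial.X + 1) + 2) fun d => ?_
  refine ⟨_, A.k * (l d).length + (o d).length, ?_, Tr.Ends.done (h d) le_rfl⟩
  have := T.pass_le T.s0 (l d)
  rw [h d] at this
  simp only [Polynomial.eval_add, Polynomial.eval_mul, Polynomial.eval_C, Polynomial.eval_X,
    Polynomial.eval_one, Polynomial.eval_ofNat]
  dsimp only at this
  nlinarith

theorem PT.poly {f : List Bool → List Bool} (h : PT (fun w => w) f) : PolyTimeComputable f := by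
  obtain ⟨M, p, h⟩ := h
  refine M.polyTime f p fun w => ?_
  obtain ⟨n, L, h1, h2⟩ := h w
  exact ⟨n, L, true, h1, h2⟩

/-! ## The alphabets -/

/-- Raw bits. -/
abbrev raw : Alph where
  Γ := Bool
  k := 1
  hk := one_pos
  enc b := [b]
  dec l := l.headD false
  len _ := rfl
  dec_enc _ := rfl

theorem raw_encs (l : List Bool) : raw.encs l = l := by
  induction l with
  | nil => rfl
  | cons a l ih => exact congrArg (List.cons a) ih

inductive Sy where
  | U (b : Bool)
  | M (b : Bool)
  | P
  | N

abbrev sy : Alph where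
  Γ := Sy
  k := 3
  hk := by norm_num
  enc
    | .U b => [false, false, b]
    | .M b => [false, true, b]
    | .P => [true, false, false]
    | .N => [true, true, false]
  dec
    | [false, false, b] => .U b
    | [false, true, b] => .M b
    | [true, true, _] => .N
    | _ => .P
  len a := by cases a <;> rfl
  dec_enc a := by cases a <;> rfl

theorem sy_encs_length (l : List Sy) : (sy.encs l).length = 3 * l.length := Alph.encs_length sy l

@[simp] theorem sy_nil : sy.encs ([] : List Sy) = [] := rfl
@[simp] theorem sy_cons (a : Sy) (l : List Sy) : sy.encs (a :: l) = sy.enc a ++ sy.encs l := rfl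
theorem sy_append (l m : List Sy) : sy.encs (l ++ m) = sy.encs l ++ sy.encs m :=
  Alph.encs_append sy l m

theorem rep_comm {α : Type} (n : ℕ) (a : α) (l : List α) :
    List.replicate n a ++ a :: l = a :: (List.replicate n a ++ l) := by
  induction n with
  | zero => rfl
  | succ n ih => simp [List.replicate_succ, ih]

namespace Loop

/-- One pass of the loop: mark the first unmarked symbol, put an `N` after each `P`. -/
def one : Bool → Sy → Bool × List Sy
  | false, .U b => (true, [.M b])
  | true, .U b => (true, [.U b])
  | s, .M b => (s, [.M b])
  | s, .P => (s, [.P, .N])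
  | s, .N => (s, [.N])

abbrev T : Tr sy where
  S := Bool
  fin := inferInstance
  s0 := false
  step s a := ((one s a).1, sy.encs (one s a).2)
  last s := (if s then .inr false else .inl true, [])

def ones : Bool → List Sy → List Sy
  | _, [] => []
  | s, a :: l => (one s a).2 ++ ones (one s a).1 l

def cU : List Sy → ℕ
  | [] => 0
  | .U _ :: l => cU l + 1
  | _ :: l => cU l

def cP : List Sy → ℕ
  | [] => 0
  | .P :: l => cP l + 1
  | _ :: l => cP l

theorem runs_eq (s : Bool) (l : List Sy) :
    T.runs s l = ((s || decide (0 < cU l)), sy.encs (ones s l)) := by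
  induction l generalizing s with
  | nil => simp [Tr.runs, ones, cU]
  | cons a l ih =>
    simp only [Tr.runs]
    rw [ih]
    cases a <;> cases s <;> simp [one, ones, cU] <;> first | rfl | exact ⟨rfl, rfl⟩

theorem pass_eq (l : List Sy) :
    T.pass false l = ((if 0 < cU l then .inr false else .inl true), sy.encs (ones false l)) := by
  unfold Tr.pass
  rw [runs_eq]
  simp [T]

def fin1 (r : ℕ) : Sy → List Sy
  | .U b => [.M b]
  | .M b => [.M b]
  | .P => .P :: List.replicate (r + 1) .N
  | .N => [.N]

def fin (r : ℕ) (l : List Sy) : List Sy := l.flatMap (fin1 r)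

theorem fin_cons (r : ℕ) (a : Sy) (l : List Sy) : fin r (a :: l) = fin1 r a ++ fin r l := rfl

theorem ones_length (s : Bool) (l : List Sy) : (ones s l).length = l.length + cP l := by
  induction l generalizing s with
  | nil => rfl
  | cons a l ih =>
    cases a <;> cases s <;> simp [one, ones, cP, ih] <;> omega

theorem cP_ones (s : Bool) (l : List Sy) : cP (ones s l) = cP l := by
  induction l generalizing s with
  | nil => rfl
  | cons a l ih => cases a <;> cases s <;> simp [one, ones, cP, ih]

theorem cU_ones (s : Bool) (l : List Sy) : cU (ones s l) = cU l - (if s then 0 else 1) := by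
  induction l generalizing s with
  | nil => cases s <;> rfl
  | cons a l ih => cases a <;> cases s <;> simp [one, ones, cU, ih]

theorem fin_ones (r : ℕ) (s : Bool) (l : List Sy) : fin r (ones s l) = fin (r + 1) l := by
  induction l generalizing s with
  | nil => rfl
  | cons a l ih =>
    cases a <;> cases s <;> simp [one, ones, fin_cons, fin1, ih, List.replicate_succ, rep_comm]

theorem ones_zero (s : Bool) (l : List Sy) (h : cU l = 0) : ones s l = fin 0 l := by
  induction l generalizing s with
  | nil => rfl
  | cons a l ih =>
    cases a <;> cases s <;> simp [cU] at h <;> simp [one, ones, fin_cons, fin1, ih _ h]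

theorem ends (r : ℕ) (l : List Sy) (hr : cU l = r) (L : ℕ)
    (hL : 6 * (l.length + cP l * (r + 1)) ≤ L) :
    T.Ends ((r + 1) * (L + 2)) L false (sy.encs l) true (sy.encs (fin r l)) := by
  induction r generalizing l with
  | zero =>
    have h := pass_eq l
    rw [hr, if_neg (lt_irrefl 0), ones_zero _ _ hr] at h
    rw [Nat.zero_add, Nat.one_mul]
    refine Tr.Ends.done h ?_
    have h1 : 3 * l.length ≤ L := by omega
    rw [← ones_zero false _ hr, sy_encs_length, ones_length]
    show 3 * _ + _ ≤ L
    omega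
  | succ r ih =>
    have h := pass_eq l
    rw [hr, if_pos (Nat.succ_pos r)] at h
    have h2 := ih (ones false l) (by rw [cU_ones, hr]; rfl) (by
      rw [ones_length, cP_ones]; nlinarith)
    rw [fin_ones] at h2
    have h3 := Tr.Ends.next h (L := L) (by
      rw [sy_encs_length, ones_length]
      show 3 * _ + _ ≤ L
      nlinarith) h2
    convert h3 using 1
    ring

theorem cU_le (l : List Sy) : cU l ≤ l.length := by
  induction l with
  | nil => rfl
  | cons a l ih => cases a <;> simp [cU] <;> omega

theorem cP_le (l : List Sy) : cP l ≤ l.length := by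
  induction l with
  | nil => rfl
  | cons a l ih => cases a <;> simp [cP] <;> omega

theorem pt {D : Type} (l : D → List Sy) :
    PT (fun d => sy.encs (l d)) (fun d => sy.encs (fin (cU (l d)) (l d))) := by
  refine PT.of_tr T l _
    ((Polynomial.X + 1) * (6 * (Polynomial.X + Polynomial.X * (Polynomial.X + 1)) + 2)) fun d => ?_
  refine ⟨_, _, ?_, ends _ (l d) rfl _ le_rfl⟩
  simp only [Polynomial.eval_add, Polynomial.eval_mul, Polynomial.eval_X,
    Polynomial.eval_one, Polynomial.eval_ofNat]
  have h1 := cU_le (l d)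
  have h2 := cP_le (l d)
  have h3 : cP (l d) * (cU (l d) + 1) ≤ (l d).length * ((l d).length + 1) :=
    Nat.mul_le_mul h2 (by omega)
  exact Nat.mul_le_mul (by omega) (by omega)

end Loop

/-! ## The padding chain -/

def us (w : List Bool) : List Sy := w.map Sy.U
def ms (w : List Bool) : List Sy := w.map Sy.M

theorem cU_append (l m : List Sy) : Loop.cU (l ++ m) = Loop.cU l + Loop.cU m := by
  induction l with
  | nil => simp [Loop.cU]
  | cons a l ih => cases a <;> simp [Loop.cU, ih] <;> omega

theorem cU_us (w : List Bool) : Loop.cU (us w) = w.length := by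
  induction w with
  | nil => rfl
  | cons a l ih => simpa [us, Loop.cU] using ih

theorem cU_P (m : ℕ) : Loop.cU (List.replicate m .P) = 0 := by
  induction m with
  | zero => rfl
  | succ m ih => simpa [List.replicate_succ, Loop.cU] using ih

theorem fin_append (r : ℕ) (l m : List Sy) :
    Loop.fin r (l ++ m) = Loop.fin r l ++ Loop.fin r m := by simp [Loop.fin]

theorem fin_us (r : ℕ) (w : List Bool) : Loop.fin r (us w) = ms w := by
  induction w with
  | nil => rfl
  | cons a l ih => exact congrArg (List.cons _) ih

/-- Symbolwise maps as one-state transducers. -/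
def mapT (A : Alph) (g : A.Γ → List Bool) (e : List Bool) : Tr A where
  S := Unit
  fin := inferInstance
  s0 := ()
  step _ a := ((), g a)
  last _ := (.inl true, e)

theorem mapT_pass (A : Alph) (g : A.Γ → List Bool) (e : List Bool) (l : List A.Γ) :
    (mapT A g e).pass () l = (.inl true, l.flatMap g ++ e) := by
  have : ∀ l, (mapT A g e).runs () l = ((), l.flatMap g) := by
    intro l
    induction l with
    | nil => rfl
    | cons a l ih =>
      show (((mapT A g e).runs () l).1, g a ++ ((mapT A g e).runs () l).2) = _
      rw [ih]; rfl
  unfold Tr.pass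
  rw [this]
  rfl

/-- Transducers treating the first symbol specially. -/
def fstT (A : Alph) (g : Bool → A.Γ → List Bool) (e : Bool → List Bool) : Tr A where
  S := Bool
  fin := inferInstance
  s0 := true
  step s a := (false, g s a)
  last s := (.inl true, e s)

theorem fstT_pass (A : Alph) (g : Bool → A.Γ → List Bool) (e : Bool → List Bool) (a : A.Γ)
    (l : List A.Γ) :
    (fstT A g e).pass true (a :: l) = (.inl true, g true a ++ l.flatMap (g false) ++ e false) := by
  have : ∀ l, (fstT A g e).runs false l = (false, l.flatMap (g false)) := by
    intro l
    induction l with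
    | nil => rfl
    | cons a l ih =>
      show (((fstT A g e).runs false l).1, g false a ++ ((fstT A g e).runs false l).2) = _
      rw [ih]; rfl
  unfold Tr.pass
  show (Sum.inl true, (g true a ++ ((fstT A g e).runs false l).2) ++ e ((fstT A g e).runs false l).1) = _
  rw [this]
  rfl

theorem fstT_nil (A : Alph) (g : Bool → A.Γ → List Bool) (e : Bool → List Bool) :
    (fstT A g e).pass true [] = (.inl true, e true) := rfl

theorem pt_start : PT (fun w => w) (fun w => sy.encs (us w ++ [.P])) := by
  have := PT.of_pass (mapT raw (fun b => sy.enc (.U b)) (sy.enc .P)) (fun w : List Bool => w)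
    (fun w => sy.encs (us w ++ [.P])) (fun w => by
      refine (mapT_pass raw _ _ _).trans ?_
      congr 1
      rw [Alph.encs_append]
      simp [us, Alph.encs, List.flatMap_map])
  simpa only [raw_encs] using this

def unmark : Sy → Sy
  | .U b => .U b
  | .M b => .U b
  | .P => .P
  | .N => .P

theorem pt_mul (m : List Bool → ℕ) :
    PT (fun w => sy.encs (us w ++ List.replicate (m w) .P))
      (fun w => sy.encs (us w ++ List.replicate (m w * (w.length + 2)) .P)) := by
  refine (Loop.pt _).comp (PT.of_pass (mapT sy (fun a => sy.enc (unmark a)) []) _ _ fun w => ?_)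
  refine (mapT_pass sy _ _ _).trans ?_
  congr 1
  rw [List.append_nil]
  have h1 : ∀ l : List Sy, (l.flatMap fun a => sy.enc (unmark a)) = sy.encs (l.map unmark) := by
    intro l; simp [Alph.encs, List.flatMap_map]
  refine (h1 _).trans ?_
  congr 1
  rw [cU_append, cU_us, cU_P, fin_append, fin_us, Nat.add_zero, List.map_append]
  congr 1
  · simp [ms, us, unmark]
  · generalize m w = k
    induction k with
    | zero => simp [Loop.fin]
    | succ k ih =>
      rw [List.replicate_succ, ← List.singleton_append, fin_append, List.map_append, ih]
      rw [Nat.succ_mul, Nat.add_comm (k * _), List.replicate_add]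
      congr 1
      simp [Loop.fin, Loop.fin1, unmark, List.replicate_succ]

theorem pt_pad (k : ℕ) :
    PT (fun w => w) (fun w => sy.encs (us w ++ List.replicate ((w.length + 2) ^ k) .P)) := by
  induction k with
  | zero => simpa using pt_start
  | succ k ih =>
    have := ih.comp (pt_mul _)
    simpa only [pow_succ] using this

/-! ## The final encoding -/

def Fenc (x : List Bool) : List Bool :=
  List.replicate (x.length + 1) true ++ false :: (x ++ [true, false, false])

theorem Fenc_eq (x : List Bool) : Fenc x = encodeVec (cv false (num x) 0 0) := by
  have : cv false (num x) 0 0 = ![num x, 0, 0] := by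
    ext j; fin_cases j <;> simp [cv]
  rw [this]
  simp [encodeVec, Fenc, encodeNatU, num_bits, List.ofFn_succ]

def preT : Tr raw := fstT raw (fun f b => if f then sy.encs [.P, .U b] else sy.enc (.U b))
  (fun f => if f then sy.enc .P else [])

def postT : Tr sy where
  S := Bool
  fin := inferInstance
  s0 := true
  step s a := match a with
    | .M b => (false, if s then [false, b] else [b])
    | .N => (s, [true])
    | _ => (s, [])
  last s := (.inl true, (if s then [false] else []) ++ [true, false, false])

theorem post_ms (x : List Bool) : postT.runs false (ms x) = (false, x) := by
  induction x with
  | nil => rfl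
  | cons a l ih =>
    show ((postT.runs false (ms l)).1, [a] ++ (postT.runs false (ms l)).2) = _
    rw [ih]; rfl

theorem post_N (n : ℕ) (l : List Sy) : postT.runs true (List.replicate n .N ++ l) =
    ((postT.runs true l).1, List.replicate n true ++ (postT.runs true l).2) := by
  induction n with
  | zero => rfl
  | succ n ih =>
    show ((postT.runs true (List.replicate n .N ++ l)).1, [true] ++ (postT.runs true (List.replicate n .N ++ l)).2) = _
    rw [ih]; rfl

theorem pt_Fenc : PT (fun x => x) Fenc := by
  have h1 : PT (fun x => x) (fun x => sy.encs (.P :: us x)) := by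
    have := PT.of_pass preT (fun w : List Bool => w) (fun x => sy.encs (.P :: us x)) (fun w => by
      cases w with
      | nil => rfl
      | cons a l =>
        refine (fstT_pass raw _ _ _ _).trans ?_
        congr 1
        simp [us, Alph.encs, List.flatMap_map])
    simpa only [raw_encs] using this
  refine (h1.comp (Loop.pt _)).comp (PT.of_pass postT _ _ fun x => ?_)
  have h2 : Loop.fin (Loop.cU (.P :: us x)) (.P :: us x) =
      .P :: (List.replicate (x.length + 1) .N ++ ms x) := by
    have : Loop.cU (.P :: us x) = x.length := cU_us x
    rw [this, Loop.fin_cons, fin_us]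
    rfl
  rw [h2]
  have h3 := post_N (x.length + 1) (ms x)
  show ((postT.last (postT.runs true (List.replicate (x.length + 1) .N ++ ms x)).1).1,
    (postT.runs true (List.replicate (x.length + 1) .N ++ ms x)).2 ++
    (postT.last (postT.runs true (List.replicate (x.length + 1) .N ++ ms x)).1).2) = _
  rw [h3]
  cases x with
  | nil => rfl
  | cons a l =>
    have : postT.runs true (ms (a :: l)) = (false, false :: a :: l) := by
      show ((postT.runs false (ms l)).1, [false, a] ++ (postT.runs false (ms l)).2) = _
      rw [post_ms]; rfl
    rw [this]
    simp [postT, Fenc]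


/-! ## Checking that a word is an encoding -/

namespace Chk

abbrev parseT : Tr raw where
  S := Bool
  fin := inferInstance
  s0 := false
  step s b := match s, b with
    | false, true => (false, sy.enc .N)
    | false, false => (true, [])
    | true, b => (true, sy.enc (.U b))
  last s := (.inl s, [])

theorem parse_true (ys : List Bool) : parseT.runs true ys = (true, sy.encs (us ys)) := by
  induction ys with
  | nil => rfl
  | cons b ys ih =>
    show ((parseT.runs true ys).1, sy.enc (.U b) ++ (parseT.runs true ys).2) = _
    rw [ih]; rfl

theorem parse_rep (a : ℕ) (l : List Bool) : parseT.runs false (List.replicate a true ++ l) =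
    ((parseT.runs false l).1, sy.encs (List.replicate a .N) ++ (parseT.runs false l).2) := by
  induction a with
  | zero => rfl
  | succ a ih =>
    show ((parseT.runs false (List.replicate a true ++ l)).1,
      sy.enc .N ++ (parseT.runs false (List.replicate a true ++ l)).2) = _
    rw [ih]; simp [List.replicate_succ]; rfl

theorem split_word (u : List Bool) : (∃ a, u = List.replicate a true) ∨
    ∃ a ys, u = List.replicate a true ++ false :: ys := by
  induction u with
  | nil => exact .inl ⟨0, rfl⟩
  | cons b u ih =>
    cases b with
    | false => exact .inr ⟨0, u, rfl⟩
    | true =>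
      rcases ih with ⟨a, rfl⟩ | ⟨a, ys, rfl⟩
      · exact .inl ⟨a + 1, rfl⟩
      · exact .inr ⟨a + 1, ys, rfl⟩

inductive St where
  | start | find | copy | hold (b : Bool) | u1 | u2 | bad

def St.code : St → Fin 8
  | .start => 0
  | .find => 1
  | .copy => 2
  | .hold false => 3
  | .hold true => 4
  | .u1 => 5
  | .u2 => 6
  | .bad => 7

theorem St.fin : Finite St := Finite.of_injective St.code (by
  intro a b h
  cases a <;> cases b <;> first | rfl | skip
  all_goals first
    | (rename_i x y; cases x <;> cases y <;> first | rfl | (simp [St.code] at h))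
    | (rename_i x; cases x <;> simp [St.code] at h)
    | simp [St.code] at h)

abbrev T : Tr sy where
  S := St
  fin := St.fin
  s0 := .start
  step s a := match s, a with
    | .start, .N => (.find, [])
    | .start, .M b => (.hold b, [])
    | .find, .U b => (.copy, sy.enc (.M b))
    | .find, a => (.find, sy.enc a)
    | .copy, a => (.copy, sy.enc a)
    | .hold c, .M b => (.hold b, [c])
    | .hold true, .U false => (.u1, [])
    | .u1, .U false => (.u2, [])
    | _, _ => (.bad, [])
  last s := match s with
    | .copy => (.inr .start, [])
    | .u2 => (.inl true, [])
    | _ => (.inl false, [])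

theorem runs_bad (l : List Sy) : T.runs .bad l = (.bad, []) := by
  induction l with
  | nil => rfl
  | cons a l ih =>
    show ((T.runs .bad l).1, [] ++ (T.runs .bad l).2) = _
    rw [ih]; rfl

theorem runs_copy (l : List Sy) : T.runs .copy l = (.copy, sy.encs l) := by
  induction l with
  | nil => rfl
  | cons a l ih =>
    show ((T.runs .copy l).1, sy.enc a ++ (T.runs .copy l).2) = _
    rw [ih]; rfl

theorem runs_find (a : ℕ) (xs : List Bool) (l : List Sy) :
    T.runs .find (List.replicate a .N ++ ms xs ++ l) =
    ((T.runs .find l).1, sy.encs (List.replicate a .N ++ ms xs) ++ (T.runs .find l).2) := by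
  induction a with
  | zero =>
    induction xs with
    | nil => rfl
    | cons x xs ih =>
      simp only [List.replicate_zero, List.nil_append] at ih ⊢
      show ((T.runs .find (ms xs ++ l)).1, sy.enc (.M x) ++ (T.runs .find (ms xs ++ l)).2) = _
      rw [ih]
      simp [ms]; rfl
  | succ a ih =>
    show ((T.runs .find (List.replicate a .N ++ ms xs ++ l)).1,
      sy.enc .N ++ (T.runs .find (List.replicate a .N ++ ms xs ++ l)).2) = _
    rw [ih]; simp [List.replicate_succ]; rfl

theorem runs_hold (c : Bool) (xs : List Bool) (l : List Sy) :
    T.runs (.hold c) (ms xs ++ l) = ((T.runs (.hold ((c :: xs).getLast (by simp))) l).1,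
      (c :: xs).dropLast ++ (T.runs (.hold ((c :: xs).getLast (by simp))) l).2) := by
  induction xs generalizing c with
  | nil => simp [ms]
  | cons x xs ih =>
    show ((T.runs (.hold x) (ms xs ++ l)).1, [c] ++ (T.runs (.hold x) (ms xs ++ l)).2) = _
    rw [ih]
    simp

theorem runs_tail (c : Bool) (ys : List Bool) :
    (c = true ∧ ys = [false, false] ∧ T.runs (.hold c) (us ys) = (.u2, [])) ∨
    (¬ (c = true ∧ ys = [false, false]) ∧ ∃ s, (s = .bad ∨ s = .u1 ∨ s = .hold c) ∧
      T.runs (.hold c) (us ys) = (s, [])) := by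
  cases c with
  | false =>
    right
    refine ⟨by simp, ?_⟩
    cases ys with
    | nil => exact ⟨_, .inr (.inr rfl), rfl⟩
    | cons y ys =>
      exact ⟨_, .inl rfl, by
        cases y <;> (show ((T.runs .bad (us ys)).1, [] ++ (T.runs .bad (us ys)).2) = _; rw [runs_bad]; rfl)⟩
  | true =>
    match ys with
    | [] => exact .inr ⟨by simp, _, .inr (.inr rfl), rfl⟩
    | true :: ys =>
      exact .inr ⟨by simp, _, .inl rfl, by
        show ((T.runs .bad (us ys)).1, [] ++ (T.runs .bad (us ys)).2) = _; rw [runs_bad]; rfl⟩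
    | [false] => exact .inr ⟨by simp, _, .inr (.inl rfl), rfl⟩
    | false :: true :: ys =>
      exact .inr ⟨by simp, _, .inl rfl, by
        show ((T.runs .bad (us ys)).1, [] ++ ([] ++ (T.runs .bad (us ys)).2)) = _; rw [runs_bad]; rfl⟩
    | [false, false] => exact .inl ⟨rfl, rfl, rfl⟩
    | false :: false :: y :: ys =>
      exact .inr ⟨by simp, _, .inl rfl, by
        show ((T.runs .bad (us ys)).1, [] ++ ([] ++ ([] ++ (T.runs .bad (us ys)).2))) = _
        rw [runs_bad]; rfl⟩

theorem ends (a : ℕ) (xs ys : List Bool) (L : ℕ) (hL : 6 * (a + xs.length + ys.length) ≤ L) :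
    (∃ x, (xs ++ ys = x ++ [true, false, false] ∧ x.length + 1 = a + xs.length) ∧
      ∃ n, T.Ends n L .start (sy.encs (List.replicate a .N ++ ms xs ++ us ys)) true x) ∨
    ((¬ ∃ x, xs ++ ys = x ++ [true, false, false] ∧ x.length + 1 = a + xs.length) ∧
      ∃ n y, T.Ends n L .start (sy.encs (List.replicate a .N ++ ms xs ++ us ys)) false y) := by
  have hlen : (List.replicate a Sy.N ++ ms xs ++ us ys).length = a + xs.length + ys.length := by
    simp [ms, us]; omega
  induction a generalizing xs ys with
  | zero =>
    simp only [Nat.zero_add] at *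
    cases xs with
    | nil =>
      right
      refine ⟨by simp, _, [], Tr.Ends.done ?_ ?_⟩
      · cases ys with
        | nil => rfl
        | cons y ys =>
          have : T.runs .start (us (y :: ys)) = (.bad, []) := by
            show ((T.runs .bad (us ys)).1, [] ++ (T.runs .bad (us ys)).2) = _; rw [runs_bad]; rfl
          show T.pass .start (us (y :: ys)) = _
          unfold Tr.pass
          rw [this]; rfl
      · rw [hlen]; show 3 * _ + 0 ≤ _; omega
    | cons x xs =>
      have h1 : T.runs .start (ms (x :: xs) ++ us ys) =
          ((T.runs (.hold ((x :: xs).getLast (by simp))) (us ys)).1,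
            (x :: xs).dropLast ++ (T.runs (.hold ((x :: xs).getLast (by simp))) (us ys)).2) :=
        runs_hold x xs (us ys)
      have hd : x :: xs = (x :: xs).dropLast ++ [(x :: xs).getLast (by simp)] :=
        (List.dropLast_append_getLast (by simp)).symm
      have hdl : (x :: xs).dropLast.length + 1 = (x :: xs).length := by simp
      generalize (x :: xs).getLast (by simp) = c at *
      generalize (x :: xs).dropLast = z at *
      rw [hd] at h1 ⊢
      have hlen' : 3 * (ms (z ++ [c]) ++ us ys).length + z.length ≤ L := by
        simp [ms, us] at *; omega
      rcases runs_tail c ys with ⟨rfl, rfl, h2⟩ | ⟨hn, s, hs, h2⟩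
      · left
        refine ⟨z, ⟨by simp, by simp⟩, _, Tr.Ends.done ?_ hlen'⟩
        show T.pass .start (ms (z ++ [true]) ++ us [false, false]) = _
        unfold Tr.pass
        rw [h1, h2]
        simp
      · right
        refine ⟨?_, _, z, Tr.Ends.done ?_ hlen'⟩
        · rintro ⟨x', h3, h4⟩
          apply hn
          have h5 : z.length = x'.length := by simp at h4; omega
          have h6 : z ++ (c :: ys) = x' ++ [true, false, false] := by simpa using h3
          have := (List.append_inj h6 h5).2
          simpa using this
        · show T.pass .start (ms (z ++ [c]) ++ us ys) = _
          unfold Tr.pass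
          rw [h1, h2]
          rcases hs with rfl | rfl | rfl <;> simp
  | succ a ih =>
    cases ys with
    | nil =>
      right
      refine ⟨?_, ?_⟩
      · rintro ⟨x, h1, h2⟩
        have := congrArg List.length h1
        simp at this
        omega
      · refine ⟨_, sy.encs (List.replicate a .N ++ ms xs), Tr.Ends.done ?_ ?_⟩
        · have h1 : T.runs .start (List.replicate (a + 1) .N ++ ms xs ++ us []) =
            (.find, sy.encs (List.replicate a .N ++ ms xs)) := by
            show ((T.runs .find (List.replicate a .N ++ ms xs ++ us [])).1,
              [] ++ (T.runs .find (List.replicate a .N ++ ms xs ++ us [])).2) = _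
            rw [runs_find]
            show (_, [] ++ (sy.encs (List.replicate a .N ++ ms xs) ++ [])) = _
            simp [Tr.runs, us]
          unfold Tr.pass
          rw [h1]
          simp
        · rw [hlen, sy_encs_length]
          simp [ms] at *
          omega
    | cons y ys =>
      have h1 : T.runs .start (List.replicate (a + 1) .N ++ ms xs ++ us (y :: ys)) =
          (.copy, sy.encs (List.replicate a .N ++ ms (xs ++ [y]) ++ us ys)) := by
        show ((T.runs .find (List.replicate a .N ++ ms xs ++ us (y :: ys))).1,
          [] ++ (T.runs .find (List.replicate a .N ++ ms xs ++ us (y :: ys))).2) = _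
        rw [runs_find]
        have : T.runs .find (us (y :: ys)) = (.copy, sy.encs (.M y :: us ys)) := by
          show ((T.runs .copy (us ys)).1, sy.enc (.M y) ++ (T.runs .copy (us ys)).2) = _
          rw [runs_copy]; rfl
        rw [this]
        simp [ms, sy_append]
      have h2 : T.pass .start (List.replicate (a + 1) .N ++ ms xs ++ us (y :: ys)) =
          (.inr .start, sy.encs (List.replicate a .N ++ ms (xs ++ [y]) ++ us ys)) := by
        unfold Tr.pass
        rw [h1]
        simp
      have hL' : sy.k * (List.replicate (a + 1) Sy.N ++ ms xs ++ us (y :: ys)).length +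
          (sy.encs (List.replicate a .N ++ ms (xs ++ [y]) ++ us ys)).length ≤ L := by
        rw [hlen, sy_encs_length]
        simp [ms, us] at *
        omega
      have e1 : (xs ++ [y]) ++ ys = xs ++ y :: ys := by simp
      have e2 : a + (xs ++ [y]).length = a + 1 + xs.length := by simp; omega
      have := ih (xs ++ [y]) ys (by simp at *; omega) (by simp [ms, us]; omega)
      rw [e1, e2] at this
      rcases this with ⟨x, h3, n, h4⟩ | ⟨h3, n, z, h4⟩
      · exact .inl ⟨x, h3, _, Tr.Ends.next h2 hL' h4⟩
      · exact .inr ⟨h3, _, z, Tr.Ends.next h2 hL' h4⟩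

theorem Fenc_parse (x : List Bool) (a : ℕ) (ys : List Bool) :
    List.replicate a true ++ false :: ys = Fenc x ↔
      ys = x ++ [true, false, false] ∧ x.length + 1 = a := by
  unfold Fenc
  generalize x.length + 1 = b
  generalize x ++ [true, false, false] = z
  induction a generalizing b with
  | zero => cases b <;> simp [List.replicate_succ]
  | succ a ih =>
    cases b with
    | zero => simp [List.replicate_succ]
    | succ b => simpa [List.replicate_succ] using ih b

theorem spec : ∃ (K : QM) (p : Polynomial ℕ), ∀ u : List Bool, ∃ n L, L ≤ p.eval u.length ∧
    ((∃ x, u = Fenc x ∧ K.HaltsIn n L u true x []) ∨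
      ((¬ ∃ x, u = Fenc x) ∧ ∃ y v, K.HaltsIn n L u false y v)) := by
  refine ⟨parseT.toQM.comp T.toQM, 6 * Polynomial.X, fun u => ?_⟩
  simp only [Polynomial.eval_mul, Polynomial.eval_ofNat, Polynomial.eval_X]
  rcases split_word u with ⟨a, rfl⟩ | ⟨a, ys, rfl⟩
  · have h1 : parseT.pass false (List.replicate a true) = (.inl false, sy.encs (List.replicate a .N)) := by
      have := parse_rep a []
      rw [List.append_nil] at this
      unfold Tr.pass
      rw [this]
      simp [Tr.runs]
    have h2 := Tr.Ends.done h1 (L := 6 * a) (by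
      rw [sy_encs_length]; simp; omega)
    obtain ⟨m, _, h3⟩ := h2.halts
    rw [raw_encs] at h3
    refine ⟨m, 6 * a, by simp, .inr ⟨?_, _, _, h3.comp_false⟩⟩
    rintro ⟨x, hx⟩
    have : false ∈ List.replicate a true := by rw [hx]; simp [Fenc]
    simp at this
  · have h1 : parseT.pass false (List.replicate a true ++ false :: ys) =
        (.inl true, sy.encs (List.replicate a .N ++ us ys)) := by
      have h0 : parseT.runs false (false :: ys) = (true, sy.encs (us ys)) := by
        show ((parseT.runs true ys).1, [] ++ (parseT.runs true ys).2) = _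
        rw [parse_true]; rfl
      unfold Tr.pass
      rw [parse_rep, h0]
      simp [sy_append]
    have h2 := Tr.Ends.done h1 (L := 6 * (a + ys.length + 1)) (by
      rw [sy_encs_length]; simp [us]; try omega)
    obtain ⟨m, _, h3⟩ := h2.halts
    rw [raw_encs] at h3
    have h4 := ends a [] ys (6 * (a + ys.length + 1)) (by simp)
    simp only [ms, List.map_nil, List.append_nil, List.nil_append, List.length_nil, Nat.add_zero]
      at h4
    rcases h4 with ⟨x, h5, n, h6⟩ | ⟨h5, n, z, h6⟩
    · obtain ⟨k, _, h7⟩ := h6.halts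
      exact ⟨_, 6 * (a + ys.length + 1), by simp <;> omega, .inl ⟨x, (Fenc_parse _ _ _).2 h5, h3.comp_true h7⟩⟩
    · obtain ⟨k, _, h7⟩ := h6.halts
      refine ⟨_, 6 * (a + ys.length + 1), by simp <;> omega, .inr ⟨?_, _, _, h3.comp_true h7⟩⟩
      rintro ⟨x, hx⟩
      exact h5 ⟨x, (Fenc_parse _ _ _).1 hx⟩

end Chk


/-! ## The universal ring machine -/

namespace Ring

/-- Instructions: a conditionality flag and an opcode. -/
abbrev Ins := Bool × Bool × Bool × Bool

abbrev iE : Ins := (false, false, false, false)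
abbrev iT : Ins := (false, false, false, true)
abbrev iT0 : Ins := (false, false, true, false)
abbrev iX : Ins := (true, false, true, true)
abbrev iH : Ins := (true, true, false, false)
abbrev iR : Ins := (false, true, false, true)
abbrev iL : Ins := (false, true, true, false)
abbrev iRc : Ins := (true, true, false, true)
abbrev iLc : Ins := (true, true, true, false)

/-- New flag. -/
def fN (i : Ins) (f d : Bool) : Bool := match i.2 with
  | (false, false, false) => true
  | (false, false, true) => f && d
  | (false, true, false) => f && !d
  | _ => f

/-- New bit under the head. -/
def dN (i : Ins) (f d : Bool) : Bool := match i.2 with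
  | (false, true, true) => if !i.1 || f then !d else d
  | _ => d

/-- Head movement: `some true` is right. -/
def mN (i : Ins) (f : Bool) : Option Bool := match i.2 with
  | (true, false, true) => if !i.1 || f then some true else none
  | (true, true, false) => if !i.1 || f then some false else none
  | _ => none

/-- Acceptance. -/
def aN (i : Ins) (f : Bool) : Bool := match i.2 with
  | (true, false, false) => !i.1 || f
  | _ => false

abbrev Blk := Ins × Bool × Bool

abbrev blk : Alph where
  Γ := Blk
  k := 6
  hk := by norm_num
  enc a := [a.1.1, a.1.2.1, a.1.2.2.1, a.1.2.2.2, a.2.1, a.2.2]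
  dec
    | [c, x, y, z, d, k] => ((c, x, y, z), d, k)
    | _ => (iE, false, false)
  len _ := rfl
  dec_enc _ := rfl

theorem blk_split (m : ℕ) (x : List Bool) (h : x.length ≤ m) :
    ∃ (l : List Blk) (r : List Bool), x = blk.encs l ++ r ∧ r.length < 6 := by
  induction m using Nat.strong_induction_on generalizing x with
  | _ m ih =>
    match x, h with
    | [], _ => exact ⟨[], [], rfl, by simp⟩
    | [a], _ => exact ⟨[], [a], rfl, by simp⟩
    | [a, b], _ => exact ⟨[], [a, b], rfl, by simp⟩
    | [a, b, c], _ => exact ⟨[], [a, b, c], rfl, by simp⟩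
    | [a, b, c, d], _ => exact ⟨[], [a, b, c, d], rfl, by simp⟩
    | [a, b, c, d, e], _ => exact ⟨[], [a, b, c, d, e], rfl, by simp⟩
    | a :: b :: c :: d :: e :: f :: x, h =>
      simp at h
      obtain ⟨l, r, h1, h2⟩ := ih (m - 1) (by omega) x (by omega)
      exact ⟨((a, b, c, d), e, f) :: l, r, by rw [h1]; rfl, h2⟩

structure US where
  i : Ins
  d : Bool
  f : Bool
  c : Bool
  m : Option Bool
  acc : Bool
  r : Bool
  hold : Option (Ins × Bool)

theorem US.fin : Finite US := by
  refine Finite.of_injective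
    (fun s : US => (s.i, s.d, s.f, s.c, s.m, s.acc, s.r, s.hold)) ?_
  rintro ⟨⟩ ⟨⟩ h
  simp only [Prod.mk.injEq] at h
  obtain ⟨rfl, rfl, rfl, rfl, rfl, rfl, rfl, rfl⟩ := h
  rfl

def start (i : Ins) (f d : Bool) : US :=
  ⟨i, dN i f d, fN i f d, true, mN i f, aN i f, dN i f d, none⟩

abbrev U : Tr blk where
  S := US
  fin := US.fin
  s0 := start iE true false
  step s b := match s.m with
    | none => ({s with i := b.1, c := b.2.2 && s.c}, blk.enc (s.i, b.2.1, xor b.2.2 s.c))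
    | some false => ({s with i := b.1, c := b.2.2 && s.c, d := b.2.1},
        blk.enc (s.i, s.d, xor b.2.2 s.c))
    | some true => match s.hold with
      | none => ({s with i := b.1, c := b.2.2 && s.c, d := b.2.1,
                         hold := some (s.i, xor b.2.2 s.c)}, [])
      | some (hi, hk) => ({s with i := b.1, c := b.2.2 && s.c,
                                  hold := some (s.i, xor b.2.2 s.c)}, blk.enc (hi, b.2.1, hk))
  last s := (if s.acc then .inl true else if s.c then .inl false else .inr (start s.i s.f s.d),
    match s.hold with
    | none => []
    | some (hi, hk) => blk.enc (hi, s.r, hk))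

def shR {α : Type} : α → List α → α × List α
  | a, [] => (a, [])
  | a, b :: l => ((shR b l).1, a :: (shR b l).2)

def shL {α : Type} : α → List α → α × List α
  | a, [] => (a, [])
  | a, b :: l => (b, l ++ [a])

def inc : Bool → List Bool → Bool × List Bool
  | c, [] => (c, [])
  | c, k :: l => ((inc (k && c) l).1, xor k c :: (inc (k && c) l).2)

abbrev tI (w : List Blk) : List Ins := w.map fun b => b.1
abbrev tD (w : List Blk) : List Bool := w.map fun b => b.2.1
abbrev tK (w : List Blk) : List Bool := w.map fun b => b.2.2

theorem runs_stay (s : US) (hm : s.m = none) (w : List Blk) :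
    ∃ w', U.runs s w = ({s with i := (shR s.i (tI w)).1, c := (inc s.c (tK w)).1}, blk.encs w') ∧
      tI w' = (shR s.i (tI w)).2 ∧ tD w' = tD w ∧ tK w' = (inc s.c (tK w)).2 := by
  induction w generalizing s with
  | nil => exact ⟨[], rfl, rfl, rfl, rfl⟩
  | cons b w ih =>
    obtain ⟨i, d, f, c, m, acc, r, hold⟩ := s
    dsimp only at hm
    subst hm
    obtain ⟨w', h1, h2, h3, h4⟩ := ih ⟨b.1, d, f, b.2.2 && c, none, acc, r, hold⟩ rfl
    refine ⟨(i, b.2.1, xor b.2.2 c) :: w', ?_, ?_, ?_, ?_⟩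
    · show ((U.runs ⟨b.1, d, f, b.2.2 && c, none, acc, r, hold⟩ w).1,
        blk.enc (i, b.2.1, xor b.2.2 c) ++ (U.runs ⟨b.1, d, f, b.2.2 && c, none, acc, r, hold⟩ w).2) = _
      rw [h1]; rfl
    · simp only [tI, List.map_cons, shR] at h2 ⊢; rw [h2]
    · simp only [tD, List.map_cons] at h3 ⊢; rw [h3]
    · simp only [tK, List.map_cons, inc] at h4 ⊢; rw [h4]

theorem runs_right (s : US) (hm : s.m = some false) (w : List Blk) :
    ∃ w', U.runs s w = ({s with i := (shR s.i (tI w)).1, c := (inc s.c (tK w)).1,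
                                d := (shR s.d (tD w)).1}, blk.encs w') ∧
      tI w' = (shR s.i (tI w)).2 ∧ tD w' = (shR s.d (tD w)).2 ∧ tK w' = (inc s.c (tK w)).2 := by
  induction w generalizing s with
  | nil => exact ⟨[], rfl, rfl, rfl, rfl⟩
  | cons b w ih =>
    obtain ⟨i, d, f, c, m, acc, r, hold⟩ := s
    dsimp only at hm
    subst hm
    obtain ⟨w', h1, h2, h3, h4⟩ := ih ⟨b.1, b.2.1, f, b.2.2 && c, some false, acc, r, hold⟩ rfl
    refine ⟨(i, d, xor b.2.2 c) :: w', ?_, ?_, ?_, ?_⟩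
    · show ((U.runs ⟨b.1, b.2.1, f, b.2.2 && c, some false, acc, r, hold⟩ w).1,
        blk.enc (i, d, xor b.2.2 c) ++
          (U.runs ⟨b.1, b.2.1, f, b.2.2 && c, some false, acc, r, hold⟩ w).2) = _
      rw [h1]; rfl
    · simp only [tI, List.map_cons, shR] at h2 ⊢; rw [h2]
    · simp only [tD, List.map_cons, shR] at h3 ⊢; rw [h3]
    · simp only [tK, List.map_cons, inc] at h4 ⊢; rw [h4]

theorem runs_left (s : US) (hm : s.m = some true) (w : List Blk) (hi : Ins) (hk : Bool)
    (hh : s.hold = some (hi, hk)) :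
    ∃ w' hi' hk', U.runs s w = ({s with i := (shR s.i (tI w)).1, c := (inc s.c (tK w)).1,
                                        hold := some (hi', hk')}, blk.encs w') ∧
      tI w' ++ [hi'] = hi :: (shR s.i (tI w)).2 ∧ tD w' = tD w ∧
      tK w' ++ [hk'] = hk :: (inc s.c (tK w)).2 := by
  induction w generalizing s hi hk with
  | nil =>
    obtain ⟨i, d, f, c, m, acc, r, hold⟩ := s
    dsimp only at hm hh
    subst hm hh
    exact ⟨[], hi, hk, rfl, rfl, rfl, rfl⟩
  | cons b w ih =>
    obtain ⟨i, d, f, c, m, acc, r, hold⟩ := s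
    dsimp only at hm hh
    subst hm hh
    obtain ⟨w', hi', hk', h1, h2, h3, h4⟩ :=
      ih ⟨b.1, d, f, b.2.2 && c, some true, acc, r, some (i, xor b.2.2 c)⟩ rfl i (xor b.2.2 c) rfl
    refine ⟨(hi, b.2.1, hk) :: w', hi', hk', ?_, ?_, ?_, ?_⟩
    · show ((U.runs ⟨b.1, d, f, b.2.2 && c, some true, acc, r, some (i, xor b.2.2 c)⟩ w).1,
        blk.enc (hi, b.2.1, hk) ++
          (U.runs ⟨b.1, d, f, b.2.2 && c, some true, acc, r, some (i, xor b.2.2 c)⟩ w).2) = _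
      rw [h1]; rfl
    · simp only [tI, List.map_cons, shR, List.cons_append] at h2 ⊢; rw [h2]
    · simp only [tD, List.map_cons] at h3 ⊢; rw [h3]
    · simp only [tK, List.map_cons, inc, List.cons_append] at h4 ⊢; rw [h4]

/-- The effect of the head movement on the data ring. -/
def mv (m : Option Bool) (d : Bool) (l : List Bool) : Bool × List Bool := match m with
  | none => (d, l)
  | some false => shR d l
  | some true => shL d l

theorem pass_eq (i : Ins) (f d : Bool) (w : List Blk) :
    ∃ w', U.pass (start i f d) w =
      ((if aN i f then .inl true else if (inc true (tK w)).1 then .inl false else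
        .inr (start (shR i (tI w)).1 (fN i f d) (mv (mN i f) (dN i f d) (tD w)).1)), blk.encs w') ∧
      tI w' = (shR i (tI w)).2 ∧ tD w' = (mv (mN i f) (dN i f d) (tD w)).2 ∧
      tK w' = (inc true (tK w)).2 := by
  unfold start
  generalize aN i f = acc
  generalize fN i f d = f'
  generalize dN i f d = d'
  rcases hm : mN i f with _ | _ | _
  · obtain ⟨w', h1, h2, h3, h4⟩ := runs_stay ⟨i, d', f', true, none, acc, d', none⟩ rfl w
    refine ⟨w', ?_, h2, h3, h4⟩
    unfold Tr.pass
    rw [h1]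
    simp only [List.append_nil]
    rfl
  · obtain ⟨w', h1, h2, h3, h4⟩ := runs_right ⟨i, d', f', true, some false, acc, d', none⟩ rfl w
    refine ⟨w', ?_, h2, h3, h4⟩
    unfold Tr.pass
    rw [h1]
    simp only [List.append_nil]
    rfl
  · cases w with
    | nil => exact ⟨[], rfl, rfl, rfl, rfl⟩
    | cons b w =>
      obtain ⟨w', hi', hk', h1, h2, h3, h4⟩ :=
        runs_left ⟨b.1, b.2.1, f', b.2.2 && true, some true, acc, d', some (i, xor b.2.2 true)⟩ rfl w
          i (xor b.2.2 true) rfl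
      refine ⟨w' ++ [(hi', d', hk')], ?_, ?_, ?_, ?_⟩
      · have : U.runs ⟨i, d', f', true, some true, acc, d', none⟩ (b :: w) =
          U.runs ⟨b.1, b.2.1, f', b.2.2 && true, some true, acc, d', some (i, xor b.2.2 true)⟩ w := rfl
        have e : blk.encs (w' ++ [(hi', d', hk')]) = blk.encs w' ++ blk.enc (hi', d', hk') :=
          (Alph.encs_append blk _ _).trans (congrArg _ (List.append_nil _))
        unfold Tr.pass
        rw [this, h1, e]
        rfl
      · simpa [tI, shR] using h2
      · simp only [tD, List.map_append] at h3 ⊢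
        rw [h3]; rfl
      · simpa [tK, inc] using h4

/-! ### Clock -/

def val : List Bool → ℕ
  | [] => 0
  | b :: l => b.toNat + 2 * val l

theorem val_lt (l : List Bool) : val l < 2 ^ l.length := by
  induction l with
  | nil => simp [val]
  | cons b l ih => cases b <;> simp [val, pow_succ] <;> omega

theorem inc_length (c : Bool) (l : List Bool) : (inc c l).2.length = l.length := by
  induction l generalizing c with
  | nil => rfl
  | cons k l ih => simp [inc, ih]

theorem inc_val (c : Bool) (l : List Bool) :
    val (inc c l).2 + 2 ^ l.length * (inc c l).1.toNat = val l + c.toNat := by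
  induction l generalizing c with
  | nil => simp [inc, val]
  | cons k l ih =>
    have := ih (k && c)
    simp only [inc, val, List.length_cons, pow_succ]
    cases k <;> cases c <;> simp at this ⊢ <;> nlinarith

/-! ### Rings -/

def On {α : Type} {n : ℕ} (g : ZMod n → α) (h : ZMod n) (a : α) (l : List α) : Prop :=
  l.length + 1 = n ∧ ∀ k < n, (a :: l)[k]? = some (g (h + k))

theorem shR_eq {α : Type} (a : α) (l : List α) : a :: l = (shR a l).2 ++ [(shR a l).1] := by
  induction l generalizing a with
  | nil => rfl
  | cons b l ih => simp only [shR, List.cons_append]; rw [← ih]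

theorem shR_length {α : Type} (a : α) (l : List α) : (shR a l).2.length = l.length := by
  have := congrArg List.length (shR_eq a l)
  simpa using this.symm

theorem shL_eq {α : Type} (a : α) (l : List α) : (shL a l).1 :: (shL a l).2 = l ++ [a] := by
  cases l <;> rfl

theorem On.shR {α : Type} {n : ℕ} {g : ZMod n → α} {h : ZMod n} {a : α} {l : List α}
    (H : On g h a l) : On g (h - 1) (shR a l).1 (shR a l).2 := by
  obtain ⟨h1, h2⟩ := H
  refine ⟨by rw [shR_length]; exact h1, fun k hk => ?_⟩
  cases k with
  | zero =>
    have := h2 l.length (by omega)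
    rw [shR_eq, List.getElem?_append_right (by rw [shR_length]), shR_length] at this
    simp only [Nat.sub_self, List.getElem?_cons_zero] at this ⊢
    rw [this]
    congr 2
    have h3 : ((l.length + 1 : ℕ) : ZMod n) = 0 := by rw [h1]; exact ZMod.natCast_self n
    push_cast at h3 ⊢
    linear_combination h3
  | succ k =>
    have := h2 k (by omega)
    rw [shR_eq, List.getElem?_append_left (by rw [shR_length]; omega)] at this
    simp only [List.getElem?_cons_succ]
    rw [this]
    congr 2
    push_cast
    ring

theorem On.shL {α : Type} {n : ℕ} {g : ZMod n → α} {h : ZMod n} {a : α} {l : List α}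
    (H : On g h a l) : On g (h + 1) (shL a l).1 (shL a l).2 := by
  obtain ⟨h1, h2⟩ := H
  have hl := congrArg List.length (shL_eq a l)
  simp at hl
  refine ⟨by rw [hl]; exact h1, fun k hk => ?_⟩
  rw [shL_eq]
  rcases Nat.lt_or_ge k l.length with h3 | h3
  · have := h2 (k + 1) (by omega)
    rw [List.getElem?_append_left h3]
    simp only [List.getElem?_cons_succ] at this
    rw [this]
    congr 2
    push_cast
    ring
  · obtain rfl : k = l.length := by omega
    have := h2 0 (by omega)
    simp only [List.getElem?_cons_zero] at this
    simp only [List.getElem?_concat_length]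
    rw [this]
    congr 2
    have h3 : ((l.length + 1 : ℕ) : ZMod n) = 0 := by rw [h1]; exact ZMod.natCast_self n
    push_cast at h3 ⊢
    linear_combination -h3

theorem On.head {α : Type} {n : ℕ} {g : ZMod n → α} {h : ZMod n} {a : α} {l : List α}
    (H : On g h a l) : a = g h := by
  have := H.2 0 (by have := H.1; omega)
  simpa using this

theorem On.set {α : Type} {n : ℕ} {g : ZMod n → α} {h : ZMod n} {a : α} {l : List α}
    (H : On g h a l) (b : α) : On (Function.update g h b) h b l := by
  refine ⟨H.1, fun k hk => ?_⟩
  cases k with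
  | zero => simp
  | succ k =>
    have := H.2 (k + 1) hk
    simp only [List.getElem?_cons_succ] at this ⊢
    rw [this, Function.update_of_ne]
    intro h3
    have h4 : ((k + 1 : ℕ) : ZMod n) = 0 := by linear_combination h3
    rw [ZMod.natCast_eq_zero_iff] at h4
    exact absurd (Nat.le_of_dvd (Nat.succ_pos k) h4) (by omega)

/-- Abstract states. -/
structure St (n : ℕ) where
  g : ZMod n → Bool
  h : ZMod n
  f : Bool

def hm {n : ℕ} (m : Option Bool) (h : ZMod n) : ZMod n := match m with
  | none => h
  | some false => h - 1
  | some true => h + 1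

def exec {n : ℕ} (i : Ins) (s : St n) : St n :=
  ⟨Function.update s.g s.h (dN i s.f (s.g s.h)), hm (mN i s.f) s.h, fN i s.f (s.g s.h)⟩

/-- Acceptance after exactly `t` steps. -/
def accAt {n : ℕ} (gI : ZMod n → Ins) : ZMod n → St n → ℕ → Prop
  | h, s, 0 => aN (gI h) s.f = true
  | h, s, t + 1 => accAt gI (h - 1) (exec (gI h) s) t

theorem ends {n : ℕ} (gI : ZMod n → Ins) (L : ℕ) (K : ℕ) (h : ZMod n) (s : St n) (w : List Blk)
    (i : Ins) (d : Bool) (hI : On gI h i (tI w)) (hD : On s.g s.h d (tD w))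
    (hK : 2 ^ w.length - val (tK w) = K) (hL : 12 * w.length ≤ L) :
    ∃ m y b, U.Ends m L (start i s.f d) (blk.encs w) b y ∧
      (b = true ↔ ∃ t < K, accAt gI h s t) := by
  induction K generalizing h s w i d with
  | zero =>
    have := val_lt (tK w)
    simp at this
    omega
  | succ K ih =>
    obtain ⟨w', h1, h2, h3, h4⟩ := pass_eq i s.f d w
    have hi := hI.head
    have hd := hD.head
    have hlen : w'.length = w.length := by
      have := congrArg List.length h4
      rw [inc_length] at this
      simpa using this
    have hL' : blk.k * w.length + (blk.encs w').length ≤ L := by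
      rw [Alph.encs_length, hlen]
      show 6 * _ + 6 * _ ≤ L
      omega
    by_cases ha : aN i s.f = true
    · rw [if_pos ha] at h1
      refine ⟨_, _, true, Tr.Ends.done h1 hL', ?_⟩
      simp only [true_iff]
      exact ⟨0, Nat.succ_pos K, by rw [hi] at ha; exact ha⟩
    · rw [if_neg ha] at h1
      have hv := inc_val true (tK w)
      rw [← h4] at hv
      by_cases hc : (inc true (tK w)).1 = true
      · rw [if_pos hc] at h1
        refine ⟨_, _, false, Tr.Ends.done h1 hL', ?_⟩
        rw [hc] at hv
        simp at hv
        have h5 := val_lt (tK w)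
        simp only [List.length_map] at h5
        obtain rfl : K = 0 := by omega
        constructor
        · intro h; simp at h
        · rintro ⟨t, ht, h6⟩
          obtain rfl : t = 0 := by omega
          rw [hi] at ha
          exact absurd h6 ha
      · rw [if_neg hc] at h1
        simp only [Bool.not_eq_true] at hc
        rw [hc] at hv
        simp at hv
        have hD' : On (exec (gI h) s).g (exec (gI h) s).h
            (mv (mN i s.f) (dN i s.f d) (tD w)).1 (mv (mN i s.f) (dN i s.f d) (tD w)).2 := by
          have h6 := hD.set (dN i s.f d)
          rw [hi, hd] at h6 ⊢
          unfold exec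
          dsimp only
          rcases mN (gI h) s.f with _ | _ | _
          · exact h6
          · exact h6.shR
          · exact h6.shL
        have hI' := hI.shR
        rw [← h2] at hI'
        rw [← h3] at hD'
        obtain ⟨m, y, b, h7, h8⟩ := ih (h - 1) (exec (gI h) s) w' _ _ hI' hD'
          (by rw [hlen, hv]; omega) (by omega)
        have hf : (exec (gI h) s).f = fN i s.f d := by rw [hi, hd]; rfl
        rw [hf] at h7
        refine ⟨_, y, b, Tr.Ends.next h1 hL' h7, h8.trans ?_⟩
        constructor
        · rintro ⟨t, ht, h9⟩
          exact ⟨t + 1, by omega, h9⟩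
        · rintro ⟨t, ht, h9⟩
          cases t with
          | zero => rw [hi] at ha; exact absurd h9 ha
          | succ t => exact ⟨t, by omega, h9⟩

end Ring


/-! ## Programs for the ring machine -/

namespace Ring

def execs {n : ℕ} : List Ins → St n → St n
  | [], s => s
  | i :: l, s => execs l (exec i s)

def accs {n : ℕ} : List Ins → St n → Prop
  | [], _ => False
  | i :: l, s => aN i s.f = true ∨ accs l (exec i s)

theorem execs_append {n : ℕ} (l m : List Ins) (s : St n) :
    execs (l ++ m) s = execs m (execs l s) := by
  induction l generalizing s with
  | nil => rfl
  | cons i l ih => exact ih _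

theorem accs_append {n : ℕ} (l m : List Ins) (s : St n) :
    accs (l ++ m) s ↔ accs l s ∨ accs m (execs l s) := by
  induction l generalizing s with
  | nil => simp [accs, execs]
  | cons i l ih => simp only [List.cons_append, accs, execs, ih, or_assoc]

theorem acc_list {n : ℕ} (gI : ZMod n → Ins) (h : ZMod n) (l : List Ins) (s : St n)
    (H : ∀ k (hk : k < l.length), gI (h - k) = l[k]) :
    ((∃ t < l.length, accAt gI h s t) ↔ accs l s) ∧
    ∀ t, accAt gI h s (l.length + t) ↔ accAt gI (h - l.length) (execs l s) t := by
  induction l generalizing h s with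
  | nil => simp [accs, execs]
  | cons i l ih =>
    have hi : gI h = i := by
      have := H 0 (by simp)
      rw [Nat.cast_zero, sub_zero] at this
      exact this
    obtain ⟨h1, h2⟩ := ih (h - 1) (exec i s) (by
      intro k hk
      have := H (k + 1) (by simpa using hk)
      simp only [List.getElem_cons_succ] at this
      rw [← this]
      congr 1
      push_cast
      ring)
    constructor
    · rw [accs, ← h1]
      constructor
      · rintro ⟨t, ht, h3⟩
        cases t with
        | zero => left; rw [← hi]; exact h3
        | succ t =>
          right
          rw [accAt, hi] at h3
          exact ⟨t, by simpa using ht, h3⟩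
      · rintro (h3 | ⟨t, ht, h3⟩)
        · exact ⟨0, by simp, by rw [accAt, hi]; exact h3⟩
        · exact ⟨t + 1, by simpa using ht, by rw [accAt, hi]; exact h3⟩
    · intro t
      have : (i :: l).length + t = (l.length + t) + 1 := by simp; omega
      rw [this, accAt, hi, h2, execs]
      have e : h - 1 - (l.length : ZMod n) = h - ((i :: l).length : ZMod n) := by
        simp only [List.length_cons]; push_cast; ring
      rw [e]

theorem acc_rounds {n : ℕ} (gI : ZMod n → Ins) (h : ZMod n) (l : List Ins) (hl : l.length = n)
    (H : ∀ k (hk : k < l.length), gI (h - k) = l[k]) (r : ℕ) (s : St n) :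
    (∃ t < r * n, accAt gI h s t) ↔ ∃ r' < r, accs l ((execs l)^[r'] s) := by
  induction r generalizing s with
  | zero => simp
  | succ r ih =>
    obtain ⟨h1, h2⟩ := acc_list gI h l s H
    have e : h - (l.length : ZMod n) = h := by rw [hl]; simp
    rw [e] at h2
    rw [hl] at h1 h2
    constructor
    · rintro ⟨t, ht, h3⟩
      rcases Nat.lt_or_ge t n with h4 | h4
      · exact ⟨0, Nat.succ_pos r, h1.1 ⟨t, h4, h3⟩⟩
      · obtain ⟨t, rfl⟩ := Nat.exists_eq_add_of_le h4
        rw [h2] at h3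
        obtain ⟨r', h5, h6⟩ := (ih (execs l s)).1 ⟨t, by rw [Nat.succ_mul] at ht; omega, h3⟩
        exact ⟨r' + 1, by omega, h6⟩
    · rintro ⟨r', hr, h3⟩
      cases r' with
      | zero =>
        obtain ⟨t, h4, h5⟩ := h1.2 h3
        exact ⟨t, by rw [Nat.succ_mul]; omega, h5⟩
      | succ r' =>
        obtain ⟨t, h5, h6⟩ := (ih (execs l s)).2 ⟨r', by omega, h3⟩
        exact ⟨n + t, by rw [Nat.succ_mul]; omega, (h2 t).2 h6⟩

/-- Instruction lists that never accept. -/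
def NA (l : List Ins) : Prop := ∀ i ∈ l, ∀ f, aN i f = false

theorem NA.not {n : ℕ} {l : List Ins} (h : NA l) (s : St n) : ¬ accs l s := by
  induction l generalizing s with
  | nil => exact id
  | cons i l ih =>
    rintro (h1 | h1)
    · rw [h i (by simp)] at h1; simp at h1
    · exact ih (fun j hj => h j (by simp [hj])) _ h1

theorem NA.append {l m : List Ins} (h : NA l) (h' : NA m) : NA (l ++ m) := by
  intro i hi
  rcases List.mem_append.1 hi with h1 | h1
  · exact h i h1
  · exact h' i h1

theorem NA.rep {k : ℕ} {i : Ins} (h : ∀ f, aN i f = false) : NA (List.replicate k i) := by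
  intro j hj
  rw [List.eq_of_mem_replicate hj]
  exact h

/-- Conditional flip. -/
def fl {n : ℕ} (f : Bool) (p : ZMod n) (g : ZMod n → Bool) (z : ZMod n) : Bool :=
  xor (g z) (f && decide (z = p))

variable {n : ℕ}

theorem exec_E (g : ZMod n → Bool) (h : ZMod n) (f : Bool) : exec iE ⟨g, h, f⟩ = ⟨g, h, true⟩ := by
  simp [exec, dN, fN, mN, hm]

theorem exec_T (g : ZMod n → Bool) (h : ZMod n) (f : Bool) :
    exec iT ⟨g, h, f⟩ = ⟨g, h, f && g h⟩ := by
  simp [exec, dN, fN, mN, hm]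

theorem exec_T0 (g : ZMod n → Bool) (h : ZMod n) (f : Bool) :
    exec iT0 ⟨g, h, f⟩ = ⟨g, h, f && !g h⟩ := by
  simp [exec, dN, fN, mN, hm]

theorem exec_X (g : ZMod n → Bool) (h : ZMod n) (f : Bool) :
    exec iX ⟨g, h, f⟩ = ⟨fl f h g, h, f⟩ := by
  have : Function.update g h (if f = true then !g h else g h) = fl f h g := by
    funext z
    by_cases hz : z = h
    · subst hz; cases f <;> simp [fl]
    · simp [fl, hz]
  simp [exec, dN, fN, mN, hm, this]

theorem exec_H (s : St n) : exec iH s = s := by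
  simp [exec, dN, fN, mN, hm]

theorem exec_R (g : ZMod n → Bool) (h : ZMod n) (f : Bool) :
    exec iR ⟨g, h, f⟩ = ⟨g, h + 1, f⟩ := by
  simp [exec, dN, fN, mN, hm]

theorem exec_L (g : ZMod n → Bool) (h : ZMod n) (f : Bool) :
    exec iL ⟨g, h, f⟩ = ⟨g, h - 1, f⟩ := by
  simp [exec, dN, fN, mN, hm]

theorem exec_Rc (g : ZMod n → Bool) (h : ZMod n) (f : Bool) :
    exec iRc ⟨g, h, f⟩ = ⟨g, if f then h + 1 else h, f⟩ := by
  cases f <;> simp [exec, dN, fN, mN, hm]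

theorem exec_Lc (g : ZMod n → Bool) (h : ZMod n) (f : Bool) :
    exec iLc ⟨g, h, f⟩ = ⟨g, if f then h - 1 else h, f⟩ := by
  cases f <;> simp [exec, dN, fN, mN, hm]

theorem execs_R (k : ℕ) (g : ZMod n → Bool) (h : ZMod n) (f : Bool) :
    execs (List.replicate k iR) ⟨g, h, f⟩ = ⟨g, h + k, f⟩ := by
  induction k generalizing h with
  | zero => simp [execs]
  | succ k ih =>
    rw [List.replicate_succ, execs, exec_R, ih]
    congr 1; push_cast; ring

theorem execs_L (k : ℕ) (g : ZMod n → Bool) (h : ZMod n) (f : Bool) :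
    execs (List.replicate k iL) ⟨g, h, f⟩ = ⟨g, h - k, f⟩ := by
  induction k generalizing h with
  | zero => simp [execs]
  | succ k ih =>
    rw [List.replicate_succ, execs, exec_L, ih]
    congr 1; push_cast; ring

theorem execs_Rc (k : ℕ) (g : ZMod n → Bool) (h : ZMod n) (f : Bool) :
    execs (List.replicate k iRc) ⟨g, h, f⟩ = ⟨g, if f then h + k else h, f⟩ := by
  induction k generalizing h with
  | zero => simp [execs]
  | succ k ih =>
    rw [List.replicate_succ, execs, exec_Rc, ih]
    cases f <;> simp
    ring

theorem execs_Lc (k : ℕ) (g : ZMod n → Bool) (h : ZMod n) (f : Bool) :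
    execs (List.replicate k iLc) ⟨g, h, f⟩ = ⟨g, if f then h - k else h, f⟩ := by
  induction k generalizing h with
  | zero => simp [execs]
  | succ k ih =>
    rw [List.replicate_succ, execs, exec_Lc, ih]
    cases f <;> simp
    ring

def atO (k : ℕ) (i : Ins) : List Ins := List.replicate k iR ++ i :: List.replicate k iL

theorem atO_NA {k : ℕ} {i : Ins} (h : ∀ f, aN i f = false) : NA (atO k i) := by
  refine NA.append (NA.rep fun _ => rfl) ?_
  intro j hj
  rcases List.mem_cons.1 hj with rfl | hj
  · exact h
  · rw [List.eq_of_mem_replicate hj]; exact fun _ => rfl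

def iTb (b : Bool) : Ins := if b then iT else iT0

theorem atO_T (k : ℕ) (b : Bool) (g : ZMod n → Bool) (h : ZMod n) (f : Bool) :
    execs (atO k (iTb b)) ⟨g, h, f⟩ = ⟨g, h, f && (g (h + k) == b)⟩ := by
  rw [atO, execs_append, execs_R, execs]
  cases b
  · rw [iTb, if_neg (by simp), exec_T0, execs_L]; simp
  · rw [iTb, if_pos rfl, exec_T, execs_L]; simp

theorem atO_X (k : ℕ) (g : ZMod n → Bool) (h : ZMod n) (f : Bool) :
    execs (atO k iX) ⟨g, h, f⟩ = ⟨fl f (h + k) g, h, f⟩ := by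
  rw [atO, execs_append, execs_R, execs, exec_X, execs_L]; simp

theorem fl_false (p : ZMod n) (g : ZMod n → Bool) : fl false p g = g := by
  funext z; simp [fl]

/-! ### Simulating a Turing machine -/

section sim
variable (M : TM)

abbrev B : ℕ := M.nstates + 3

/-- Offset of the bit of a symbol. -/
def so : Option Bool → Option ℕ
  | none => none
  | some false => some (M.nstates + 1)
  | some true => some (M.nstates + 2)

theorem so_lt {a : Option Bool} {o : ℕ} (h : so M a = some o) : M.nstates < o ∧ o < B M := by
  unfold B
  rcases a with _ | _ | _ <;> simp [so] at h <;> omega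

theorem so_inj {a b : Option Bool} (h : so M a = so M b) : a = b := by
  rcases a with _ | _ | _ <;> rcases b with _ | _ | _ <;> simp [so] at h ⊢

variable {M}

/-- Content of the bits of the cells. -/
def cellbit (c : TMCfg M) (j : ℤ) (b : ℕ) : Bool :=
  xor (decide (j = c.pos ∧ b = 1 + c.q.1)) (decide (so M (c.tape j) = some b))

/-- The ring state represents the configuration within the window. -/
def Rel (lo : ℤ) (S : ℕ) (c : TMCfg M) (s : St n) : Prop :=
  s.h = ((B M * c.pos : ℤ) : ZMod n) ∧ ∀ j : ℤ, lo ≤ j → j < lo + S → ∀ b < B M,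
    s.g ((B M * j + b : ℤ) : ZMod n) = cellbit c j b

theorem ring_inj {lo : ℤ} {S m : ℕ} (hS : m * S ≤ n) {j j' : ℤ} {b b' : ℕ}
    (h1 : lo ≤ j) (h2 : j < lo + S) (h1' : lo ≤ j') (h2' : j' < lo + S) (hb : b < m) (hb' : b' < m) :
    ((m * j + b : ℤ) : ZMod n) = ((m * j' + b' : ℤ) : ZMod n) ↔ j = j' ∧ b = b' := by
  constructor
  · intro h
    rw [ZMod.intCast_eq_intCast_iff_dvd_sub] at h
    have hS' : (m : ℤ) * S ≤ n := by exact_mod_cast hS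
    have h3 : (m * j' + b' : ℤ) - (m * j + b) = 0 := by
      apply Int.eq_zero_of_abs_lt_dvd h
      rw [abs_lt]
      constructor <;> nlinarith
    have h4 : (m : ℤ) * (j' - j) = b - b' := by linarith
    have h5 : j' - j = 0 := by
      rcases lt_trichotomy (j' - j) 0 with h5 | h5 | h5
      · nlinarith
      · exact h5
      · nlinarith
    rw [h5] at h4
    exact ⟨by omega, by omega⟩
  · rintro ⟨rfl, rfl⟩; rfl

theorem Rel.key {lo : ℤ} {S : ℕ} (hS : B M * S ≤ n) {p j : ℤ} (hp1 : lo ≤ p) (hp2 : p < lo + S)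
    (h1 : lo ≤ j) (h2 : j < lo + S) {b o : ℕ} (hb : b < B M) (ho : o < B M) :
    ((B M * j + b : ℤ) : ZMod n) = ((B M * p : ℤ) : ZMod n) + (o : ZMod n) ↔ j = p ∧ b = o := by
  rw [← ring_inj hS h1 h2 hp1 hp2 hb ho]
  push_cast
  rfl

/-- Flip the bit of a symbol. -/
def wr (M : TM) (a : Option Bool) : List Ins := match so M a with
  | none => []
  | some o => atO o iX

theorem wr_NA (a : Option Bool) : NA (wr M a) := by
  unfold wr
  rcases so M a with _ | o
  · intro i hi; simp at hi
  · exact atO_NA fun _ => rfl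

def flo (M : TM) (f : Bool) (h : ZMod n) (a : Option Bool) (g : ZMod n → Bool) : ZMod n → Bool :=
  match so M a with
  | none => g
  | some o => fl f (h + o) g

theorem wr_eq (a : Option Bool) (g : ZMod n → Bool) (h : ZMod n) (f : Bool) :
    execs (wr M a) ⟨g, h, f⟩ = ⟨flo M f h a g, h, f⟩ := by
  unfold wr flo
  rcases so M a with _ | o
  · rfl
  · exact atO_X _ _ _ _

theorem flo_false (a : Option Bool) (g : ZMod n → Bool) (h : ZMod n) : flo M false h a g = g := by
  unfold flo
  rcases so M a with _ | o
  · rfl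
  · exact fl_false _ _

theorem flo_eval {lo : ℤ} {S : ℕ} (hS : B M * S ≤ n) {p j : ℤ} (hp1 : lo ≤ p) (hp2 : p < lo + S)
    (h1 : lo ≤ j) (h2 : j < lo + S) {b : ℕ} (hb : b < B M) (a : Option Bool) (g : ZMod n → Bool) :
    flo M true ((B M * p : ℤ) : ZMod n) a g ((B M * j + b : ℤ) : ZMod n) =
      xor (g ((B M * j + b : ℤ) : ZMod n)) (decide (j = p ∧ so M a = some b)) := by
  unfold flo
  rcases h : so M a with _ | o
  · simp
  · have ho := (so_lt M h).2
    simp only [fl, Rel.key hS hp1 hp2 h1 h2 hb ho, Bool.true_and, Option.some.injEq, eq_comm (a := o)]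

theorem fl_eval {lo : ℤ} {S : ℕ} (hS : B M * S ≤ n) {p j : ℤ} (hp1 : lo ≤ p) (hp2 : p < lo + S)
    (h1 : lo ≤ j) (h2 : j < lo + S) {b o : ℕ} (hb : b < B M) (ho : o < B M) (g : ZMod n → Bool) :
    fl true (((B M * p : ℤ) : ZMod n) + (o : ZMod n)) g ((B M * j + b : ℤ) : ZMod n) =
      xor (g ((B M * j + b : ℤ) : ZMod n)) (decide (j = p ∧ b = o)) := by
  simp only [fl, Rel.key hS hp1 hp2 h1 h2 hb ho, Bool.true_and]

/-- Test for a state and a symbol. -/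
def tst (M : TM) (q : Fin M.nstates) (a : Option Bool) : List Ins :=
  iE :: (atO (1 + q.1) (iTb true) ++ (atO (M.nstates + 1) (iTb (decide (a = some false))) ++
    atO (M.nstates + 2) (iTb (decide (a = some true)))))

theorem iTb_NA (b : Bool) : ∀ f, aN (iTb b) f = false := by
  intro f; cases b <;> rfl

theorem tst_NA (q : Fin M.nstates) (a : Option Bool) : NA (tst M q a) := by
  intro i hi
  rcases List.mem_cons.1 hi with rfl | hi
  · exact fun _ => rfl
  · exact ((atO_NA (iTb_NA _)).append ((atO_NA (iTb_NA _)).append (atO_NA (iTb_NA _)))) i hi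

theorem Rel.at {lo : ℤ} {S : ℕ} {c : TMCfg M} {s : St n} (h : Rel lo S c s)
    (hp1 : lo ≤ c.pos) (hp2 : c.pos < lo + S) {b : ℕ} (hb : b < B M) :
    s.g (s.h + b) = cellbit c c.pos b := by
  rw [← h.2 _ hp1 hp2 b hb, h.1]
  push_cast
  rfl

theorem tst_eq {lo : ℤ} {S : ℕ} {c : TMCfg M} {s : St n} (h : Rel lo S c s)
    (hp1 : lo ≤ c.pos) (hp2 : c.pos < lo + S) (q : Fin M.nstates) (a : Option Bool) :
    execs (tst M q a) s = ⟨s.g, s.h, decide (c.q = q ∧ c.tape c.pos = a)⟩ := by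
  have h1 := h.at hp1 hp2 (b := 1 + q.1) (by have := q.2; unfold B; omega)
  have h2 := h.at hp1 hp2 (b := M.nstates + 1) (by unfold B; omega)
  have h3 := h.at hp1 hp2 (b := M.nstates + 2) (by unfold B; omega)
  obtain ⟨g, hh, f⟩ := s
  dsimp only at h1 h2 h3 ⊢
  rw [tst, execs, exec_E, execs_append, atO_T, execs_append, atO_T, atO_T]
  dsimp only
  rw [h1, h2, h3]
  congr 1
  have hq := q.2
  have hq' := c.q.2
  have e : (1 + q.1 = 1 + c.q.1) ↔ c.q = q := by
    constructor
    · intro h; apply Fin.ext; omega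
    · rintro rfl; rfl
  have e1 : ¬ M.nstates + 1 = 1 + c.q.1 := by omega
  have e2 : ¬ M.nstates + 2 = 1 + c.q.1 := by omega
  have e3 : ¬ M.nstates + 1 = 1 + q.1 := by omega
  have e4 : ¬ M.nstates + 2 = 1 + q.1 := by omega
  simp only [cellbit, e, e1, e2]
  by_cases hc : c.q = q
  · rcases c.tape c.pos with _ | _ | _ <;> rcases a with _ | _ | _ <;> simp [so, hc, e3, e4]
  · rcases c.tape c.pos with _ | _ | _ <;> simp [so, hc, e3, e4]

/-- The action of a rule. -/
def act (M : TM) (q : Fin M.nstates) (a : Option Bool) : List Ins := match M.trans q a with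
  | none => if q = M.qacc then [iH] else []
  | some (q', b, d) => atO (1 + q.1) iX ++ (wr M a ++ (wr M b ++
      (List.replicate (B M) (if d then iRc else iLc) ++ atO (1 + q'.1) iX)))

theorem act_NA {q : Fin M.nstates} {a : Option Bool} {r} (h : M.trans q a = some r) :
    NA (act M q a) := by
  obtain ⟨q', b, d⟩ := r
  unfold act
  rw [h]
  refine (atO_NA fun _ => rfl).append ((wr_NA _).append ((wr_NA _).append (NA.append ?_
    (atO_NA fun _ => rfl))))
  cases d
  · exact NA.rep fun _ => rfl
  · exact NA.rep fun _ => rfl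

theorem act_false (q : Fin M.nstates) (a : Option Bool) (g : ZMod n → Bool) (h : ZMod n) :
    execs (act M q a) ⟨g, h, false⟩ = ⟨g, h, false⟩ ∧ ¬ accs (act M q a) (⟨g, h, false⟩ : St n) := by
  rcases e : M.trans q a with _ | ⟨q', b, d⟩
  · unfold act
    rw [e]
    dsimp only
    split_ifs
    · simp only [execs, exec_H, accs]
      simp [aN]
    · exact ⟨rfl, id⟩
  · refine ⟨?_, (act_NA e).not _⟩
    unfold act
    rw [e]
    dsimp only
    rw [execs_append, atO_X, execs_append, wr_eq, execs_append, wr_eq, execs_append]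
    cases d
    · rw [if_neg (by simp), execs_Lc, atO_X]; simp [fl_false, flo_false]
    · rw [if_pos rfl, execs_Rc, atO_X]; simp [fl_false, flo_false]

theorem act_true {lo : ℤ} {S : ℕ} (hS : B M * S ≤ n) {c c' : TMCfg M} {s : St n} (h : Rel lo S c s)
    (hf : s.f = true) (hp1 : lo ≤ c.pos) (hp2 : c.pos < lo + S)
    (hc : M.stepCfg c = some c') (hp1' : lo ≤ c'.pos) (hp2' : c'.pos < lo + S) :
    Rel lo S c' (execs (act M c.q (c.tape c.pos)) s) := by
  obtain ⟨g, hh, f⟩ := s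
  obtain ⟨h1, h2⟩ := h
  dsimp only at h1 h2 hf
  subst hf h1
  unfold TM.stepCfg at hc
  rcases e : M.trans c.q (c.tape c.pos) with _ | ⟨q', b, d⟩
  · rw [e] at hc; simp at hc
  rw [e] at hc
  simp only [Option.some.injEq] at hc
  have hm : execs (List.replicate (B M) (if d then iRc else iLc))
      (⟨flo M true ((B M * c.pos : ℤ) : ZMod n) b (flo M true ((B M * c.pos : ℤ) : ZMod n) (c.tape c.pos)
        (fl true (((B M * c.pos : ℤ) : ZMod n) + ((1 + c.q.1 : ℕ) : ZMod n)) g)),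
        ((B M * c.pos : ℤ) : ZMod n), true⟩ : St n) =
      ⟨flo M true ((B M * c.pos : ℤ) : ZMod n) b (flo M true ((B M * c.pos : ℤ) : ZMod n) (c.tape c.pos)
        (fl true (((B M * c.pos : ℤ) : ZMod n) + ((1 + c.q.1 : ℕ) : ZMod n)) g)),
        ((B M * c'.pos : ℤ) : ZMod n), true⟩ := by
    rw [← hc]
    cases d
    · rw [if_neg (by simp), execs_Lc, if_pos rfl]
      congr 1
      simp only [Bool.false_eq_true, if_false]
      push_cast; ring
    · rw [if_pos rfl, execs_Rc, if_pos rfl]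
      congr 1
      simp only [if_true]
      push_cast; ring
  unfold act
  rw [e]
  dsimp only
  rw [execs_append, atO_X, execs_append, wr_eq, execs_append, wr_eq, execs_append, hm, atO_X]
  refine ⟨rfl, fun j hj1 hj2 o ho => ?_⟩
  have hq := q'.2
  have hq' := c.q.2
  dsimp only
  rw [fl_eval hS hp1' hp2' hj1 hj2 ho (by unfold B; omega),
    flo_eval hS hp1 hp2 hj1 hj2 ho, flo_eval hS hp1 hp2 hj1 hj2 ho,
    fl_eval hS hp1 hp2 hj1 hj2 ho (by unfold B; omega), h2 j hj1 hj2 o ho]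
  unfold cellbit
  have hc1 : c'.q = q' := by rw [← hc]
  have hc2 : c'.tape = Function.update c.tape c.pos b := by rw [← hc]
  rw [hc1, hc2]
  generalize (decide (j = c'.pos ∧ o = 1 + q'.1)) = X
  by_cases hj : j = c.pos
  · subst hj
    simp only [true_and, Function.update_self]
    generalize decide (o = 1 + c.q.1) = Y
    generalize decide (so M (c.tape c.pos) = some o) = Z
    generalize decide (so M b = some o) = W
    cases X <;> cases Y <;> cases Z <;> cases W <;> rfl
  · simp only [hj, false_and, Function.update_of_ne (h := hj), ne_eq, not_false_eq_true]
    simp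
    exact Bool.xor_comm _ _

def seg (M : TM) (r : Fin M.nstates × Option Bool) : List Ins := tst M r.1 r.2 ++ act M r.1 r.2

def prog (M : TM) (R : List (Fin M.nstates × Option Bool)) : List Ins := R.flatMap (seg M)

/-- All rules. -/
noncomputable def rules (M : TM) : List (Fin M.nstates × Option Bool) :=
  (Finset.univ : Finset (Fin M.nstates × Option Bool)).toList

theorem Rel.flag {lo : ℤ} {S : ℕ} {c : TMCfg M} {s : St n} (h : Rel lo S c s) (f : Bool) :
    Rel lo S c ⟨s.g, s.h, f⟩ := h

theorem prog_sim {lo : ℤ} {S : ℕ} (hS : B M * S ≤ n) {w : List Bool}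
    (hw : ∀ m c, M.run w m = some c → lo ≤ c.pos ∧ c.pos < lo + S)
    (R : List (Fin M.nstates × Option Bool)) (m : ℕ) (c : TMCfg M) (hr : M.run w m = some c)
    (s : St n) (h : Rel lo S c s) :
    ∃ m' c', m ≤ m' ∧ M.run w m' = some c' ∧ Rel lo S c' (execs (prog M R) s) ∧
      (accs (prog M R) s → ∃ m'' c'', M.run w m'' = some c'' ∧ M.stepCfg c'' = none ∧ c''.q = M.qacc) ∧
      ((c.q, c.tape c.pos) ∈ R → m < m' ∨
        (M.stepCfg c = none ∧ (c.q = M.qacc → accs (prog M R) s))) := by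
  induction R generalizing m c s with
  | nil => exact ⟨m, c, le_rfl, hr, h, fun h => h.elim, by simp⟩
  | cons r R ih =>
    obtain ⟨q, a⟩ := r
    have hp := hw m c hr
    have ht := tst_eq h hp.1 hp.2 q a
    have e1 : prog M ((q, a) :: R) = tst M q a ++ (act M q a ++ prog M R) := by
      simp [prog, seg, List.flatMap_cons]
    have e2 : execs (prog M ((q, a) :: R)) s = execs (prog M R) (execs (act M q a)
        ⟨s.g, s.h, decide (c.q = q ∧ c.tape c.pos = a)⟩) := by
      rw [e1, execs_append, execs_append, ht]
    have e3 : accs (prog M ((q, a) :: R)) s ↔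
        accs (act M q a) ⟨s.g, s.h, decide (c.q = q ∧ c.tape c.pos = a)⟩ ∨
        accs (prog M R) (execs (act M q a)
        ⟨s.g, s.h, decide (c.q = q ∧ c.tape c.pos = a)⟩) := by
      rw [e1, accs_append, accs_append, ht]
      simp only [(tst_NA q a).not s, false_or]
    rw [e2, e3]
    by_cases hc : c.q = q ∧ c.tape c.pos = a
    · rw [decide_eq_true hc]
      obtain ⟨rfl, rfl⟩ := hc
      rcases hst : M.stepCfg c with _ | c1
      · have htr : M.trans c.q (c.tape c.pos) = none := by
          unfold TM.stepCfg at hst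
          rcases e : M.trans c.q (c.tape c.pos) with _ | ⟨q', b, d⟩
          · rfl
          · rw [e] at hst; simp at hst
        have h4 : execs (act M c.q (c.tape c.pos)) (⟨s.g, s.h, true⟩ : St n) = ⟨s.g, s.h, true⟩ ∧
            (accs (act M c.q (c.tape c.pos)) (⟨s.g, s.h, true⟩ : St n) ↔ c.q = M.qacc) := by
          unfold act
          rw [htr]
          dsimp only
          split_ifs with h5
          · simp only [execs, exec_H, accs]
            simp [aN, h5]
          · exact ⟨rfl, by simp [accs, h5]⟩
        rw [h4.1, h4.2]
        obtain ⟨m', c', k1, k2, k3, k4, k5⟩ := ih m c hr _ (h.flag true)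
        refine ⟨m', c', k1, k2, k3, ?_, fun _ => Or.inr ⟨rfl, Or.inl⟩⟩
        rintro (k | k)
        · exact ⟨m, c, hr, hst, k⟩
        · exact k4 k
      · have hr1 : M.run w (m + 1) = some c1 := by
          rw [TM.run, hr]; exact hst
        have hp1 := hw _ _ hr1
        have hrel := act_true hS (h.flag true) rfl hp.1 hp.2 hst hp1.1 hp1.2
        obtain ⟨m', c', k1, k2, k3, k4, k5⟩ := ih (m + 1) c1 hr1 _ hrel
        refine ⟨m', c', by omega, k2, k3, ?_, fun _ => Or.inl (by omega)⟩
        rintro (k | k)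
        · exfalso
          rcases e : M.trans c.q (c.tape c.pos) with _ | r
          · unfold TM.stepCfg at hst; rw [e] at hst; simp at hst
          · exact (act_NA e).not _ k
        · exact k4 k
    · rw [decide_eq_false hc, (act_false q a s.g s.h).1]
      obtain ⟨m', c', k1, k2, k3, k4, k5⟩ := ih m c hr _ (h.flag false)
      refine ⟨m', c', k1, k2, k3, ?_, ?_⟩
      · rintro (k | k)
        · exact absurd k (act_false q a s.g s.h).2
        · exact k4 k
      · intro hmem
        rcases List.mem_cons.1 hmem with h6 | h6
        · simp only [Prod.mk.injEq] at h6; exact absurd h6 hc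
        · rcases k5 h6 with h7 | h7
          · exact Or.inl h7
          · exact Or.inr ⟨h7.1, fun h8 => Or.inr (h7.2 h8)⟩

theorem run_det {w : List Bool} {m : ℕ} {c : TMCfg M} (hr : M.run w m = some c)
    (hs : M.stepCfg c = none) (k : ℕ) : M.run w (m + 1 + k) = none := by
  induction k with
  | zero => show M.run w (m + 1) = none; rw [TM.run, hr]; exact hs
  | succ k ih => show M.run w (m + 1 + k + 1) = none; rw [TM.run, ih]; rfl

theorem run_le {w : List Bool} {m : ℕ} {c : TMCfg M} (hr : M.run w m = some c)
    (hs : M.stepCfg c = none) {m' : ℕ} {c' : TMCfg M} (hr' : M.run w m' = some c') : m' ≤ m := by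
  by_contra h
  have := run_det hr hs (m' - (m + 1))
  rw [show m + 1 + (m' - (m + 1)) = m' by omega, hr'] at this
  simp at this

theorem run_uniq {w : List Bool} {m : ℕ} {c : TMCfg M} (hr : M.run w m = some c)
    (hs : M.stepCfg c = none) {m' : ℕ} {c' : TMCfg M} (hr' : M.run w m' = some c')
    (hs' : M.stepCfg c' = none) : c' = c := by
  have : m' = m := le_antisymm (run_le hr hs hr') (run_le hr' hs' hr)
  subst this
  rw [hr] at hr'
  exact (Option.some.inj hr').symm

/-- A full round. -/
noncomputable def rnd (M : TM) (pad : ℕ) : List Ins := iE :: (prog M (rules M) ++ List.replicate pad iE)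

theorem execs_E (k : ℕ) (s : St n) :
    (execs (List.replicate k iE) s).g = s.g ∧ (execs (List.replicate k iE) s).h = s.h := by
  induction k generalizing s with
  | zero => exact ⟨rfl, rfl⟩
  | succ k ih =>
    obtain ⟨g, h, f⟩ := s
    rw [List.replicate_succ, execs, exec_E]
    exact ih _

theorem rnd_sim {lo : ℤ} {S : ℕ} (hS : B M * S ≤ n) {w : List Bool}
    (hw : ∀ m c, M.run w m = some c → lo ≤ c.pos ∧ c.pos < lo + S)
    (pad m : ℕ) (c : TMCfg M) (hr : M.run w m = some c)
    (s : St n) (h : Rel lo S c s) :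
    ∃ m' c', m ≤ m' ∧ M.run w m' = some c' ∧ Rel lo S c' (execs (rnd M pad) s) ∧
      (accs (rnd M pad) s → ∃ m'' c'', M.run w m'' = some c'' ∧ M.stepCfg c'' = none ∧ c''.q = M.qacc) ∧
      (m < m' ∨ (M.stepCfg c = none ∧ (c.q = M.qacc → accs (rnd M pad) s))) := by
  obtain ⟨g, hh, f⟩ := s
  have h0 : exec iE (⟨g, hh, f⟩ : St n) = ⟨g, hh, true⟩ := exec_E _ _ _
  obtain ⟨m', c', k1, k2, k3, k4, k5⟩ := prog_sim hS hw (rules M) m c hr _ (h.flag true)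
  have e1 : accs (rnd M pad) (⟨g, hh, f⟩ : St n) ↔ accs (prog M (rules M)) (⟨g, hh, true⟩ : St n) := by
    rw [rnd, accs, h0, accs_append]
    simp only [(NA.rep (k := pad) (i := iE) fun _ => rfl).not, or_false]
    simp [aN]
  rw [e1]
  refine ⟨m', c', k1, k2, ?_, k4, k5 (by simp [rules])⟩
  rw [rnd, execs, h0, execs_append]
  have e2 := execs_E pad (execs (prog M (rules M)) (⟨g, hh, true⟩ : St n))
  unfold Rel
  rw [e2.1, e2.2]
  exact k3

theorem rnds_sim {lo : ℤ} {S : ℕ} (hS : B M * S ≤ n) {w : List Bool}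
    (hw : ∀ m c, M.run w m = some c → lo ≤ c.pos ∧ c.pos < lo + S)
    (pad : ℕ) {n0 : ℕ} {c0 : TMCfg M} (hr0 : M.run w n0 = some c0) (hs0 : M.stepCfg c0 = none)
    (r m : ℕ) (c : TMCfg M) (hr : M.run w m = some c)
    (s : St n) (h : Rel lo S c s) (hT : n0 < m + r) :
    (∃ r' < r, accs (rnd M pad) ((execs (rnd M pad))^[r'] s)) ↔ c0.q = M.qacc := by
  induction r generalizing m c s with
  | zero => exact absurd (run_le hr0 hs0 hr) (by omega)
  | succ r ih =>
    obtain ⟨m', c', k1, k2, k3, k4, k5⟩ := rnd_sim hS hw pad m c hr s h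
    have hsplit : (∃ r' < r + 1, accs (rnd M pad) ((execs (rnd M pad))^[r'] s)) ↔
        accs (rnd M pad) s ∨ ∃ r' < r, accs (rnd M pad) ((execs (rnd M pad))^[r'] (execs (rnd M pad) s)) := by
      constructor
      · rintro ⟨r', h1, h2⟩
        cases r' with
        | zero => exact Or.inl h2
        | succ r' => exact Or.inr ⟨r', by omega, h2⟩
      · rintro (h2 | ⟨r', h1, h2⟩)
        · exact ⟨0, by omega, h2⟩
        · exact ⟨r' + 1, by omega, h2⟩
    have hacc : accs (rnd M pad) s → c0.q = M.qacc := by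
      intro h1
      obtain ⟨m'', c'', h2, h3, h4⟩ := k4 h1
      rw [← run_uniq hr0 hs0 h2 h3]; exact h4
    rw [hsplit]
    rcases k5 with h5 | ⟨h5, h6⟩
    · rw [ih m' c' k2 _ k3 (by omega)]
      exact ⟨fun h => h.elim hacc id, Or.inr⟩
    · have : c = c0 := run_uniq hr0 hs0 hr h5
      subst this
      constructor
      · rintro (h7 | ⟨r', h1, h2⟩)
        · exact hacc h7
        · by_cases hr1 : n0 < m' + r
          · exact (ih m' c' k2 _ k3 hr1).1 ⟨r', h1, h2⟩
          · have := run_le hr h5 hr0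
            omega
      · exact fun h7 => Or.inl (h6 h7)

end sim
end Ring


/-! ## Time bound of space bounded machines -/

namespace Ring

section time
variable {M : TM} {w : List Bool}

theorem run_some {m : ℕ} {c : TMCfg M} (h : M.run w m = some c) {i : ℕ} (hi : i ≤ m) :
    ∃ d, M.run w i = some d := by
  induction m generalizing c with
  | zero => obtain rfl : i = 0 := by omega
            exact ⟨c, h⟩
  | succ m ih =>
    rcases Nat.lt_or_ge i (m + 1) with h1 | h1
    · rw [TM.run, Option.bind_eq_some_iff] at h
      obtain ⟨d, hd, -⟩ := h
      exact ih hd (by omega)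
    · obtain rfl : i = m + 1 := by omega
      exact ⟨c, h⟩

theorem run_shift {i j : ℕ} (h : M.run w i = M.run w j) (k : ℕ) : M.run w (i + k) = M.run w (j + k) := by
  induction k with
  | zero => exact h
  | succ k ih => show M.run w (i + k + 1) = M.run w (j + k + 1); rw [TM.run, TM.run, ih]

theorem tape_out {lo : ℤ} {S : ℕ} (hw : ∀ m c, M.run w m = some c → lo ≤ c.pos ∧ c.pos < lo + S)
    (m : ℕ) (c : TMCfg M) (h : M.run w m = some c) (j : ℤ) (hj : ¬ (lo ≤ j ∧ j < lo + S)) :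
    c.tape j = (M.initCfg w).tape j := by
  induction m generalizing c with
  | zero => rw [TM.run, Option.some.injEq] at h; rw [h]
  | succ m ih =>
    rw [TM.run, Option.bind_eq_some_iff] at h
    obtain ⟨d, hd, h1⟩ := h
    rw [← ih d hd]
    have hp := hw m d hd
    unfold TM.stepCfg at h1
    rcases e : M.trans d.q (d.tape d.pos) with _ | ⟨q', b, r⟩
    · rw [e] at h1; simp at h1
    · rw [e] at h1
      simp only [Option.some.injEq] at h1
      rw [← h1]
      dsimp only
      rw [Function.update_of_ne]
      rintro rfl
      exact hj hp

theorem time_bound {lo : ℤ} {S : ℕ} (hw : ∀ m c, M.run w m = some c → lo ≤ c.pos ∧ c.pos < lo + S)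
    {n0 : ℕ} {c0 : TMCfg M} (hr : M.run w n0 = some c0) (hs : M.stepCfg c0 = none) :
    n0 + 1 ≤ M.nstates * (S * 3 ^ S) := by
  have H : ∀ i : Fin (n0 + 1), ∃ d, M.run w i.1 = some d := fun i => run_some hr (by omega)
  choose d hd using H
  have hin := fun i => hw _ _ (hd i)
  let F : Fin (n0 + 1) → Fin M.nstates × Fin S × (Fin S → Option Bool) := fun i =>
    ((d i).q, ⟨((d i).pos - lo).toNat, by have := hin i; omega⟩, fun k => (d i).tape (lo + k.1))
  have hF : Function.Injective F := by
    intro i j hij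
    simp only [F, Prod.mk.injEq, Fin.mk.injEq] at hij
    obtain ⟨h1, h2, h3⟩ := hij
    have hi := hin i
    have hj := hin j
    have hdd : d i = d j := by
      have ht : (d i).tape = (d j).tape := by
        funext z
        by_cases hz : lo ≤ z ∧ z < lo + S
        · have := congrFun h3 ⟨(z - lo).toNat, by omega⟩
          simp only at this
          rwa [show lo + ((z - lo).toNat : ℤ) = z by omega] at this
        · rw [tape_out hw _ _ (hd i) z hz, tape_out hw _ _ (hd j) z hz]
      have hp : (d i).pos = (d j).pos := by omega
      revert h1 ht hp
      rcases d i with ⟨q, t, p⟩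
      rcases d j with ⟨q', t', p'⟩
      rintro h1 ht hp
      dsimp only at h1 ht hp
      subst h1 ht hp
      rfl
    have key : ∀ i j : Fin (n0 + 1), d i = d j → ¬ i.1 < j.1 := by
      intro i j he hlt
      have e1 : M.run w i.1 = M.run w j.1 := by rw [hd, hd, he]
      have e2 := run_shift e1 (n0 - j.1)
      have hj := j.2
      rw [show j.1 + (n0 - j.1) = n0 by omega, hr] at e2
      have := run_le e2 hs hr
      omega
    have k1 := key i j hdd
    have k2 := key j i hdd.symm
    exact Fin.ext (by omega)
  have := Fintype.card_le_of_injective F hF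
  simpa using this

theorem arith_bound (a S n : ℕ) (h : 2 * a + 6 * S + 4 ≤ n) : a * (S * 3 ^ S) * n ≤ 2 ^ (n - 1) := by
  have h1 : a ≤ 2 ^ a := Nat.lt_two_pow_self.le
  have h2 : S ≤ 2 ^ S := Nat.lt_two_pow_self.le
  have h3 : 3 ^ S ≤ 2 ^ (2 * S) := by
    rw [pow_mul]; exact Nat.pow_le_pow_left (by norm_num) S
  have h4 : n ≤ 2 ^ (n / 2 + 1) := by
    have := Nat.lt_two_pow_self (n := n / 2)
    rw [pow_succ]; omega
  calc a * (S * 3 ^ S) * n ≤ 2 ^ a * (2 ^ S * 2 ^ (2 * S)) * 2 ^ (n / 2 + 1) := by gcongr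
    _ = 2 ^ (a + (S + 2 * S) + (n / 2 + 1)) := by rw [← pow_add, ← pow_add, ← pow_add]
    _ ≤ 2 ^ (n - 1) := Nat.pow_le_pow_right (by norm_num) (by omega)

end time

theorem poly_pow (p : Polynomial ℕ) : ∃ k : ℕ, ∀ n : ℕ, p.eval n ≤ (n + 2) ^ k := by
  induction p using Polynomial.induction_on' with
  | add p q hp hq =>
    obtain ⟨a, ha⟩ := hp
    obtain ⟨b, hb⟩ := hq
    refine ⟨a + b + 1, fun n => ?_⟩
    rw [Polynomial.eval_add]
    have h1 : (n + 2) ^ a ≤ (n + 2) ^ (a + b) := Nat.pow_le_pow_right (by omega) (by omega)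
    have h2 : (n + 2) ^ b ≤ (n + 2) ^ (a + b) := Nat.pow_le_pow_right (by omega) (by omega)
    have h3 := ha n
    have h4 := hb n
    rw [pow_succ]
    nlinarith
  | monomial d c =>
    refine ⟨c + d, fun n => ?_⟩
    rw [Polynomial.eval_monomial, pow_add]
    have h1 : c ≤ (n + 2) ^ c := Nat.lt_two_pow_self.le.trans (Nat.pow_le_pow_left (by omega) c)
    have h2 : n ^ d ≤ (n + 2) ^ d := Nat.pow_le_pow_left (by omega) d
    exact Nat.mul_le_mul h1 h2

/-! ## The payload -/

section payload
variable (M : TM)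

def sym : Sy → Option Bool
  | .U b => some b
  | _ => none

def bit (f : Bool) (a : Sy) (b : ℕ) : Bool :=
  xor (f && decide (b = 1 + M.q0.1)) (decide (so M (sym a) = some b))

def bits (f : Bool) (a : Sy) : List Bool := (List.range (B M)).map (bit M f a)

theorem bits_head (f : Bool) (a : Sy) :
    bits M f a = false :: (List.range (M.nstates + 2)).map (fun b => bit M f a (b + 1)) := by
  unfold bits B
  rw [show M.nstates + 3 = (M.nstates + 2) + 1 from rfl, List.range_succ_eq_map, List.map_cons, List.map_map]
  congr 1
  unfold bit
  have : ¬ so M (sym a) = some 0 := by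
    intro h; have := so_lt M h; omega
  simp [this]
  omega

theorem bits_length (f : Bool) (a : Sy) : (bits M f a).length = B M := by simp [bits]

def dblk (d : Bool) : Blk := (iE, d, false)
def iblk (i : Ins) : Blk := (i, false, false)

/-- The cells, with the first one marked. -/
def cells : List Sy → List (Bool × Sy)
  | [] => []
  | a :: l => (true, a) :: l.map fun a => (false, a)

/-- The word of data bits. -/
def dbits (l : List Sy) : List Bool := (cells l).flatMap fun x => bits M x.1 x.2

noncomputable def pl (l : List Sy) : List Blk :=
  (dbits M l).tail.map dblk ++ (prog M (rules M)).reverse.map iblk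

theorem pt_pl {D : Type} (l : D → List Sy) (hl : ∀ d, l d ≠ []) :
    PT (fun d => sy.encs (l d)) (fun d => blk.encs (pl M (l d))) := by
  refine PT.of_pass (fstT sy (fun f a => blk.encs ((if f then (bits M f a).tail else bits M f a).map dblk))
    (fun _ => blk.encs ((prog M (rules M)).reverse.map iblk))) l _ fun d => ?_
  rcases h : l d with _ | ⟨a, m⟩
  · exact absurd h (hl d)
  refine (fstT_pass sy _ _ _ _).trans ?_
  congr 1
  have e : ∀ m : List Sy, blk.encs ((m.flatMap (bits M false)).map dblk) =
      m.flatMap fun a => blk.encs ((bits M false a).map dblk) := by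
    intro m
    induction m with
    | nil => rfl
    | cons a m ih =>
      rw [List.flatMap_cons, List.map_append, Alph.encs_append, ih, List.flatMap_cons]
  rw [pl, Alph.encs_append, dbits, cells, List.flatMap_cons, List.flatMap_map]
  simp only [bits_head M true, List.cons_append, List.tail_cons, List.map_append,
    if_true, Bool.false_eq_true, if_false]
  rw [Alph.encs_append]
  exact congrArg (fun z => _ ++ z ++ _) (e m).symm

theorem flatMap_get {α : Type} (f : α → List Bool) (m : ℕ) (hm : ∀ a, (f a).length = m) (l : List α)
    (j b : ℕ) (hb : b < m) : (l.flatMap f)[m * j + b]? = l[j]?.bind fun a => (f a)[b]? := by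
  induction l generalizing j with
  | nil => simp
  | cons a l ih =>
    rw [List.flatMap_cons]
    cases j with
    | zero =>
      rw [List.getElem?_append_left (by rw [hm]; omega)]
      simp
    | succ j =>
      rw [List.getElem?_append_right (by rw [hm, Nat.mul_succ]; omega), hm,
        show m * (j + 1) + b - m = m * j + b by rw [Nat.mul_succ]; omega, ih]
      simp

theorem flatMap_len {α : Type} (f : α → List Bool) (m : ℕ) (hm : ∀ a, (f a).length = m) (l : List α) :
    (l.flatMap f).length = m * l.length := by
  induction l with
  | nil => simp
  | cons a l ih => rw [List.flatMap_cons, List.length_append, hm, ih, List.length_cons, Nat.mul_succ, Nat.add_comm]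

theorem cells_length (l : List Sy) : (cells l).length = l.length := by
  cases l <;> simp [cells]

theorem cells_get (l : List Sy) (j : ℕ) : (cells l)[j]? = l[j]?.map fun a => (decide (j = 0), a) := by
  cases l with
  | nil => simp [cells]
  | cons a l => cases j <;> simp [cells]

theorem dbits_length (l : List Sy) : (dbits M l).length = B M * l.length := by
  rw [dbits, flatMap_len _ (B M) (fun a => bits_length M _ _), cells_length]

theorem dbits_getD (l : List Sy) (j b : ℕ) (hb : b < B M) :
    (dbits M l).getD (B M * j + b) false = ((l[j]?.map fun a => bit M (decide (j = 0)) a b).getD false) := by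
  rw [List.getD_eq_getElem?_getD, dbits, flatMap_get _ (B M) (fun a => bits_length M _ _) _ _ _ hb, cells_get]
  rcases l[j]? with _ | a
  · rfl
  · simp [bits, hb]

/-- The padded input. -/
def inp (K : ℕ) (w : List Bool) : List Sy := us w ++ List.replicate K .P

theorem inp_bits (K : ℕ) (hK : 0 < K) (w : List Bool) (j b : ℕ) (hb : b < B M) :
    (dbits M (inp K w)).getD (B M * j + b) false =
      xor (decide (j = 0 ∧ b = 1 + M.q0.1)) (decide (so M w[j]? = some b)) := by
  rw [dbits_getD M _ _ _ hb]
  unfold inp us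
  rcases Nat.lt_or_ge j w.length with h | h
  · rw [List.getElem?_append_left (by simpa using h)]
    simp [h, bit, sym, Bool.decide_and]
    rfl
  · rw [List.getElem?_append_right (by simpa using h), List.getElem?_eq_none h]
    simp only [List.length_map, List.getElem?_replicate]
    split_ifs with h2
    · simp [bit, sym, Bool.decide_and]
      rfl
    · have : j ≠ 0 := by omega
      simp [this, so]

theorem on_list {α : Type} (n : ℕ) (a : α) (l : List α) (z : α) (h : l.length + 1 = n) :
    On (n := n) (fun i => (a :: l).getD i.val z) 0 a l := by
  refine ⟨h, fun k hk => ?_⟩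
  have : NeZero n := ⟨by omega⟩
  rw [zero_add]
  dsimp only
  rw [ZMod.val_natCast_of_lt hk, List.getD_eq_getElem?_getD]
  rw [List.getElem?_eq_getElem (by simp; omega)]
  rfl

variable {M} in
theorem U_correct {w : List Bool} {K S : ℕ} {lo : ℤ}
    (hw : ∀ m c, M.run w m = some c → lo ≤ c.pos ∧ c.pos < lo + S)
    (hK : 2 * S + 2 ≤ K) {n0 : ℕ} {c0 : TMCfg M} (hr : M.run w n0 = some c0)
    (hs : M.stepCfg c0 = none) (L : ℕ) (hL : 12 * (pl M (inp K w)).length ≤ L) :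
    ∃ m y b, U.Ends m L U.s0 (blk.encs (pl M (inp K w))) b y ∧ (b = true ↔ c0.q = M.qacc) := by
  set P := prog M (rules M) with hP
  set W := pl M (inp K w) with hW
  set n := W.length + 1 with hn
  have hinp : (inp K w).length = w.length + K := by simp [inp, us]
  have hdl : (dbits M (inp K w)).length = B M * (w.length + K) := by rw [dbits_length, hinp]
  have hBpos : 0 < B M := by unfold B; omega
  have hpos : 0 < B M * (w.length + K) := Nat.mul_pos hBpos (by omega)
  have hhead : ∃ t, dbits M (inp K w) = false :: t := by
    rcases h : inp K w with _ | ⟨a, l⟩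
    · rw [h] at hinp; simp at hinp; omega
    · exact ⟨_, by rw [dbits, cells, List.flatMap_cons, bits_head, List.cons_append]⟩
  obtain ⟨t, ht⟩ := hhead
  have htl : t.length + 1 = B M * (w.length + K) := by rw [← hdl, ht]; rfl
  have hWe : W = t.map dblk ++ P.reverse.map iblk := by rw [hW, pl, ht]; rfl
  have hnval : n = B M * (w.length + K) + P.length := by
    rw [hn, hWe]; simp; omega
  have hI : iE :: tI W = List.replicate (B M * (w.length + K)) iE ++ P.reverse := by
    rw [← htl, List.replicate_succ, hWe]
    simp [tI, Function.comp_def, dblk, iblk]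
  have hD : false :: tD W = dbits M (inp K w) ++ List.replicate P.length false := by
    rw [ht, hWe]
    simp [tD, Function.comp_def, dblk, iblk]
  have hKv : val (tK W) = 0 := by
    have : tK W = List.replicate W.length false := by
      rw [hWe]
      simp [tK, Function.comp_def, dblk, iblk]
    rw [this]
    generalize W.length = m
    induction m with
    | zero => rfl
    | succ m ih => rw [List.replicate_succ, val, ih]; rfl
  let gI : ZMod n → Ins := fun i => (iE :: tI W).getD i.val iE
  let g : ZMod n → Bool := fun i => (false :: tD W).getD i.val false
  let s : St n := ⟨g, 0, true⟩
  have hNe : NeZero n := ⟨by omega⟩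
  obtain ⟨m, y, b, h1, h2⟩ := ends gI L (2 ^ W.length) 0 s W iE false
    (on_list n _ _ _ (by simp [hn])) (on_list n _ _ _ (by simp [hn])) (by rw [hKv]; simp) hL
  refine ⟨m, y, b, h1, h2.trans ?_⟩
  clear h1 h2
  -- the data ring
  have hg : ∀ y : ℕ, (false :: tD W).getD y false =
      xor (decide (y / B M = 0 ∧ y % B M = 1 + M.q0.1)) (decide (so M w[y / B M]? = some (y % B M))) := by
    intro y
    rw [← inp_bits M K (by omega) w (y / B M) (y % B M) (Nat.mod_lt _ hBpos), Nat.div_add_mod, hD]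
    simp only [List.getD_eq_getElem?_getD, List.getElem?_append]
    split_ifs with h3
    · rfl
    · rw [List.getElem?_replicate, List.getElem?_eq_none (by omega)]
      split_ifs <;> rfl
  have hBS : B M * S ≤ n := by
    rw [hnval]
    exact (Nat.mul_le_mul_left _ (by omega)).trans (Nat.le_add_right _ _)
  have h0 := hw 0 (M.initCfg w) rfl
  have hrel : Rel lo S (M.initCfg w) s := by
    refine ⟨by simp [s, TM.initCfg], fun j hj1 hj2 b hb => ?_⟩
    have h0' : lo ≤ 0 ∧ (0 : ℤ) < lo + S := h0
    show (false :: tD W).getD (ZMod.val (((B M * j + b : ℤ)) : ZMod n)) false = _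
    rw [hg]
    unfold cellbit
    show _ = xor (decide (j = 0 ∧ b = 1 + M.q0.1)) (decide (so M (if j < 0 then none else w[j.toNat]?) = some b))
    rcases lt_or_ge j 0 with hj | hj
    · obtain ⟨k, rfl⟩ : ∃ k : ℕ, j = -(k : ℤ) := ⟨j.natAbs, by omega⟩
      have hk : k < S := by omega
      have hk2 : B M * k ≤ n := (Nat.mul_le_mul_left _ hk.le).trans hBS
      have hk1 : B M ≤ B M * k := Nat.le_mul_of_pos_right _ (by omega)
      have e : ((B M * -(k : ℤ) + b : ℤ) : ZMod n) = ((n - B M * k + b : ℕ) : ZMod n) := by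
        push_cast [Nat.cast_sub hk2]
        rw [ZMod.natCast_self]; ring
      rw [e, ZMod.val_natCast_of_lt (by omega)]
      have hq : w.length + 1 ≤ (n - B M * k + b) / B M := by
        rw [Nat.le_div_iff_mul_le hBpos, Nat.mul_comm]
        have : B M * (w.length + 1) + B M * k ≤ n := by
          rw [← Nat.mul_add, hnval]
          exact (Nat.mul_le_mul_left _ (by omega)).trans (Nat.le_add_right _ _)
        omega
      have hne : ¬ (n - B M * k + b) / B M = 0 := by omega
      have hne2 : ¬ (-(k : ℤ) = 0) := by omega
      rw [List.getElem?_eq_none (by omega), if_pos hj]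
      simp only [hne, hne2, false_and, so]
      simp
    · obtain ⟨k, rfl⟩ : ∃ k : ℕ, j = (k : ℤ) := ⟨j.toNat, by omega⟩
      have hk : k < S := by omega
      have e : ((B M * (k : ℤ) + b : ℤ) : ZMod n) = ((B M * k + b : ℕ) : ZMod n) := by push_cast; rfl
      have hlt : B M * k + b < n := by
        have : B M * (k + 1) ≤ B M * S := Nat.mul_le_mul_left _ hk
        rw [Nat.mul_succ] at this
        omega
      rw [e, ZMod.val_natCast_of_lt hlt, Nat.mul_add_div hBpos, Nat.mul_add_mod, Nat.div_eq_of_lt hb,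
        Nat.mod_eq_of_lt hb, add_zero, if_neg (by omega), Int.toNat_natCast]
      congr 2
      simp
  -- the instruction ring
  set pad := B M * (w.length + K) - 1 with hpad
  have hrl : (rnd M pad).length = n := by
    rw [rnd, hnval]; simp [← hP]; omega
  have hrI : ∀ k (hk : k < (rnd M pad).length), gI (0 - k) = (rnd M pad)[k] := by
    intro k hk
    rw [hrl] at hk
    show (iE :: tI W).getD (ZMod.val ((0 : ZMod n) - (k : ZMod n))) iE = _
    cases k with
    | zero => simp [rnd]
    | succ k =>
      have e : (0 : ZMod n) - ((k + 1 : ℕ) : ZMod n) = ((n - (k + 1) : ℕ) : ZMod n) := by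
        rw [Nat.cast_sub hk.le, ZMod.natCast_self]
      rw [e, ZMod.val_natCast_of_lt (by omega), hI]
      have hrev : List.replicate (B M * (w.length + K)) iE ++ P.reverse =
          (P ++ List.replicate (B M * (w.length + K)) iE).reverse := by simp
      rw [hrev, List.getD_eq_getElem?_getD, List.getElem?_reverse (by simp; omega)]
      have hidx : (P ++ List.replicate (B M * (w.length + K)) iE).length - 1 - (n - (k + 1)) = k := by
        simp; omega
      rw [hidx]
      have hr2 : (rnd M pad)[k + 1]'(by rw [hrl]; exact hk) = ((P ++ List.replicate pad iE)[k]?).getD iE := by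
        rw [List.getElem?_eq_getElem (by simp; omega)]
        rfl
      rw [hr2]
      simp only [List.getElem?_append, List.getElem?_replicate]
      split_ifs <;> simp
  have hnS : 2 * M.nstates + 6 * S + 4 ≤ n := by
    have : (M.nstates + 3) * (2 * S + 2) ≤ B M * (w.length + K) := Nat.mul_le_mul_left _ (by omega)
    nlinarith
  have hT := time_bound hw hr hs
  have hT2 := arith_bound M.nstates S n hnS
  have hT3 : (n0 + 1) * n ≤ 2 ^ W.length := (Nat.mul_le_mul_right _ hT).trans hT2
  have hr1 := (acc_rounds gI 0 (rnd M pad) hrl hrI (n0 + 1) s).trans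
    (rnds_sim hBS hw pad hr hs (n0 + 1) 0 _ rfl s hrel (by omega))
  constructor
  · rintro ⟨t', ht1, ht2⟩
    refine ((acc_rounds gI 0 (rnd M pad) hrl hrI (n0 + 1 + 2 ^ W.length) s).trans
      (rnds_sim hBS hw pad hr hs _ 0 _ rfl s hrel (by omega))).1 ⟨t', ?_, ht2⟩
    nlinarith
  · intro h
    obtain ⟨t', ht1, ht2⟩ := hr1.2 h
    exact ⟨t', by omega, ht2⟩

end payload
end Ring


/-! ## Conclusion -/

namespace Ring

theorem U_total (x : List Bool) :
    ∃ m b y v, U.toQM.HaltsIn m ((12 + U.C) * x.length) x b y v := by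
  obtain ⟨l, r, hx, hr⟩ := blk_split x.length x le_rfl
  have hlen : x.length = 6 * l.length + r.length := by
    rw [hx, List.length_append, Alph.encs_length]
  by_cases h : r = []
  · subst h
    rw [List.append_nil] at hx
    obtain ⟨m, y, b, h1, -⟩ := ends (n := l.length + 1) (fun i => (iE :: tI l).getD i.val iE)
      ((12 + U.C) * x.length) _ 0 ⟨fun i => (false :: tD l).getD i.val false, 0, true⟩ l iE false
      (on_list _ _ _ _ (by simp)) (on_list _ _ _ _ (by simp)) rfl (by rw [hlen]; nlinarith)
    rw [← hx] at h1
    obtain ⟨k, -, h2⟩ := Tr.Ends.halts (T := U) h1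
    exact ⟨k, b, y, [], h2⟩
  · obtain ⟨m, y, v, h1⟩ := Tr.partial_halts (T := U) (l := l) (r := r) (L := (12 + U.C) * x.length) h hr (by
      rw [hlen]; show 6 * l.length + r.length + U.C * l.length ≤ _; nlinarith)
    rw [← hx] at h1
    exact ⟨m, false, y, v, h1⟩

noncomputable abbrev AA : CA 3 := U.toQM.toCA

theorem Fenc_inj {x y : List Bool} (h : Fenc x = Fenc y) : x = y := by
  have := (Chk.Fenc_parse y (x.length + 1) (x ++ [true, false, false])).1 h
  exact List.append_cancel_right this.1

theorem good_vec (v : Fin 3 → ℕ) (hv : v 1 = 0 ∧ v 2 = 0 ∧ v 0 ≠ 0) :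
    ∃ x, v = cv false (num x) 0 0 := by
  obtain ⟨x, hx⟩ := num_surj _ hv.2.2
  refine ⟨x, ?_⟩
  funext j
  fin_cases j
  · exact hx.symm
  · exact hv.1
  · exact hv.2.1

theorem mem_lang (u : List Bool) : (∃ v : Fin 3 → ℕ, u = encodeVec v ∧ AA.ZeroReach v) ↔
    ∃ x, u = Fenc x ∧ AA.ZeroReach (cv false (num x) 0 0) := by
  constructor
  · rintro ⟨v, h1, h2⟩
    by_cases hv : v 1 = 0 ∧ v 2 = 0 ∧ v 0 ≠ 0
    · obtain ⟨x, rfl⟩ := good_vec v hv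
      exact ⟨x, by rw [Fenc_eq]; exact h1, h2⟩
    · exact absurd h2 (QM.toCA_bad v hv).1
  · rintro ⟨x, h1, h2⟩
    exact ⟨_, by rw [← Fenc_eq]; exact h1, h2⟩

theorem space : ∃ p : Polynomial ℕ, ∀ v : Fin 3 → ℕ,
    AA.SpaceBounded v (Polynomial.eval (∑ j, Nat.size (v j)) p) := by
  refine ⟨Polynomial.C (13 + U.C) * Polynomial.X + Polynomial.C 3, fun v c hc j => ?_⟩
  simp only [Polynomial.eval_add, Polynomial.eval_mul, Polynomial.eval_C, Polynomial.eval_X]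
  by_cases hv : v 1 = 0 ∧ v 2 = 0 ∧ v 0 ≠ 0
  · obtain ⟨x, rfl⟩ := good_vec v hv
    obtain ⟨m, b, y, w, h⟩ := U_total x
    have h1 := (QM.toCA_spec h).2 c hc j
    have h2 : Nat.size (c.2 j) ≤ (12 + U.C) * x.length + 3 := by
      rw [Nat.size_le]
      exact lt_of_le_of_lt h1 (Nat.pow_lt_pow_right (by norm_num) (by omega))
    have h3 : x.length + 1 ≤ ∑ j, Nat.size (cv false (num x) 0 0 j) := by
      refine le_trans ?_ (Finset.single_le_sum (f := fun j => Nat.size (cv false (num x) 0 0 j))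
        (fun _ _ => Nat.zero_le _) (Finset.mem_univ 0))
      show x.length + 1 ≤ Nat.size (num x)
      rw [← Nat.size_eq_bits_len, num_bits]
      simp
    refine h2.trans ?_
    have : (12 + U.C) * x.length ≤ (13 + U.C) * ∑ j, Nat.size (cv false (num x) 0 0 j) :=
      Nat.mul_le_mul (by omega) (by omega)
    omega
  · have h1 := (QM.toCA_bad v hv).2 c hc j
    have h3 : Nat.size (v j) ≤ ∑ j, Nat.size (v j) :=
      Finset.single_le_sum (f := fun j => Nat.size (v j)) (fun _ _ => Nat.zero_le _) (Finset.mem_univ j)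
    have h2 : Nat.size (c.2 j) ≤ Nat.size (v j) + 1 := by
      rw [Nat.size_le, pow_succ]
      have := Nat.lt_size_self (v j)
      omega
    have h4 : 1 * ∑ j, Nat.size (v j) ≤ (13 + U.C) * ∑ j, Nat.size (v j) :=
      Nat.mul_le_mul_right _ (by omega)
    omega

theorem in_pspace : InPSpace {u | ∃ v : Fin 3 → ℕ, u = encodeVec v ∧ AA.ZeroReach v} := by
  obtain ⟨K, p, hK⟩ := Chk.spec
  refine QM.inPSpace (K.comp U.toQM) _ (p + Polynomial.C (12 + U.C) * Polynomial.X) fun u => ?_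
  simp only [Polynomial.eval_add, Polynomial.eval_mul, Polynomial.eval_C, Polynomial.eval_X,
    Set.mem_ofPred_eq, mem_lang]
  obtain ⟨n, L, hL, ⟨x, hx, h1⟩ | ⟨hx, y, v, h1⟩⟩ := hK u
  · obtain ⟨m, b, y, w, h2⟩ := U_total x
    have hlen : x.length ≤ u.length := by rw [hx, Fenc]; simp; omega
    refine ⟨_, L + (12 + U.C) * u.length, b, y, w, by omega,
      (h1.mono (by omega)).comp_true (h2.mono ?_), ?_⟩
    · have := Nat.mul_le_mul_left (12 + U.C) hlen
      omega
    · rw [← (QM.toCA_spec h2).1]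
      constructor
      · exact fun h => ⟨x, hx, h⟩
      · rintro ⟨x', h3, h4⟩
        rw [Fenc_inj (hx.symm.trans h3)]
        exact h4
  · refine ⟨n, L, false, y, v, by omega, h1.comp_false, ?_⟩
    simp only [Bool.false_eq_true, false_iff]
    rintro ⟨x, h2, -⟩
    exact hx ⟨x, h2⟩

theorem hard : PSpaceHard {u | ∃ v : Fin 3 → ℕ, u = encodeVec v ∧ AA.ZeroReach v} := by
  rintro L' ⟨M, ⟨p, hp⟩, hM⟩
  obtain ⟨k, hk⟩ := poly_pow (2 * p + 2)
  have e1 : PT (fun w => w) (fun w => sy.encs (inp ((w.length + 2) ^ k) w)) := pt_pad k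
  have e2 : PT (fun w => sy.encs (inp ((w.length + 2) ^ k) w))
      (fun w => blk.encs (pl M (inp ((w.length + 2) ^ k) w))) := by
    refine pt_pl M (fun w : List Bool => inp ((w.length + 2) ^ k) w) fun w h => ?_
    have := congrArg List.length h
    have hpos : 0 < (w.length + 2) ^ k := Nat.pow_pos (by omega)
    simp [inp] at this
  have e3 := pt_Fenc.pullback (fun w : List Bool => blk.encs (pl M (inp ((w.length + 2) ^ k) w)))
  refine ⟨_, ((e1.comp e2).comp e3).poly, fun w => ?_⟩
  obtain ⟨lo, hlo⟩ := hp w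
  obtain ⟨n0, c0, hr, hs, hacc⟩ := hM w
  have hkw := hk w.length
  simp only [Polynomial.eval_add, Polynomial.eval_mul, Polynomial.eval_ofNat] at hkw
  obtain ⟨m, y, b, h1, h2⟩ := U_correct hlo hkw hr hs _ le_rfl
  obtain ⟨m', -, h3⟩ := Tr.Ends.halts (T := U) h1
  have h4 := (QM.toCA_spec h3).1
  rw [← hacc, ← h2, ← h4, Set.mem_ofPred_eq, mem_lang]
  constructor
  · exact fun h => ⟨_, rfl, h⟩
  · rintro ⟨x, h5, h6⟩
    rw [Fenc_inj h5]
    exact h6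

end Ring

theorem fixed_three_counter_automaton_pspace_complete :
    ∃ A : CA 3, A.Deterministic ∧
      (∃ p : Polynomial ℕ, ∀ v : Fin 3 → ℕ,
        A.SpaceBounded v (Polynomial.eval (∑ j, Nat.size (v j)) p)) ∧
      PSpaceComplete {u : List Bool | ∃ v : Fin 3 → ℕ, u = encodeVec v ∧ A.ZeroReach v} := by
  exact ⟨Ring.AA, QM.toCA_det _, Ring.space, Ring.in_pspace, Ring.hard⟩
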